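/- arXiv:1210.6271 — 2 statements merged into one kernel-verified Lean document; each statement's English description precedes it below -/
import Mathlib

section
/- Let v be a vector field satisfying the Beltrami equation curl v = λv, with λ a nonzero real constant, in an open neighborhood of a compact set S ⊂ ℝ³ whose complement ℝ³∖S is connected. Then for any δ > 0 and any positive integer k there exists a vector field u satisfying curl u = λu in all of ℝ³, decaying at infinity as |D^j u(x)| < C_j/|x| for all j, and approximating v as ‖u − v‖_{C^k(S)} < δ. -/
open Filter Topology MeasureTheory Real
open scoped RealInnerProductSpace

set_option linter.unusedVariables false
noncomputable section

/-- Euclidean three-space `ℝ³`. -/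
abbrev E3 := EuclideanSpace ℝ (Fin 3)

/-- Partial derivative of a scalar function on `ℝ³` in the `i`-th coordinate direction. -/
def pd (i : Fin 3) (f : E3 → ℝ) (x : E3) : ℝ :=
  fderiv ℝ f x (EuclideanSpace.single i 1)

/-- The curl of a vector field on `ℝ³`. -/
def curl3 (v : E3 → E3) (x : E3) : E3 :=
  (EuclideanSpace.equiv (Fin 3) ℝ).symm
    ![pd 1 (fun z => v z 2) x - pd 2 (fun z => v z 1) x,
      pd 2 (fun z => v z 0) x - pd 0 (fun z => v z 2) x,
      pd 0 (fun z => v z 1) x - pd 1 (fun z => v z 0) x]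

/-- The divergence of a vector field on `ℝ³`. -/
def div3 (v : E3 → E3) (x : E3) : ℝ := ∑ i, pd i (fun z => v z i) x

/-- The gradient of a scalar function on `ℝ³`. -/
def grad3 (f : E3 → ℝ) (x : E3) : E3 :=
  (EuclideanSpace.equiv (Fin 3) ℝ).symm ![pd 0 f x, pd 1 f x, pd 2 f x]

/-- The (Euclidean) Laplacian of a scalar function on `ℝ³`. -/
def lap3 (f : E3 → ℝ) (x : E3) : ℝ := ∑ i, pd i (pd i f) x

/-! ### Partial derivatives -/

open scoped ContDiff

lemma pd_congr {f g : E3 → ℝ} {x : E3} (h : f =ᶠ[𝓝 x] g) (i : Fin 3) : pd i f x = pd i g x := by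
  unfold pd; rw [h.fderiv_eq]

lemma pd_eventually_congr {f g : E3 → ℝ} {x : E3} (h : f =ᶠ[𝓝 x] g) (i : Fin 3) :
    pd i f =ᶠ[𝓝 x] pd i g := by
  filter_upwards [eventually_eventually_nhds.2 h] with y hy using pd_congr hy i

lemma lap_congr {f g : E3 → ℝ} {x : E3} (h : f =ᶠ[𝓝 x] g) : lap3 f x = lap3 g x := by
  unfold lap3
  exact Finset.sum_congr rfl fun i _ => pd_congr (pd_eventually_congr h i) i

lemma pd_contDiffAt {f : E3 → ℝ} {x : E3} (h : ContDiffAt ℝ ∞ f x) (i : Fin 3) :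
    ContDiffAt ℝ ∞ (pd i f) x := by
  unfold pd
  exact (h.fderiv_right (m := ∞) (by simp)).clm_apply contDiffAt_const

lemma pd_contDiff {f : E3 → ℝ} (h : ContDiff ℝ ∞ f) (i : Fin 3) :
    ContDiff ℝ ∞ (pd i f) :=
  contDiff_iff_contDiffAt.2 fun x => pd_contDiffAt h.contDiffAt i

lemma lap_contDiffAt {f : E3 → ℝ} {x : E3} (h : ContDiffAt ℝ ∞ f x) :
    ContDiffAt ℝ ∞ (lap3 f) x := by
  unfold lap3
  exact ContDiffAt.sum fun i _ => pd_contDiffAt (pd_contDiffAt h i) i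

lemma lap_contDiff {f : E3 → ℝ} (h : ContDiff ℝ ∞ f) :
    ContDiff ℝ ∞ (lap3 f) :=
  contDiff_iff_contDiffAt.2 fun x => lap_contDiffAt h.contDiffAt

lemma pd_tsupport (f : E3 → ℝ) (i : Fin 3) : tsupport (pd i f) ⊆ tsupport f := by
  refine closure_minimal ?_ (isClosed_tsupport f)
  intro x hx
  by_contra h
  apply hx
  have : f =ᶠ[𝓝 x] fun _ => 0 := by
    exact notMem_tsupport_iff_eventuallyEq.1 h
  rw [pd_congr this]; simp [pd]

lemma pd_compact {f : E3 → ℝ} (h : HasCompactSupport f) (i : Fin 3) :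
    HasCompactSupport (pd i f) :=
  h.of_isClosed_subset (isClosed_tsupport _) (pd_tsupport f i)

lemma lap_tsupport (f : E3 → ℝ) : tsupport (lap3 f) ⊆ tsupport f := by
  refine closure_minimal ?_ (isClosed_tsupport f)
  intro x hx
  by_contra h
  apply hx
  have : f =ᶠ[𝓝 x] fun _ => 0 := by
    exact notMem_tsupport_iff_eventuallyEq.1 h
  rw [lap_congr this]
  have h0 : ∀ i, pd i (fun _ : E3 => (0:ℝ)) = fun _ => 0 := by
    intro i; ext y; simp [pd]
  simp [lap3, h0]

lemma lap_compact {f : E3 → ℝ} (h : HasCompactSupport f) : HasCompactSupport (lap3 f) :=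
  h.of_isClosed_subset (isClosed_tsupport _) (lap_tsupport f)

lemma pd_add {f g : E3 → ℝ} {x : E3} (hf : DifferentiableAt ℝ f x) (hg : DifferentiableAt ℝ g x)
    (i : Fin 3) : pd i (fun z => f z + g z) x = pd i f x + pd i g x := by
  unfold pd; rw [fderiv_fun_add hf hg]; rfl

lemma pd_sub {f g : E3 → ℝ} {x : E3} (hf : DifferentiableAt ℝ f x) (hg : DifferentiableAt ℝ g x)
    (i : Fin 3) : pd i (fun z => f z - g z) x = pd i f x - pd i g x := by
  unfold pd; rw [fderiv_fun_sub hf hg]; rfl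

lemma pd_const_mul {f : E3 → ℝ} {x : E3} (hf : DifferentiableAt ℝ f x) (c : ℝ)
    (i : Fin 3) : pd i (fun z => c * f z) x = c * pd i f x := by
  unfold pd; rw [fderiv_const_mul hf]; simp

lemma cda_diff {f : E3 → ℝ} {x : E3} (h : ContDiffAt ℝ ∞ f x) : DifferentiableAt ℝ f x :=
  h.differentiableAt (by simp)

lemma cda_ev {f : E3 → ℝ} {x : E3} (h : ContDiffAt ℝ ∞ f x) :
    ∀ᶠ y in 𝓝 x, DifferentiableAt ℝ f y := by
  have h1 : ContDiffAt ℝ 1 f x := h.of_le (by simp)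
  filter_upwards [h1.eventually (by simp)] with y hy using hy.differentiableAt (by simp)

lemma lap_sub {f g : E3 → ℝ} {x : E3} (hf : ContDiffAt ℝ ∞ f x) (hg : ContDiffAt ℝ ∞ g x) :
    lap3 (fun z => f z - g z) x = lap3 f x - lap3 g x := by
  unfold lap3
  rw [← Finset.sum_sub_distrib]
  refine Finset.sum_congr rfl fun i _ => ?_
  rw [← pd_sub (cda_diff (pd_contDiffAt hf i)) (cda_diff (pd_contDiffAt hg i))]
  apply pd_congr
  filter_upwards [cda_ev hf, cda_ev hg] with y h1 h2 using pd_sub h1 h2 i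

lemma pd_comm {f : E3 → ℝ} {x : E3} (h : ContDiffAt ℝ ∞ f x) (i j : Fin 3) :
    pd i (pd j f) x = pd j (pd i f) x := by
  have hs : IsSymmSndFDerivAt ℝ f x := h.isSymmSndFDerivAt (by simp; exact WithTop.coe_le_coe.2 (le_top : (2 : ℕ∞) ≤ ⊤))
  have hd : DifferentiableAt ℝ (fderiv ℝ f) x :=
    (h.fderiv_right (m := ∞) (by simp)).differentiableAt (by simp)
  have key : ∀ a b : Fin 3, pd a (pd b f) x =
      fderiv ℝ (fderiv ℝ f) x (EuclideanSpace.single a 1) (EuclideanSpace.single b 1) := by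
    intro a b
    unfold pd
    rw [fderiv_clm_apply hd (by fun_prop)]
    simp
  rw [key, key]
  exact hs _ _

/-- reflection and translation -/
lemma pd_const_sub (f : E3 → ℝ) (x y : E3) (i : Fin 3) :
    pd i (fun z => f (x - z)) y = - pd i f (x - y) := by
  unfold pd
  have h1 : fderiv ℝ (fun z => f (x - z)) y = fderiv ℝ (fun z => f (x + z)) (-y) ∘L
      (-ContinuousLinearMap.id ℝ E3) := by
    have := (ContinuousLinearEquiv.neg ℝ (M := E3)).comp_right_fderiv
      (f := fun z => f (x + z)) (x := y)
    simp only [Function.comp_def, ContinuousLinearEquiv.neg_apply, ← sub_eq_add_neg] at this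
    rw [this]; ext z; simp
  rw [h1, fderiv_comp_add_left]
  simp [sub_eq_add_neg]

lemma pd_neg (f : E3 → ℝ) (y : E3) (i : Fin 3) :
    pd i (fun z => - f z) y = - pd i f y := by
  unfold pd; rw [fderiv_fun_neg]; rfl

lemma lap_const_sub (f : E3 → ℝ) (x y : E3) :
    lap3 (fun z => f (x - z)) y = lap3 f (x - y) := by
  unfold lap3
  refine Finset.sum_congr rfl fun i _ => ?_
  have : pd i (fun z => f (x - z)) = fun y => - pd i f (x - y) := by
    ext y; exact pd_const_sub f x y i
  rw [this, pd_neg, pd_const_sub, neg_neg]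

/-! ### integration by parts -/

lemma ibp_pd {f g : E3 → ℝ} (hf : ContDiff ℝ ∞ f) (hg : ContDiff ℝ ∞ g) (hc : HasCompactSupport g)
    (i : Fin 3) : ∫ x, f x * pd i g x = - ∫ x, pd i f x * g x := by
  have cf := hf.continuous
  have cg := hg.continuous
  have cf' := (pd_contDiff hf i).continuous
  have cg' := (pd_contDiff hg i).continuous
  refine integral_mul_fderiv_eq_neg_fderiv_mul_of_integrable ?_ ?_ ?_ ?_ ?_
  · exact (cf'.mul cg).integrable_of_hasCompactSupport hc.mul_left
  · exact (cf.mul cg').integrable_of_hasCompactSupport (pd_compact hc i).mul_left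
  · exact (cf.mul cg).integrable_of_hasCompactSupport hc.mul_left
  · exact fun x _ => cda_diff hf.contDiffAt
  · exact fun x _ => cda_diff hg.contDiffAt

lemma ibp_lap {f g : E3 → ℝ} (hf : ContDiff ℝ ∞ f) (hg : ContDiff ℝ ∞ g)
    (hc : HasCompactSupport g) : ∫ x, f x * lap3 g x = ∫ x, lap3 f x * g x := by
  have e : ∀ i, ∫ x, f x * pd i (pd i g) x = ∫ x, pd i (pd i f) x * g x := by
    intro i
    rw [ibp_pd hf (pd_contDiff hg i) (pd_compact hc i), ibp_pd (pd_contDiff hf i) hg hc, neg_neg]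
  unfold lap3
  simp_rw [Finset.mul_sum, Finset.sum_mul]
  rw [integral_finsetSum, integral_finsetSum]
  · exact Finset.sum_congr rfl fun i _ => e i
  · intro i _
    exact ((pd_contDiff (pd_contDiff hf i) i).continuous.mul
      hg.continuous).integrable_of_hasCompactSupport hc.mul_left
  · intro i _
    exact (hf.continuous.mul (pd_contDiff (pd_contDiff hg i) i).continuous
      ).integrable_of_hasCompactSupport (pd_compact (pd_compact hc i) i).mul_left

/-! ### radial functions -/

lemma pd_radial {f : ℝ → ℝ} {f1 e : ℝ} {x : E3} (h : HasDerivAt f f1 (‖x‖ ^ 2 + e ^ 2))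
    (i : Fin 3) : pd i (fun z => f (‖z‖ ^ 2 + e ^ 2)) x = 2 * x i * f1 := by
  unfold pd
  have h1 : HasFDerivAt (fun z : E3 => ‖z‖ ^ 2 + e ^ 2) (2 • (innerSL ℝ x)) x :=
    (hasStrictFDerivAt_norm_sq x).hasFDerivAt.add_const _
  have := h.comp_hasFDerivAt x h1
  rw [show (fun z : E3 => f (‖z‖ ^ 2 + e ^ 2)) = f ∘ (fun z : E3 => ‖z‖ ^ 2 + e ^ 2) from rfl,
    this.fderiv]
  simp [EuclideanSpace.inner_single_right]
  ring

lemma pd_coord (x : E3) (i : Fin 3) : pd i (fun z => z i) x = 1 := by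
  unfold pd
  have : HasFDerivAt (fun z : E3 => z i) (EuclideanSpace.proj i : E3 →L[ℝ] ℝ) x :=
    (EuclideanSpace.proj i : E3 →L[ℝ] ℝ).hasFDerivAt
  rw [this.fderiv]; simp

lemma lap_radial {f f1 f2 : ℝ → ℝ} {e : ℝ} {x : E3} (hx : 0 < ‖x‖ ^ 2 + e ^ 2)
    (h : ∀ q > 0, HasDerivAt f (f1 q) q) (h' : ∀ q > 0, HasDerivAt f1 (f2 q) q) :
    lap3 (fun z => f (‖z‖ ^ 2 + e ^ 2)) x =
      6 * f1 (‖x‖ ^ 2 + e ^ 2) + 4 * ‖x‖ ^ 2 * f2 (‖x‖ ^ 2 + e ^ 2) := by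
  have hev : ∀ᶠ z : E3 in 𝓝 x, 0 < ‖z‖ ^ 2 + e ^ 2 :=
    (isOpen_lt continuous_const (by fun_prop)).mem_nhds hx
  have key : ∀ i, pd i (pd i (fun z => f (‖z‖ ^ 2 + e ^ 2))) x =
      2 * f1 (‖x‖ ^ 2 + e ^ 2) + 4 * (x i) ^ 2 * f2 (‖x‖ ^ 2 + e ^ 2) := by
    intro i
    have e1 : pd i (fun z => f (‖z‖ ^ 2 + e ^ 2)) =ᶠ[𝓝 x]
        fun z => (2 * z i) * f1 (‖z‖ ^ 2 + e ^ 2) := by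
      filter_upwards [hev] with z hz using pd_radial (h _ hz) i
    rw [pd_congr e1]
    have d1 : DifferentiableAt ℝ (fun z : E3 => f1 (‖z‖ ^ 2 + e ^ 2)) x := by
      refine (h' _ hx).differentiableAt.comp x (f := fun z : E3 => ‖z‖ ^ 2 + e ^ 2) ?_
      exact ((hasStrictFDerivAt_norm_sq x).hasFDerivAt.add_const _).differentiableAt
    have d2 : DifferentiableAt ℝ (fun z : E3 => z i) x :=
      (EuclideanSpace.proj i : E3 →L[ℝ] ℝ).differentiableAt
    have p1 := pd_radial (h' _ hx) i
    have p2 := pd_coord x i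
    unfold pd at p1 p2 ⊢
    rw [fderiv_fun_mul (d2.const_mul 2) d1, fderiv_const_mul d2]
    simp only [add_apply, smul_apply, p1, p2, smul_eq_mul]
    ring
  unfold lap3
  have hn : ‖x‖ ^ 2 = ∑ i, (x i) ^ 2 := by
    rw [EuclideanSpace.norm_sq_eq]; simp
  simp_rw [key]
  rw [hn, Fin.sum_univ_three, Fin.sum_univ_three]
  ring

/-- radial profile as a function of the squared radius -/
def prof (lam a b q : ℝ) : ℝ := (a * cos (lam * √q) + b * sin (lam * √q)) / √q

/-- regularised kernel -/
def hker (lam a b e : ℝ) (x : E3) : ℝ := prof lam a b (‖x‖ ^ 2 + e ^ 2)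

lemma prof_d1 (lam a b q : ℝ) (hq : 0 < q) : HasDerivAt (prof lam a b)
    (lam * (-a * sin (lam * √q) + b * cos (lam * √q)) / (2 * √q ^ 2)
      - (a * cos (lam * √q) + b * sin (lam * √q)) / (2 * √q ^ 3)) q := by
  have hs : 0 < √q := sqrt_pos.2 hq
  have h0 := hasDerivAt_sqrt hq.ne'
  have h1 : HasDerivAt (fun q => lam * √q) (lam * (1 / (2 * √q))) q := h0.const_mul lam
  have h2 := (((h1.cos).const_mul a).add ((h1.sin).const_mul b)).div h0 hs.ne'
  refine h2.congr_deriv ?_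
  simp only [Pi.add_apply]
  field_simp

lemma prof_d2 (lam a b q : ℝ) (hq : 0 < q) : HasDerivAt
    (fun q => lam * (-a * sin (lam * √q) + b * cos (lam * √q)) / (2 * √q ^ 2)
      - (a * cos (lam * √q) + b * sin (lam * √q)) / (2 * √q ^ 3))
    (- lam ^ 2 * (a * cos (lam * √q) + b * sin (lam * √q)) / (4 * √q ^ 3)
      - 3 * lam * (-a * sin (lam * √q) + b * cos (lam * √q)) / (4 * √q ^ 4)
      + 3 * (a * cos (lam * √q) + b * sin (lam * √q)) / (4 * √q ^ 5)) q := by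
  have hs : 0 < √q := sqrt_pos.2 hq
  have h0 := hasDerivAt_sqrt hq.ne'
  have h1 : HasDerivAt (fun q => lam * √q) (lam * (1 / (2 * √q))) q := h0.const_mul lam
  have hC := ((h1.cos).const_mul a).add ((h1.sin).const_mul b)
  have hD := ((((h1.sin).const_mul (-a)).add ((h1.cos).const_mul b)).const_mul lam)
  have h2 := (hD.div ((h0.pow 2).const_mul 2) (by simp only [Pi.pow_apply]; positivity)).sub
    (hC.div ((h0.pow 3).const_mul 2) (by simp only [Pi.pow_apply]; positivity))
  refine h2.congr_deriv ?_
  simp only [Pi.add_apply, Pi.pow_apply]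
  field_simp
  ring

lemma hker_lap (lam a b e : ℝ) (x : E3) (hx : 0 < ‖x‖ ^ 2 + e ^ 2) :
    lap3 (hker lam a b e) x + lam ^ 2 * hker lam a b e x =
      e ^ 2 * (
        lam ^ 2 * (a * cos (lam * √(‖x‖ ^ 2 + e ^ 2)) + b * sin (lam * √(‖x‖ ^ 2 + e ^ 2)))
          / √(‖x‖ ^ 2 + e ^ 2) ^ 3
        + 3 * lam * (-a * sin (lam * √(‖x‖ ^ 2 + e ^ 2)) + b * cos (lam * √(‖x‖ ^ 2 + e ^ 2)))
          / √(‖x‖ ^ 2 + e ^ 2) ^ 4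
        - 3 * (a * cos (lam * √(‖x‖ ^ 2 + e ^ 2)) + b * sin (lam * √(‖x‖ ^ 2 + e ^ 2)))
          / √(‖x‖ ^ 2 + e ^ 2) ^ 5) := by
  unfold hker
  rw [lap_radial hx (prof_d1 lam a b) (prof_d2 lam a b)]
  have hs : 0 < √(‖x‖ ^ 2 + e ^ 2) := sqrt_pos.2 hx
  have hx2 : ‖x‖ ^ 2 = √(‖x‖ ^ 2 + e ^ 2) ^ 2 - e ^ 2 := by
    rw [sq_sqrt hx.le]; ring
  rw [show 4 * ‖x‖ ^ 2 = 4 * (√(‖x‖ ^ 2 + e ^ 2) ^ 2 - e ^ 2) by rw [← hx2]]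
  unfold prof
  generalize √(‖x‖ ^ 2 + e ^ 2) = s at *
  generalize cos (lam * s) = C
  generalize sin (lam * s) = D
  field_simp
  ring

lemma hker_contDiffAt (lam a b e : ℝ) (x : E3) (hx : 0 < ‖x‖ ^ 2 + e ^ 2) :
    ContDiffAt ℝ ∞ (hker lam a b e) x := by
  unfold hker prof
  have h1 : ContDiffAt ℝ ∞ (fun z : E3 => √(‖z‖ ^ 2 + e ^ 2)) x :=
    ContDiffAt.sqrt ((contDiff_norm_sq ℝ).contDiffAt.add contDiffAt_const) hx.ne'
  have h2 : ContDiffAt ℝ ∞ (fun z : E3 => lam * √(‖z‖ ^ 2 + e ^ 2)) x :=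
    contDiffAt_const.mul h1
  exact ((contDiffAt_const.mul h2.cos).add (contDiffAt_const.mul h2.sin)).div h1
    (sqrt_pos.2 hx).ne'

open scoped ContDiff

/-- the normalisation constant -/
def cst : ℝ := 3 * ∫ y : E3, 1 / √(‖y‖ ^ 2 + 1) ^ 5

lemma int_s4 : Integrable (fun y : E3 => 1 / √(‖y‖ ^ 2 + 1) ^ 4) := by
  have h := integrable_rpow_neg_one_add_norm_sq (E := E3) (μ := volume) (r := 4) (by simp; norm_num)
  refine h.congr (Eventually.of_forall fun y => ?_)
  have hp : (0:ℝ) ≤ ‖y‖ ^ 2 + 1 := by positivity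
  simp only
  rw [show √(‖y‖ ^ 2 + 1) ^ 4 = (√(‖y‖ ^ 2 + 1) ^ 2) ^ 2 by ring, sq_sqrt hp,
    show (-4 / 2 : ℝ) = -((2:ℕ) : ℝ) by norm_num, rpow_neg (by positivity), rpow_natCast,
    one_div, add_comm]

lemma one_le_s (y : E3) : 1 ≤ √(‖y‖ ^ 2 + 1) := by
  rw [one_le_sqrt]; nlinarith [sq_nonneg ‖y‖]

lemma int_s5 : Integrable (fun y : E3 => 1 / √(‖y‖ ^ 2 + 1) ^ 5) := by
  refine int_s4.mono' ?_ (Eventually.of_forall fun y => ?_)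
  · apply Measurable.aestronglyMeasurable; fun_prop
  · have := one_le_s y
    rw [Real.norm_eq_abs, abs_of_nonneg (by positivity)]
    gcongr
    norm_num

lemma cst_pos : 0 < cst := by
  unfold cst
  have : 0 < ∫ y : E3, 1 / √(‖y‖ ^ 2 + 1) ^ 5 := by
    rw [integral_pos_iff_support_of_nonneg (fun y => by positivity) int_s5]
    have : Function.support (fun y : E3 => 1 / √(‖y‖ ^ 2 + 1) ^ 5) = Set.univ := by
      ext y
      have := one_le_s y
      simp only [Function.mem_support, Set.mem_univ, iff_true]
      positivity
    rw [this]; simp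
  positivity

lemma hker_zero (lam a b : ℝ) (x : E3) :
    hker lam a b 0 x = (a * cos (lam * ‖x‖) + b * sin (lam * ‖x‖)) / ‖x‖ := by
  simp [hker, prof]

lemma trig_bound (a b t : ℝ) : |a * cos t + b * sin t| ≤ |a| + |b| := by
  calc |a * cos t + b * sin t| ≤ |a * cos t| + |b * sin t| := abs_add_le _ _
    _ ≤ |a| * 1 + |b| * 1 := by
        rw [abs_mul, abs_mul]; gcongr
        · exact abs_cos_le_one t
        · exact abs_sin_le_one t
    _ = _ := by ring

lemma trig_bound' (a b t : ℝ) : |-a * sin t + b * cos t| ≤ |a| + |b| := by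
  have := trig_bound b (-a) t
  rw [abs_neg] at this
  rw [add_comm, add_comm |a|]; exact this

lemma hker_bound (lam a b e : ℝ) (x : E3) (hx : x ≠ 0) :
    |hker lam a b e x| ≤ (|a| + |b|) * ‖x‖ ^ (-1 : ℝ) := by
  have hn : 0 < ‖x‖ := norm_pos_iff.2 hx
  unfold hker prof
  rw [abs_div, rpow_neg_one, ← div_eq_mul_inv, abs_of_nonneg (sqrt_nonneg _)]
  have : ‖x‖ ≤ √(‖x‖ ^ 2 + e ^ 2) := by
    apply le_sqrt_of_sq_le; nlinarith [sq_nonneg e]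
  gcongr
  exact trig_bound _ _ _

lemma hker_meas (lam a b e : ℝ) : Measurable (hker lam a b e) := by
  unfold hker prof; fun_prop

lemma E3_ae_ne : ∀ᵐ x : E3, x ≠ 0 := by
  rw [ae_iff]; simp

lemma hker_locInt (lam a b e : ℝ) : LocallyIntegrable (hker lam a b e) := by
  refine locallyIntegrable_of_norm_le_rpow (C := |a| + |b|) (α := 1) (by simp) (by simp) ?_
    (hker_meas _ _ _ _).aestronglyMeasurable
  filter_upwards [E3_ae_ne] with x hx using hker_bound lam a b e x hx

lemma norm_inv_locInt : LocallyIntegrable (fun x : E3 => ‖x‖ ^ (-1 : ℝ)) := by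
  refine locallyIntegrable_of_norm_le_rpow (C := 1) (α := 1) (by simp) (by simp) ?_
    (by apply Measurable.aestronglyMeasurable; fun_prop)
  refine Eventually.of_forall fun x => ?_
  rw [one_mul, Real.norm_eq_abs, abs_of_nonneg (by positivity)]

/-- the Helmholtz operator -/
def Lop (lam : ℝ) (f : E3 → ℝ) (x : E3) : ℝ := lap3 f x + lam ^ 2 * f x

lemma Lop_contDiff {lam : ℝ} {f : E3 → ℝ} (hf : ContDiff ℝ ∞ f) : ContDiff ℝ ∞ (Lop lam f) :=
  (lap_contDiff hf).add (contDiff_const.mul hf)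

lemma Lop_tsupport (lam : ℝ) (f : E3 → ℝ) : tsupport (Lop lam f) ⊆ tsupport f := by
  refine closure_minimal ?_ (isClosed_tsupport f)
  intro x hx
  by_contra h
  apply hx
  have h1 : lap3 f x = 0 := image_eq_zero_of_notMem_tsupport (fun h' => h (lap_tsupport f h'))
  have h2 : f x = 0 := image_eq_zero_of_notMem_tsupport h
  simp [Lop, h1, h2]

lemma Lop_compact {lam : ℝ} {f : E3 → ℝ} (h : HasCompactSupport f) :
    HasCompactSupport (Lop lam f) :=
  h.of_isClosed_subset (isClosed_tsupport _) (Lop_tsupport lam f)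

lemma Lop_congr {lam : ℝ} {f g : E3 → ℝ} {x : E3} (h : f =ᶠ[𝓝 x] g) :
    Lop lam f x = Lop lam g x := by
  simp [Lop, lap_congr h, h.eq_of_nhds]

lemma ibp_Lop {lam : ℝ} {f g : E3 → ℝ} (hf : ContDiff ℝ ∞ f) (hg : ContDiff ℝ ∞ g)
    (hc : HasCompactSupport g) : ∫ x, f x * Lop lam g x = ∫ x, Lop lam f x * g x := by
  unfold Lop
  have c1 := hf.continuous
  have c2 := hg.continuous
  have c3 := (lap_contDiff hf).continuous
  have c4 := (lap_contDiff hg).continuous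
  simp_rw [mul_add, add_mul]
  rw [integral_add, integral_add, ibp_lap hf hg hc]
  · congr 1
    congr 1; ext x; ring
  · exact (c3.mul c2).integrable_of_hasCompactSupport hc.mul_left
  · exact ((continuous_const.mul c1).mul c2).integrable_of_hasCompactSupport hc.mul_left
  · exact (c1.mul c4).integrable_of_hasCompactSupport (lap_compact hc).mul_left
  · exact (c1.mul (continuous_const.mul c2)).integrable_of_hasCompactSupport
      (hc.mul_left).mul_left

lemma hker_contDiff (lam a b e : ℝ) (he : 0 < e) : ContDiff ℝ ∞ (hker lam a b e) :=
  contDiff_iff_contDiffAt.2 fun x => hker_contDiffAt _ _ _ _ _ (by positivity)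

/-- the rescaled integrand -/
def resc (lam a b e : ℝ) (ψ : E3 → ℝ) (y : E3) : ℝ :=
  (e ^ 2 * (lam ^ 2 * (a * cos (lam * (e * √(‖y‖ ^ 2 + 1))) + b * sin (lam * (e * √(‖y‖ ^ 2 + 1))))
      / √(‖y‖ ^ 2 + 1) ^ 3)
    + e * (3 * lam * (-a * sin (lam * (e * √(‖y‖ ^ 2 + 1))) + b * cos (lam * (e * √(‖y‖ ^ 2 + 1))))
      / √(‖y‖ ^ 2 + 1) ^ 4)
    - 3 * (a * cos (lam * (e * √(‖y‖ ^ 2 + 1))) + b * sin (lam * (e * √(‖y‖ ^ 2 + 1))))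
      / √(‖y‖ ^ 2 + 1) ^ 5) * ψ (e • y)

lemma resc_eq (lam a b e : ℝ) (he : 0 < e) {ψ : E3 → ℝ} (hψ : ContDiff ℝ ∞ ψ)
    (hc : HasCompactSupport ψ) :
    ∫ x, hker lam a b e x * Lop lam ψ x = ∫ y, resc lam a b e ψ y := by
  rw [ibp_Lop (hker_contDiff lam a b e he) hψ hc]
  have h := Measure.integral_comp_smul (volume : Measure E3)
    (fun x => Lop lam (hker lam a b e) x * ψ x) e
  have hf : Module.finrank ℝ E3 = 3 := by simp
  rw [hf, abs_of_pos (by positivity), smul_eq_mul] at h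
  have h2 : ∫ x, Lop lam (hker lam a b e) x * ψ x =
      e ^ 3 * ∫ x, Lop lam (hker lam a b e) (e • x) * ψ (e • x) := by
    rw [h]; field_simp
  rw [h2, ← integral_const_mul]
  congr 1; ext y
  unfold Lop
  rw [hker_lap _ _ _ _ _ (by positivity)]
  have hs : √(‖e • y‖ ^ 2 + e ^ 2) = e * √(‖y‖ ^ 2 + 1) := by
    rw [norm_smul, Real.norm_eq_abs, abs_of_pos he,
      show (e * ‖y‖) ^ 2 + e ^ 2 = e ^ 2 * (‖y‖ ^ 2 + 1) by ring, sqrt_mul (by positivity),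
      sqrt_sq he.le]
  rw [hs]
  unfold resc
  have := one_le_s y
  generalize √(‖y‖ ^ 2 + 1) = s at *
  field_simp

lemma resc_bound (lam a b : ℝ) {ψ : E3 → ℝ} {M r : ℝ} (hr0 : 0 < r) (hM : ∀ x, |ψ x| ≤ M)
    (hr : ∀ x, ψ x ≠ 0 → ‖x‖ ≤ r) (e : ℝ) (he : 0 < e) (he1 : e ≤ 1) (y : E3) :
    |resc lam a b e ψ y| ≤
      ((|a| + |b|) * (lam ^ 2 * (r + 1) + 3 * |lam| + 3) * M) * (1 / √(‖y‖ ^ 2 + 1) ^ 4) := by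
  have hM0 : 0 ≤ M := (abs_nonneg _).trans (hM 0)
  by_cases h0 : ψ (e • y) = 0
  · have hs := one_le_s y
    unfold resc
    rw [h0, mul_zero, abs_zero]
    positivity
  · have hs := one_le_s y
    have hy := hr _ h0
    rw [norm_smul, Real.norm_eq_abs, abs_of_pos he] at hy
    have hes : e * √(‖y‖ ^ 2 + 1) ≤ r + 1 := by
      have : √(‖y‖ ^ 2 + 1) ≤ ‖y‖ + 1 := by
        rw [sqrt_le_left (by positivity)]; nlinarith [norm_nonneg y]
      nlinarith
    unfold resc
    rw [abs_mul]
    have b1 := trig_bound a b (lam * (e * √(‖y‖ ^ 2 + 1)))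
    have b2 := trig_bound' a b (lam * (e * √(‖y‖ ^ 2 + 1)))
    have b3 := hM (e • y)
    generalize a * cos (lam * (e * √(‖y‖ ^ 2 + 1))) + b * sin (lam * (e * √(‖y‖ ^ 2 + 1))) = C at *
    generalize -a * sin (lam * (e * √(‖y‖ ^ 2 + 1))) + b * cos (lam * (e * √(‖y‖ ^ 2 + 1))) = D at *
    generalize √(‖y‖ ^ 2 + 1) = s at *
    have hA : 0 ≤ |a| + |b| := by positivity
    generalize |a| + |b| = A at *
    have hs0 : 0 < s := by linarith
    have k1 : |e ^ 2 * (lam ^ 2 * C / s ^ 3)| ≤ A * (lam ^ 2 * (r + 1)) * (1 / s ^ 4) := by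
      rw [show e ^ 2 * (lam ^ 2 * C / s ^ 3) = C * (lam ^ 2 * (e * (e * s))) * (1 / s ^ 4) by
        field_simp]
      rw [abs_mul, abs_mul, abs_of_nonneg (show 0 ≤ lam ^ 2 * (e * (e * s)) by positivity),
        abs_of_nonneg (show 0 ≤ 1 / s ^ 4 by positivity)]
      gcongr
      nlinarith [mul_pos he hs0]
    have k2 : |e * (3 * lam * D / s ^ 4)| ≤ A * (3 * |lam|) * (1 / s ^ 4) := by
      rw [show e * (3 * lam * D / s ^ 4) = D * (3 * (e * lam)) * (1 / s ^ 4) by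
        field_simp]
      rw [abs_mul, abs_mul, abs_mul, abs_mul, abs_of_pos he,
        abs_of_nonneg (show 0 ≤ 1 / s ^ 4 by positivity), abs_of_pos (show (0:ℝ) < 3 by norm_num)]
      gcongr
      nlinarith [abs_nonneg lam]
    have k3 : |3 * C / s ^ 5| ≤ A * 3 * (1 / s ^ 4) := by
      rw [show 3 * C / s ^ 5 = C * (3 * (1 / s)) * (1 / s ^ 4) by
        field_simp]
      rw [abs_mul, abs_mul, abs_of_nonneg (show 0 ≤ 1 / s ^ 4 by positivity),
        abs_of_nonneg (show 0 ≤ 3 * (1 / s) by positivity)]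
      gcongr
      have : 1 / s ≤ 1 := by rw [div_le_one hs0]; exact hs
      linarith
    calc _ ≤ (A * (lam ^ 2 * (r + 1)) * (1 / s ^ 4) + A * (3 * |lam|) * (1 / s ^ 4)
          + A * 3 * (1 / s ^ 4)) * M := by
            gcongr
            exact (abs_sub _ _).trans (add_le_add ((abs_add_le _ _).trans (add_le_add k1 k2)) k3)
      _ = _ := by ring

theorem fund (lam a b : ℝ) {ψ : E3 → ℝ} (hψ : ContDiff ℝ ∞ ψ) (hc : HasCompactSupport ψ) :
    ∫ x, hker lam a b 0 x * Lop lam ψ x = - cst * a * ψ 0 := by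
  let e : ℕ → ℝ := fun n => 1 / ((n : ℝ) + 1)
  have he0 : ∀ n, 0 < e n := fun n => by positivity
  have he1 : ∀ n, e n ≤ 1 := fun n => by
    simp only [e]; rw [div_le_one (by positivity)]; linarith [n.cast_nonneg (α := ℝ)]
  have het : Tendsto e atTop (𝓝 0) := tendsto_one_div_add_atTop_nhds_zero_nat
  have hLc := (Lop_contDiff (lam := lam) hψ).continuous
  have t1 : Tendsto (fun n => ∫ x, hker lam a b (e n) x * Lop lam ψ x) atTop
      (𝓝 (∫ x, hker lam a b 0 x * Lop lam ψ x)) := by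
    refine tendsto_integral_of_dominated_convergence
      (fun x => (|a| + |b|) * (‖x‖ ^ (-1 : ℝ) * ‖Lop lam ψ x‖)) ?_ ?_ ?_ ?_
    · intro n
      exact ((hker_meas _ _ _ _).mul hLc.measurable).aestronglyMeasurable
    · apply Integrable.const_mul
      have := norm_inv_locInt.integrable_smul_right_of_hasCompactSupport hLc.norm
        (Lop_compact (lam := lam) hc).norm
      exact this
    · intro n
      filter_upwards [E3_ae_ne] with x hx
      rw [norm_mul, ← mul_assoc]
      gcongr
      exact hker_bound lam a b (e n) x hx
    · filter_upwards [E3_ae_ne] with x hx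
      refine Tendsto.mul_const _ ?_
      have : ContinuousAt (fun t => hker lam a b t x) 0 := by
        unfold hker prof
        have hn : 0 < ‖x‖ := norm_pos_iff.2 hx
        refine ContinuousAt.div (by fun_prop) (by fun_prop) ?_
        simp [hx]
      exact this.tendsto.comp het
  obtain ⟨M, hM⟩ := hc.exists_bound_of_continuous hψ.continuous
  obtain ⟨r, hr0, hr⟩ := hc.isBounded.exists_pos_norm_le
  have hr' : ∀ x, ψ x ≠ 0 → ‖x‖ ≤ r := fun x hx => hr x (subset_tsupport _ hx)
  have t2 : Tendsto (fun n => ∫ y, resc lam a b (e n) ψ y) atTop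
      (𝓝 (∫ y, resc lam a b 0 ψ y)) := by
    refine tendsto_integral_of_dominated_convergence
      (fun y => ((|a| + |b|) * (lam ^ 2 * (r + 1) + 3 * |lam| + 3) * M) *
        (1 / √(‖y‖ ^ 2 + 1) ^ 4)) ?_ (int_s4.const_mul _) ?_ ?_
    · intro n
      have := hψ.continuous.measurable
      unfold resc
      apply Measurable.aestronglyMeasurable; fun_prop
    · intro n
      refine Eventually.of_forall fun y => ?_
      exact resc_bound lam a b hr0 hM hr' (e n) (he0 n) (he1 n) y
    · refine Eventually.of_forall fun y => ?_
      have : Continuous (fun t => resc lam a b t ψ y) := by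
        have := hψ.continuous
        unfold resc
        fun_prop
      exact (this.tendsto 0).comp het
  have t3 : ∀ n, ∫ x, hker lam a b (e n) x * Lop lam ψ x = ∫ y, resc lam a b (e n) ψ y :=
    fun n => resc_eq lam a b (e n) (he0 n) hψ hc
  simp_rw [t3] at t1
  rw [tendsto_nhds_unique t1 t2]
  have : ∀ y, resc lam a b 0 ψ y = (-(3 * a) * ψ 0) * (1 / √(‖y‖ ^ 2 + 1) ^ 5) := by
    intro y; unfold resc; simp; ring
  simp_rw [this]
  rw [integral_const_mul, cst]; ring

lemma Lop_const_sub (lam : ℝ) (f : E3 → ℝ) (x y : E3) :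
    Lop lam (fun z => f (x - z)) y = Lop lam f (x - y) := by
  simp [Lop, lap_const_sub]

theorem fund_at (lam a b : ℝ) {ψ : E3 → ℝ} (hψ : ContDiff ℝ ∞ ψ) (hc : HasCompactSupport ψ)
    (x : E3) :
    ∫ y, hker lam a b 0 y * Lop lam ψ (x - y) = - cst * a * ψ x := by
  have h1 : ContDiff ℝ ∞ (fun z => ψ (x - z)) := hψ.comp (contDiff_const.sub contDiff_id)
  have h2 : HasCompactSupport (fun z => ψ (x - z)) :=
    hc.comp_homeomorph (Homeomorph.subLeft x)
  have := fund lam a b h1 h2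
  simp_rw [Lop_const_sub, sub_zero] at this
  exact this


/-! ### Convolutions -/
open scoped ContDiff

/-- convolution of a scalar function with a vector valued one -/
def cv {F : Type} [NormedAddCommGroup F] [NormedSpace ℝ F] (g : E3 → ℝ) (ψ : E3 → F) (x : E3) : F :=
  ∫ y, g y • ψ (x - y)

section
variable {F : Type} [NormedAddCommGroup F] [NormedSpace ℝ F]

lemma cv_eq (g : E3 → ℝ) (ψ : E3 → F) :
    cv g ψ = convolution g ψ (ContinuousLinearMap.lsmul ℝ ℝ) volume := rfl

lemma cv_contDiff {g : E3 → ℝ} {ψ : E3 → F} (hg : LocallyIntegrable g) (hψ : ContDiff ℝ ∞ ψ)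
    (hc : HasCompactSupport ψ) : ContDiff ℝ ∞ (cv g ψ) := by
  rw [cv_eq]
  exact hc.contDiff_convolution_right (n := ⊤) (ContinuousLinearMap.lsmul ℝ ℝ) hg hψ

lemma cv_hasFDerivAt {g : E3 → ℝ} {ψ : E3 → F} (hg : LocallyIntegrable g) (hψ : ContDiff ℝ ∞ ψ)
    (hc : HasCompactSupport ψ) (x : E3) : HasFDerivAt (cv g ψ) (cv g (fderiv ℝ ψ) x) x := by
  have h := hc.hasFDerivAt_convolution_right (ContinuousLinearMap.lsmul ℝ ℝ) hg
    (hψ.of_le (by simp)) x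
  have e : cv g (fderiv ℝ ψ) x = convolution g (fderiv ℝ ψ)
      (ContinuousLinearMap.precompR E3 (ContinuousLinearMap.lsmul ℝ ℝ)) volume x := by
    unfold cv convolution
    congr 1
  rw [cv_eq, e]
  exact h

lemma cv_integrable {g : E3 → ℝ} {ψ : E3 → F} (hg : LocallyIntegrable g) (hψ : Continuous ψ)
    (hc : HasCompactSupport ψ) (x : E3) : Integrable (fun y => g y • ψ (x - y)) :=
  hg.integrable_smul_right_of_hasCompactSupport (hψ.comp (continuous_const.sub continuous_id))
    (hc.comp_homeomorph (Homeomorph.subLeft x))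

end

theorem cv_iter_bound {g : E3 → ℝ} (hg : LocallyIntegrable g) (n : ℕ) :
    ∀ {F : Type} [NormedAddCommGroup F] [NormedSpace ℝ F] {ψ : E3 → F} (hψ : ContDiff ℝ ∞ ψ)
    (hc : HasCompactSupport ψ) (x : E3), ‖iteratedFDeriv ℝ n (cv g ψ) x‖ ≤
      ∫ y, ‖g y‖ * ‖iteratedFDeriv ℝ n ψ (x - y)‖ := by
  induction n with
  | zero =>
    intro F _ _ ψ hψ hc x
    simp only [norm_iteratedFDeriv_zero]
    refine (norm_integral_le_integral_norm _).trans (le_of_eq ?_)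
    simp [norm_smul]
  | succ n ih =>
    intro F _ _ ψ hψ hc x
    simp_rw [← norm_iteratedFDeriv_fderiv]
    have : fderiv ℝ (cv g ψ) = cv g (fderiv ℝ ψ) := by
      ext1 y; exact (cv_hasFDerivAt hg hψ hc y).fderiv
    rw [this]
    exact ih (hψ.fderiv_right (by simp)) (hc.fderiv ℝ) x

lemma cv_pd {g ψ : E3 → ℝ} (hg : LocallyIntegrable g) (hψ : ContDiff ℝ ∞ ψ)
    (hc : HasCompactSupport ψ) (i : Fin 3) : pd i (cv g ψ) = cv g (pd i ψ) := by
  ext x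
  unfold pd
  rw [(cv_hasFDerivAt hg hψ hc x).fderiv]
  unfold cv
  rw [ContinuousLinearMap.integral_apply]
  · rfl
  · exact cv_integrable hg (hψ.continuous_fderiv (by simp)) (hc.fderiv ℝ) x

lemma cv_Lop {lam : ℝ} {g ψ : E3 → ℝ} (hg : LocallyIntegrable g) (hψ : ContDiff ℝ ∞ ψ)
    (hc : HasCompactSupport ψ) (x : E3) : Lop lam (cv g ψ) x = cv g (Lop lam ψ) x := by
  unfold Lop lap3
  simp_rw [cv_pd hg hψ hc, fun i => cv_pd hg (pd_contDiff hψ i) (pd_compact hc i)]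
  unfold cv
  simp_rw [smul_add, Finset.smul_sum]
  have i1 : ∀ i ∈ (Finset.univ : Finset (Fin 3)),
      Integrable fun y => g y • pd i (pd i ψ) (x - y) := fun i _ =>
    cv_integrable hg (pd_contDiff (pd_contDiff hψ i) i).continuous
      (pd_compact (pd_compact hc i) i) x
  rw [integral_add (integrable_finsetSum _ i1), integral_finsetSum _ i1, ← integral_const_mul]
  · congr 2
    ext y; simp only [smul_eq_mul]; ring
  · have hm : HasCompactSupport (fun z => lam ^ 2 * ψ z) :=
      HasCompactSupport.mul_left (f := fun _ => lam ^ 2) hc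
    exact cv_integrable hg (continuous_const.mul hψ.continuous) hm x

/-- the regular kernel -/
def Jk (lam : ℝ) : E3 → ℝ := hker lam 0 1 0

lemma Jk_locInt (lam : ℝ) : LocallyIntegrable (Jk lam) := hker_locInt _ _ _ _

lemma Jk_bound (lam : ℝ) (x : E3) (hx : x ≠ 0) : ‖Jk lam x‖ ≤ ‖x‖⁻¹ := by
  have := hker_bound lam 0 1 0 x hx
  simpa [Jk, rpow_neg_one] using this

theorem cvJ_Lop (lam : ℝ) {ψ : E3 → ℝ} (hψ : ContDiff ℝ ∞ ψ) (hc : HasCompactSupport ψ) (x : E3) :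
    Lop lam (cv (Jk lam) ψ) x = 0 := by
  rw [cv_Lop (Jk_locInt lam) hψ hc]
  have := fund_at lam 0 1 hψ hc x
  simpa [cv, Jk] using this

theorem cvJ_decay (lam : ℝ) {ψ : E3 → ℝ} (hψ : ContDiff ℝ ∞ ψ) (hc : HasCompactSupport ψ) (j : ℕ) :
    ∃ C > (0 : ℝ), ∀ x : E3, ‖x‖ * ‖iteratedFDeriv ℝ j (cv (Jk lam) ψ) x‖ ≤ C := by
  have hu := cv_contDiff (Jk_locInt lam) hψ hc
  obtain ⟨r, hr0, hr⟩ := hc.isBounded.exists_pos_norm_le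
  have hcont : Continuous fun x => ‖x‖ * ‖iteratedFDeriv ℝ j (cv (Jk lam) ψ) x‖ :=
    continuous_norm.mul (hu.continuous_iteratedFDeriv (by exact_mod_cast le_top)).norm
  obtain ⟨C1, hC1⟩ := (isCompact_closedBall (0 : E3) (2 * r)).exists_bound_of_continuousOn
    hcont.continuousOn
  have hDc : Continuous (iteratedFDeriv ℝ j ψ) :=
    hψ.continuous_iteratedFDeriv (by exact_mod_cast le_top)
  have hDs : HasCompactSupport (iteratedFDeriv ℝ j ψ) := hc.iteratedFDeriv j
  set I := ∫ y, ‖iteratedFDeriv ℝ j ψ y‖ with hI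
  have hI0 : 0 ≤ I := integral_nonneg fun _ => norm_nonneg _
  refine ⟨|C1| + 2 * I + 1, by positivity, fun x => ?_⟩
  by_cases hx : ‖x‖ ≤ 2 * r
  · have := hC1 x (by simpa using hx)
    rw [Real.norm_eq_abs] at this
    have h1 := le_abs_self (‖x‖ * ‖iteratedFDeriv ℝ j (cv (Jk lam) ψ) x‖)
    have h2 := le_abs_self C1
    linarith
  · push Not at hx
    have hx0 : 0 < ‖x‖ := by linarith
    have key : ∫ y, ‖Jk lam y‖ * ‖iteratedFDeriv ℝ j ψ (x - y)‖ ≤ (2 / ‖x‖) * I := by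
      have : (2 / ‖x‖) * I = ∫ y, (2 / ‖x‖) * ‖iteratedFDeriv ℝ j ψ (x - y)‖ := by
        rw [integral_const_mul, hI, ← integral_sub_left_eq_self _ volume x]
      rw [this]
      refine integral_mono_of_nonneg (Eventually.of_forall fun _ => by positivity) ?_ ?_
      · refine Integrable.const_mul ?_ _
        exact ((hDc.comp (continuous_const.sub continuous_id)).norm
          ).integrable_of_hasCompactSupport (hDs.comp_homeomorph (Homeomorph.subLeft x)).norm
      · refine Eventually.of_forall fun y => ?_
        simp only
        by_cases h0 : iteratedFDeriv ℝ j ψ (x - y) = 0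
        · simp [h0]
        · have h1 : x - y ∈ tsupport ψ :=
            (tsupport_iteratedFDeriv_subset (𝕜 := ℝ) (f := ψ) j) (subset_tsupport _ h0)
          have h2 := hr _ h1
          have h3 : ‖x‖ / 2 ≤ ‖y‖ := by
            have := norm_sub_norm_le x y
            linarith
          have hy : y ≠ 0 := by
            rw [← norm_pos_iff]; linarith
          gcongr
          refine (Jk_bound lam y hy).trans ?_
          rw [inv_eq_one_div, div_le_div_iff₀ (by linarith) hx0]
          linarith
    have h1 := (cv_iter_bound (Jk_locInt lam) j hψ hc x).trans key
    calc ‖x‖ * ‖iteratedFDeriv ℝ j (cv (Jk lam) ψ) x‖ ≤ ‖x‖ * ((2 / ‖x‖) * I) := by gcongr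
      _ = 2 * I := by field_simp
      _ ≤ _ := by linarith [abs_nonneg C1]


/-! ### Interior estimates -/
open scoped ContDiff

theorem exists_kappa (lam ε : ℝ) (hε : 0 < ε) :
    ∃ κ : E3 → ℝ, ContDiff ℝ ∞ κ ∧ HasCompactSupport κ ∧ (∀ y, κ y ≠ 0 → ‖y‖ < ε) ∧
      ∀ W : E3 → ℝ, ContDiff ℝ ∞ W → ∀ x, (∀ z ∈ Metric.ball x ε, Lop lam W z = 0) →
        W x = ∫ y, κ y * W (x - y) := by
  let χ : ContDiffBump (0 : E3) := ⟨ε / 4, ε / 2, by positivity, by linarith⟩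
  let N : E3 → ℝ := fun y => (1 - χ y) * hker lam 1 0 0 y
  have hχ0 : ∀ y, ε / 2 ≤ ‖y‖ → χ y = 0 := fun y hy => χ.zero_of_le_dist (by simpa using hy)
  have hN : ContDiff ℝ ∞ N := by
    rw [contDiff_iff_contDiffAt]
    intro y
    by_cases hy : ‖y‖ < ε / 4
    · have : N =ᶠ[𝓝 y] fun _ => 0 := by
        have : Metric.ball (0 : E3) (ε / 4) ∈ 𝓝 y := Metric.isOpen_ball.mem_nhds (by simpa using hy)
        filter_upwards [this] with z hz
        have : χ z = 1 := χ.one_of_mem_closedBall (Metric.ball_subset_closedBall hz)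
        simp [N, this]
      exact contDiffAt_const.congr_of_eventuallyEq this
    · push Not at hy
      have hy0 : 0 < ‖y‖ := by linarith
      exact (contDiffAt_const.sub χ.contDiff.contDiffAt).mul
        (hker_contDiffAt _ _ _ _ _ (by positivity))
  have hsupp : ∀ y, Lop lam N y ≠ 0 → ‖y‖ ≤ ε / 2 := by
    intro y hy
    by_contra h
    push Not at h
    apply hy
    have : N =ᶠ[𝓝 y] hker lam 1 0 0 := by
      have : {z : E3 | ε / 2 < ‖z‖} ∈ 𝓝 y :=
        (isOpen_lt continuous_const continuous_norm).mem_nhds h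
      filter_upwards [this] with z hz
      simp [N, hχ0 z (le_of_lt hz)]
    rw [Lop_congr this, Lop, hker_lap]
    · simp
    · have : 0 < ‖y‖ := by linarith
      positivity
  have hcst := cst_pos
  refine ⟨fun y => -(1 / cst) * Lop lam N y, contDiff_const.mul (Lop_contDiff hN), ?_, ?_, ?_⟩
  · refine HasCompactSupport.of_support_subset_isCompact (isCompact_closedBall (0 : E3) (ε / 2)) ?_
    intro y hy
    have : Lop lam N y ≠ 0 := fun h => hy (by simp [h])
    simpa using hsupp y this
  · intro y hy
    have : Lop lam N y ≠ 0 := fun h => hy (by simp [h])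
    have := hsupp y this
    linarith
  · intro W hW x hx
    let b : ContDiffBump x := ⟨2 * ε, 3 * ε, by positivity, by linarith⟩
    let V : E3 → ℝ := fun z => b z * W z
    have hV : ContDiff ℝ ∞ V := b.contDiff.mul hW
    have hVc : HasCompactSupport V := b.hasCompactSupport.mul_right
    have hVW : ∀ z ∈ Metric.ball x (2 * ε), V z = W z := by
      intro z hz
      simp [V, b.one_of_mem_closedBall (Metric.ball_subset_closedBall hz)]
    have hLV : ∀ z ∈ Metric.ball x ε, Lop lam V z = 0 := by
      intro z hz
      have : V =ᶠ[𝓝 z] W := by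
        have : Metric.ball x (2 * ε) ∈ 𝓝 z := Metric.isOpen_ball.mem_nhds
          (Metric.ball_subset_ball (by linarith) hz)
        filter_upwards [this] with y hy using hVW y hy
      rw [Lop_congr this]; exact hx z hz
    have h1 := fund_at lam 1 0 hV hVc x
    have h2 : ∀ y, hker lam 1 0 0 y * Lop lam V (x - y) = N y * Lop lam V (x - y) := by
      intro y
      by_cases hy : ‖y‖ < ε
      · rw [hLV (x - y) (by simpa [Metric.mem_ball, dist_eq_norm] using hy)]; simp
      · push Not at hy
        simp [N, hχ0 y (by linarith)]
    simp_rw [h2, ← Lop_const_sub] at h1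
    rw [ibp_Lop hN (g := fun z => V (x - z)) (hV.comp (contDiff_const.sub contDiff_id))
      (hVc.comp_homeomorph (Homeomorph.subLeft x))] at h1
    rw [hVW x (by simp [hε])] at h1
    have h3 : ∀ y, Lop lam N y * V (x - y) = Lop lam N y * W (x - y) := by
      intro y
      by_cases h : Lop lam N y = 0
      · simp [h]
      · have := hsupp y h
        rw [hVW]
        simp [Metric.mem_ball, dist_eq_norm]; linarith
    simp_rw [h3] at h1
    simp_rw [mul_assoc, integral_const_mul]
    rw [h1]; field_simp

theorem interior_est (lam ε : ℝ) (hε : 0 < ε) (k : ℕ) : ∃ C > (0 : ℝ), ∀ K : Set E3, IsCompact K →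
    ∀ W : E3 → ℝ, ContDiff ℝ ∞ W → (∀ z ∈ K, Lop lam W z = 0) →
    ∀ x, Metric.ball x (2 * ε) ⊆ K → ∀ j ≤ k,
      ‖iteratedFDeriv ℝ j W x‖ ≤ C * ∫ y in K, ‖W y‖ := by
  obtain ⟨κ, hκ, hκc, hκs, hrep⟩ := exists_kappa lam ε hε
  have hb : ∀ j : ℕ, ∃ M, ∀ y, ‖iteratedFDeriv ℝ j κ y‖ ≤ M := fun j =>
    (hκc.iteratedFDeriv j).exists_bound_of_continuous
      (hκ.continuous_iteratedFDeriv (by exact_mod_cast le_top))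
  choose M hM using hb
  refine ⟨∑ j ∈ Finset.range (k + 1), |M j| + 1, by positivity, ?_⟩
  intro K hK W hW hLW x hx j hj
  have hIntg : Integrable (K.indicator W) := by
    rw [integrable_indicator_iff hK.measurableSet]
    exact hW.continuous.continuousOn.integrableOn_compact hK
  have hev : W =ᶠ[𝓝 x] cv (K.indicator W) κ := by
    filter_upwards [Metric.ball_mem_nhds x hε] with z hz
    have hsub : Metric.ball z ε ⊆ K := fun y hy => hx (by
      simp only [Metric.mem_ball] at *
      linarith [dist_triangle y z x])
    rw [hrep W hW z fun y hy => hLW y (hsub hy)]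
    unfold cv
    rw [← integral_sub_left_eq_self _ volume z]
    congr 1; ext y
    simp only [sub_sub_cancel, smul_eq_mul]
    by_cases h : κ (z - y) = 0
    · simp [h]
    · have : y ∈ K := hsub (by
        have := hκs _ h
        rw [Metric.mem_ball, dist_comm, dist_eq_norm]; exact this)
      rw [Set.indicator_of_mem this, mul_comm]
  rw [(hev.iteratedFDeriv ℝ j).eq_of_nhds]
  refine (cv_iter_bound hIntg.locallyIntegrable j hκ hκc x).trans ?_
  have hMj : |M j| ≤ ∑ j ∈ Finset.range (k + 1), |M j| + 1 := by
    have := Finset.single_le_sum (f := fun j => |M j|) (s := Finset.range (k + 1))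
      (fun i _ => abs_nonneg _) (Finset.mem_range.2 (Nat.lt_succ_of_le hj))
    linarith
  calc ∫ y, ‖K.indicator W y‖ * ‖iteratedFDeriv ℝ j κ (x - y)‖
      ≤ ∫ y, ‖K.indicator W y‖ * (∑ j ∈ Finset.range (k + 1), |M j| + 1) := by
        refine integral_mono_of_nonneg (Eventually.of_forall fun _ => by positivity)
          (hIntg.norm.mul_const _) (Eventually.of_forall fun y => ?_)
        simp only
        gcongr
        exact (hM j _).trans ((le_abs_self _).trans hMj)
    _ = _ := by
        rw [integral_mul_const, mul_comm]
        congr 1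
        simp_rw [norm_indicator_eq_indicator_norm]
        rw [integral_indicator hK.measurableSet]


/-! ### Topology -/

theorem exists_gamma (S A : Set E3) (hS : IsCompact S) (hScompl : IsConnected Sᶜ)
    (hA : IsCompact A) (hAS : A ⊆ Sᶜ) :
    ∃ Γ : Set E3, IsPreconnected Γ ∧ A ⊆ Γ ∧ ∃ ε > (0 : ℝ),
      (∀ x ∈ Γ, ∀ s ∈ S, ε < dist x s) ∧ ∀ R : ℝ, ∃ p ∈ Γ, R < ‖p‖ := by
  obtain ⟨r, hr0, hr⟩ := hS.isBounded.exists_pos_norm_le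
  have hopen : IsOpen Sᶜ := hS.isClosed.isOpen_compl
  have hpc : IsPathConnected Sᶜ := hopen.isConnected_iff_isPathConnected.1 hScompl
  -- base ray
  let e0 : E3 := EuclideanSpace.single 0 1
  have he0 : ‖e0‖ = 1 := by simp [e0]
  let ray : Set E3 := (fun t : ℝ => t • e0) '' Set.Ici (r + 1)
  let p : E3 := (r + 1) • e0
  have hray : IsPreconnected ray :=
    isPreconnected_Ici.image _ (by fun_prop)
  have hpray : p ∈ ray := ⟨r + 1, Set.self_mem_Ici, rfl⟩
  have hrayd : ∀ x ∈ ray, ∀ s ∈ S, 1 ≤ dist x s := by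
    rintro _ ⟨t, ht, rfl⟩ s hs
    have h1 := hr s hs
    have ht' : r + 1 ≤ t := ht
    have h2 : ‖t • e0‖ = t := by
      rw [norm_smul, he0, mul_one, Real.norm_eq_abs, abs_of_nonneg (by linarith)]
    have := norm_sub_norm_le (t • e0) s
    rw [dist_eq_norm]; simp only at *; linarith
  have hpS : p ∈ Sᶜ := fun h => by
    have := hrayd p hpray p h
    simp at this; linarith
  -- local pieces
  have hloc : ∀ a ∈ A, ∃ G : Set E3, IsPreconnected G ∧ IsCompact G ∧ G ⊆ Sᶜ ∧ p ∈ G ∧ G ∈ 𝓝 a := by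
    intro a ha
    obtain ⟨d, hd, hball⟩ := Metric.nhds_basis_closedBall.mem_iff.1 (hopen.mem_nhds (hAS ha))
    have hj : JoinedIn Sᶜ a p := hpc.joinedIn a (hAS ha) p hpS
    obtain ⟨γ, hγ⟩ := hj
    refine ⟨Metric.closedBall a d ∪ Set.range γ, ?_, ?_, ?_, ?_, ?_⟩
    · refine IsPreconnected.union a (by simp [hd.le]) ⟨0, by simp⟩ ?_ ?_
      · exact (convex_closedBall a d).isPreconnected
      · exact isPreconnected_range γ.continuous
    · exact (isCompact_closedBall a d).union (isCompact_range γ.continuous)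
    · exact Set.union_subset hball (by rintro _ ⟨t, rfl⟩; exact hγ t)
    · exact Or.inr ⟨1, by simp⟩
    · exact mem_of_superset (Metric.closedBall_mem_nhds a hd) Set.subset_union_left
  choose! G hG1 hG2 hG3 hG4 hG5 using hloc
  obtain ⟨T, hTA, hT⟩ := hA.elim_nhds_subcover G hG5
  let Γ0 : Set E3 := ⋃ a ∈ T, G a
  have hΓ0c : IsCompact Γ0 := T.isCompact_biUnion fun a ha => hG2 a (hTA a ha)
  have hΓ0S : Γ0 ⊆ Sᶜ := Set.iUnion₂_subset fun a ha => hG3 a (hTA a ha)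
  have hdisj : Disjoint Γ0 S := Set.disjoint_left.2 fun x hx hs => hΓ0S hx hs
  obtain ⟨d, hd, hdd⟩ : ∃ d > (0 : ℝ), ∀ x ∈ Γ0, ∀ s ∈ S, d < dist x s := by
    obtain ⟨d, hd, h⟩ := Metric.exists_pos_forall_lt_edist hΓ0c hS.isClosed hdisj
    refine ⟨d, hd, fun x hx s hs => ?_⟩
    have := h x hx s hs
    rw [edist_nndist] at this
    exact_mod_cast this
  refine ⟨Γ0 ∪ ray, ?_, fun x hx => Or.inl (hT hx), min d (1 / 2), by positivity, ?_, ?_⟩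
  · have : Γ0 ∪ ray = ⋃₀ (insert ray (G '' (T : Set E3))) := by
      rw [Set.sUnion_insert, Set.sUnion_image, Set.union_comm]; rfl
    rw [this]
    refine isPreconnected_sUnion p _ ?_ ?_
    · rintro s (rfl | ⟨a, ha, rfl⟩)
      · exact hpray
      · exact hG4 a (hTA a ha)
    · rintro s (rfl | ⟨a, ha, rfl⟩)
      · exact hray
      · exact hG1 a (hTA a ha)
  · rintro x (hx | hx) s hs
    · exact (min_le_left _ _).trans_lt (hdd x hx s hs)
    · exact (min_le_right _ _).trans_lt (by linarith [hrayd x hx s hs])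
  · intro R
    refine ⟨(max R r + 1) • e0, Or.inr ⟨max R r + 1, ?_, rfl⟩, ?_⟩
    · simp
    · have : 0 < max R r + 1 := by have := le_max_right R r; linarith
      rw [norm_smul, he0, mul_one, Real.norm_eq_abs, abs_of_pos this]
      have := le_max_left R r; linarith


/-! ### Holomorphic dependence on parameters -/

theorem hol_param {μ : Measure E3} {f : E3 → ℂ} (hf : Integrable f μ) {U : Set ℂ} (hU : IsOpen U)
    {k : ℂ → E3 → ℂ} {C : ℝ} (hmeas : ∀ t ∈ U, AEStronglyMeasurable (k t) μ)
    (hd : ∀ᵐ x ∂μ, DifferentiableOn ℂ (fun t => k t x) U)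
    (hb : ∀ᵐ x ∂μ, ∀ t ∈ U, ‖k t x‖ ≤ C) :
    DifferentiableOn ℂ (fun t => ∫ x, f x * k t x ∂μ) U := by
  intro t0 ht0
  obtain ⟨r, hr, hball⟩ := Metric.nhds_basis_closedBall.mem_iff.1 (hU.mem_nhds ht0)
  have hr2 : 0 < r / 2 := by positivity
  have hsub : ∀ t ∈ Metric.ball t0 (r / 2), Metric.closedBall t (r / 2) ⊆ U := by
    intro t ht z hz
    apply hball
    simp only [Metric.mem_ball, Metric.mem_closedBall] at *
    linarith [dist_triangle z t t0]
  have hmemU : ∀ t ∈ Metric.ball t0 (r / 2), t ∈ U := fun t ht =>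
    hsub t ht (Metric.mem_closedBall_self hr2.le)
  have hIntg : ∀ t ∈ U, Integrable (fun x => f x * k t x) μ := by
    intro t ht
    refine Integrable.mul_bdd (c := C) hf (hmeas t ht) ?_
    filter_upwards [hb] with x hx using hx t ht
  have hda : ∀ᵐ x ∂μ, ∀ t ∈ Metric.ball t0 (r / 2),
      HasDerivAt (fun t => f x * k t x) (f x * deriv (fun t => k t x) t) t := by
    filter_upwards [hd] with x hx t ht
    have := (hx.differentiableAt (hU.mem_nhds (hmemU t ht))).hasDerivAt
    exact this.const_mul (f x)
  refine (hasDerivAt_integral_of_dominated_loc_of_deriv_le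
    (F := fun t x => f x * k t x) (F' := fun t x => f x * deriv (fun t => k t x) t)
    (bound := fun x => ‖f x‖ * (C / (r / 2))) (Metric.ball_mem_nhds t0 hr2)
    ?_ (hIntg t0 ht0) ?_ ?_ (hf.norm.mul_const _) hda).2.differentiableAt.differentiableWithinAt
  · filter_upwards [Metric.ball_mem_nhds t0 hr2] with t ht using (hIntg t (hmemU t ht)).1
  · refine hf.1.mul ?_
    let s : ℕ → ℂ := fun n => (((r / 4) * (1 / ((n : ℝ) + 1)) : ℝ) : ℂ)
    have hs0 : ∀ n, s n ≠ 0 := fun n => by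
      simp only [s]; rw [Complex.ofReal_ne_zero]; positivity
    have hst : Tendsto s atTop (𝓝 0) := by
      have := (tendsto_one_div_add_atTop_nhds_zero_nat (𝕜 := ℝ)).const_mul (r / 4)
      rw [mul_zero] at this
      exact (Complex.continuous_ofReal.tendsto 0).comp this
    have hsn : ∀ n, t0 + s n ∈ U := fun n => by
      apply hball
      simp only [Metric.mem_closedBall, dist_eq_norm, add_sub_cancel_left, s]
      rw [Complex.norm_real, Real.norm_eq_abs, abs_of_nonneg (by positivity)]
      have : 1 / ((n : ℝ) + 1) ≤ 1 := by
        rw [div_le_one (by positivity)]; linarith [n.cast_nonneg (α := ℝ)]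
      nlinarith
    refine aestronglyMeasurable_of_tendsto_ae atTop
      (f := fun n x => (s n)⁻¹ * (k (t0 + s n) x - k t0 x)) ?_ ?_
    · intro n
      exact ((hmeas _ (hsn n)).sub (hmeas _ ht0)).const_mul _
    · filter_upwards [hd] with x hx
      have := (hx.differentiableAt (hU.mem_nhds ht0)).hasDerivAt
      rw [hasDerivAt_iff_tendsto_slope_zero] at this
      exact this.comp (tendsto_nhdsWithin_iff.2 ⟨hst, Eventually.of_forall hs0⟩)
  · filter_upwards [hd, hb] with x hx hxb t ht
    rw [norm_mul]
    gcongr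
    refine Complex.norm_deriv_le_of_forall_mem_sphere_norm_le hr2 ?_ ?_
    · refine DifferentiableOn.diffContOnCl ?_
      rw [closure_ball t hr2.ne']
      exact hx.mono (hsub t ht)
    · intro z hz
      exact hxb z (hsub t ht (Metric.sphere_subset_closedBall hz))

/-- principal square root -/
def cs (D : ℂ) : ℂ := D ^ (((1 / 2 : ℝ)) : ℂ)

lemma cs_norm (D : ℂ) : ‖cs D‖ = √‖D‖ := by
  rw [cs, Complex.norm_cpow_real, Real.sqrt_eq_rpow]

lemma cs_re_nonneg (D : ℂ) : 0 ≤ (cs D).re := by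
  rw [cs, Complex.cpow_ofReal_re]
  have h1 := Complex.neg_pi_lt_arg D
  have h2 := Complex.arg_le_pi D
  have := cos_nonneg_of_neg_pi_div_two_le_of_le (x := D.arg * (1 / 2)) (by linarith) (by linarith)
  positivity

lemma cs_ofReal {x : ℝ} (hx : 0 ≤ x) : cs (x : ℂ) = ((√x : ℝ) : ℂ) := by
  rw [cs, ← Complex.ofReal_cpow hx, Real.sqrt_eq_rpow]

lemma cs_diff {D : ℂ → ℂ} {t : ℂ} (hD : DifferentiableAt ℂ D t) (h : 0 < (D t).re) :
    DifferentiableAt ℂ (fun t => cs (D t)) t := by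
  unfold cs
  exact hD.cpow_const (Or.inl h)

lemma cs_meas : Measurable cs := by
  unfold cs; fun_prop

/-- outgoing kernel -/
def Ek (lam : ℝ) (z : E3) : ℂ := Complex.exp (Complex.I * (lam * ‖z‖ : ℝ)) / (‖z‖ : ℝ)

lemma Ek_re (lam : ℝ) (z : E3) : (Ek lam z).re = hker lam 1 0 0 z := by
  rw [hker_zero, Ek, Complex.div_ofReal_re, mul_comm Complex.I, Complex.exp_ofReal_mul_I_re]
  simp

lemma Ek_im (lam : ℝ) (z : E3) : (Ek lam z).im = Jk lam z := by
  rw [Jk, hker_zero, Ek, Complex.div_ofReal_im, mul_comm Complex.I, Complex.exp_ofReal_mul_I_im]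
  simp

/-- the potential -/
def pot (lam : ℝ) (K : Set E3) (φ : E3 → ℝ) (y : E3) : ℂ :=
  ∫ x in K, (φ x : ℂ) * Ek lam (x - y)

/-! near kernel -/

/-- the holomorphic extension of the squared distance -/
def nearD (y η : E3) (t : ℂ) (x : E3) : ℂ :=
  ((‖x - y‖ ^ 2 : ℝ) : ℂ) - 2 * t * ((inner ℝ (x - y) η : ℝ) : ℂ) + t ^ 2 * ((‖η‖ ^ 2 : ℝ) : ℂ)

lemma nearD_real (y η : E3) (t : ℝ) (x : E3) :
    nearD y η t x = ((‖x - (y + t • η)‖ ^ 2 : ℝ) : ℂ) := by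
  unfold nearD
  rw [show x - (y + t • η) = (x - y) - t • η by abel, norm_sub_sq_real (x - y) (t • η), norm_smul, inner_smul_right,
    mul_pow, Real.norm_eq_abs, sq_abs]
  push_cast; ring

lemma nearD_est {y η x : E3} {d : ℝ} (hd : 0 < d) (hx : d ≤ ‖x - y‖) (hη : ‖η‖ ≤ d / 6) {t : ℂ}
    (ht : ‖t‖ < 2) : ‖nearD y η t x - ((‖x - y‖ ^ 2 : ℝ) : ℂ)‖ ≤ 7 / 9 * ‖x - y‖ ^ 2 := by
  have e : nearD y η t x - ((‖x - y‖ ^ 2 : ℝ) : ℂ) =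
    - (2 * t * ((inner ℝ (x - y) η : ℝ) : ℂ)) + t ^ 2 * ((‖η‖ ^ 2 : ℝ) : ℂ) := by
    unfold nearD; ring
  rw [e]
  refine (norm_add_le _ _).trans ?_
  rw [norm_neg, norm_mul, norm_mul, norm_mul, norm_pow, Complex.norm_real, Complex.norm_real]
  have hi : ‖(inner ℝ (x - y) η : ℝ)‖ ≤ ‖x - y‖ * ‖η‖ := norm_inner_le_norm _ _
  have h0 := norm_nonneg η
  have ht0 := norm_nonneg t
  rw [Real.norm_eq_abs (‖η‖ ^ 2), abs_of_nonneg (by positivity)]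
  simp only [Complex.norm_ofNat]
  have hηx : ‖η‖ ≤ ‖x - y‖ / 6 := by linarith
  generalize ‖x - y‖ = a at *
  generalize ‖η‖ = b at *
  generalize ‖t‖ = s at *
  have k1 : 2 * s * ‖(inner ℝ (x - y) η : ℝ)‖ ≤ 2 * 2 * (a * (a / 6)) := by
    have ha : 0 ≤ a := by linarith
    have : ‖(inner ℝ (x - y) η : ℝ)‖ ≤ a * (a / 6) := hi.trans (by gcongr)
    gcongr
  have k2 : s ^ 2 * b ^ 2 ≤ 2 ^ 2 * (a / 6) ^ 2 := by gcongr
  nlinarith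

/-- near kernel -/
def nearK (lam : ℝ) (y η : E3) (t : ℂ) (x : E3) : ℂ :=
  Complex.exp (Complex.I * (lam * cs (nearD y η t x))) / cs (nearD y η t x)

lemma nearK_real (lam : ℝ) (y η : E3) (t : ℝ) (x : E3) :
    nearK lam y η t x = Ek lam (x - (y + t • η)) := by
  unfold nearK Ek
  rw [nearD_real, cs_ofReal (by positivity), sqrt_sq (norm_nonneg _)]
  push_cast; rfl

lemma re_pos_of {D : ℂ} {c : ℝ} (hc : 0 < c) (h : ‖D - (c : ℂ)‖ ≤ 7 / 9 * c) : 0 < D.re := by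
  have h1 := (Complex.abs_re_le_norm (D - (c : ℂ))).trans h
  rw [Complex.sub_re, Complex.ofReal_re] at h1
  have := neg_le_of_abs_le h1
  linarith

theorem pot_near (lam : ℝ) {K : Set E3} (hK : IsCompact K) {φ : E3 → ℝ} (hφ : IntegrableOn φ K)
    {y : E3} {d : ℝ} (hd : 0 < d) (hdist : ∀ x ∈ K, d ≤ dist y x)
    (hz : ∀ᶠ z in 𝓝 y, pot lam K φ z = 0) (z : E3) (hzy : ‖z - y‖ ≤ d / 6) :
    pot lam K φ z = 0 := by
  let η := z - y
  obtain ⟨M, hM⟩ := hK.exists_bound_of_continuousOn (f := fun x : E3 => x - y)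
    (by fun_prop)
  have hKm := hK.measurableSet
  have hKy : ∀ x ∈ K, d ≤ ‖x - y‖ := fun x hx => by
    rw [← dist_eq_norm, dist_comm]; exact hdist x hx
  have hest : ∀ x ∈ K, ∀ t ∈ Metric.ball (0 : ℂ) 2,
      ‖nearD y η t x - ((‖x - y‖ ^ 2 : ℝ) : ℂ)‖ ≤ 7 / 9 * ‖x - y‖ ^ 2 := fun x hx t ht =>
    nearD_est hd (hKy x hx) hzy (by simpa using ht)
  have hpos : ∀ x ∈ K, 0 < ‖x - y‖ := fun x hx => hd.trans_le (hKy x hx)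
  have hre : ∀ x ∈ K, ∀ t ∈ Metric.ball (0 : ℂ) 2, 0 < (nearD y η t x).re := fun x hx t ht =>
    re_pos_of (pow_pos (hpos x hx) 2) (hest x hx t ht)
  have hh : DifferentiableOn ℂ (fun t => ∫ x in K, (φ x : ℂ) * nearK lam y η t x)
      (Metric.ball 0 2) := by
    refine hol_param (C := rexp (|lam| * (2 * M)) / (d / 3)) hφ.ofReal Metric.isOpen_ball ?_ ?_ ?_
    · intro t ht
      have := cs_meas
      unfold nearK nearD
      apply Measurable.aestronglyMeasurable
      fun_prop
    · refine (ae_restrict_iff' hKm).2 (Eventually.of_forall fun x hx => ?_)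
      intro t ht
      apply DifferentiableAt.differentiableWithinAt
      have h1 : DifferentiableAt ℂ (fun t => nearD y η t x) t := by
        unfold nearD; fun_prop
      have h2 := cs_diff h1 (hre x hx t ht)
      have h3 : cs (nearD y η t x) ≠ 0 := by
        intro h0
        have := cs_norm (nearD y η t x)
        rw [h0, norm_zero, eq_comm, sqrt_eq_zero (norm_nonneg _), norm_eq_zero] at this
        have h := hre x hx t ht
        rw [this] at h; simp at h
      unfold nearK
      exact ((h2.const_mul _).const_mul _).cexp.div h2 h3
    · refine (ae_restrict_iff' hKm).2 (Eventually.of_forall fun x hx => ?_)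
      intro t ht
      have h1 := hest x hx t ht
      have hc : ‖((‖x - y‖ ^ 2 : ℝ) : ℂ)‖ = ‖x - y‖ ^ 2 := by
        rw [Complex.norm_real, Real.norm_eq_abs, abs_of_nonneg (by positivity)]
      have hup : ‖nearD y η t x‖ ≤ (2 * ‖x - y‖) ^ 2 := by
        have := norm_sub_norm_le (nearD y η t x) ((‖x - y‖ ^ 2 : ℝ) : ℂ)
        rw [hc] at this
        nlinarith [sq_nonneg ‖x - y‖]
      have hlo : (d / 3) ^ 2 ≤ ‖nearD y η t x‖ := by
        have := norm_sub_norm_le ((‖x - y‖ ^ 2 : ℝ) : ℂ) (nearD y η t x)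
        rw [hc, norm_sub_rev ((‖x - y‖ ^ 2 : ℝ) : ℂ) (nearD y η t x)] at this
        nlinarith [hKy x hx]
      have c1 : ‖cs (nearD y η t x)‖ ≤ 2 * M := by
        rw [cs_norm]
        refine (sqrt_le_sqrt hup).trans ?_
        rw [sqrt_sq (by positivity)]
        linarith [hM x hx]
      have c2 : d / 3 ≤ ‖cs (nearD y η t x)‖ := by
        rw [cs_norm]
        exact le_sqrt_of_sq_le hlo
      unfold nearK
      rw [norm_div]
      gcongr
      refine (Complex.norm_exp_le_exp_norm _).trans ?_
      rw [norm_mul, norm_mul, Complex.norm_I, one_mul, Complex.norm_real, Real.norm_eq_abs]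
      gcongr
  have hreal : ∀ t : ℝ, ∫ x in K, (φ x : ℂ) * nearK lam y η t x = pot lam K φ (y + t • η) := by
    intro t
    unfold pot
    simp_rw [nearK_real]
  have han := hh.analyticOnNhd Metric.isOpen_ball
  have hfreq : ∃ᶠ t in 𝓝[≠] (0 : ℂ), ∫ x in K, (φ x : ℂ) * nearK lam y η t x = 0 := by
    let s : ℕ → ℝ := fun n => 1 / ((n : ℝ) + 1)
    have hs : Tendsto s atTop (𝓝 0) := tendsto_one_div_add_atTop_nhds_zero_nat
    have hsC : Tendsto (fun n => (s n : ℂ)) atTop (𝓝[≠] 0) := by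
      refine tendsto_nhdsWithin_iff.2 ⟨?_, Eventually.of_forall fun n => ?_⟩
      · exact (Complex.continuous_ofReal.tendsto 0).comp hs
      · simp only [Set.mem_compl_iff, Set.mem_singleton_iff, s]
        rw [Complex.ofReal_eq_zero]; positivity
    refine hsC.frequently ?_
    apply Eventually.frequently
    have ht : Tendsto (fun n => y + s n • η) atTop (𝓝 y) := by
      have := (hs.smul_const η).const_add y
      simpa using this
    filter_upwards [ht.eventually hz] with n hn
    rw [hreal]; exact hn
  have h0 := han.eqOn_zero_of_preconnected_of_frequently_eq_zero
    (convex_ball (0 : ℂ) 2).isPreconnected (by simp) hfreq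
  have h1 := h0 (show (1 : ℂ) ∈ Metric.ball (0 : ℂ) 2 by simp)
  simp only [Pi.zero_apply] at h1
  have h2 := hreal 1
  rw [Complex.ofReal_one, h1] at h2
  rw [h2]; simp [η]


/-! ### Far field -/

/-- normalized squared distance at infinity -/
def farD (om : E3) (t : ℂ) (x : E3) : ℂ :=
  1 - 2 * t * ((inner ℝ x om : ℝ) : ℂ) + t ^ 2 * ((‖x‖ ^ 2 : ℝ) : ℂ)

/-- phase at infinity -/
def farθ (om : E3) (t : ℂ) (x : E3) : ℂ :=
  (- 2 * ((inner ℝ x om : ℝ) : ℂ) + t * ((‖x‖ ^ 2 : ℝ) : ℂ)) / (cs (farD om t x) + 1)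

/-- far kernel -/
def farK (lam : ℝ) (om : E3) (t : ℂ) (x : E3) : ℂ :=
  Complex.exp (Complex.I * (lam * farθ om t x)) / cs (farD om t x)

lemma farD_real {om : E3} (hom : ‖om‖ = 1) {t : ℝ} (ht : 0 < t) (x : E3) :
    farD om t x = (((t * ‖x - t⁻¹ • om‖) ^ 2 : ℝ) : ℂ) := by
  unfold farD
  rw [mul_pow, norm_sub_sq_real x (t⁻¹ • om), norm_smul, inner_smul_right, hom, mul_one,
    Real.norm_eq_abs, sq_abs]
  have : (t : ℂ) ≠ 0 := by exact_mod_cast ht.ne'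
  push_cast
  field_simp
  ring

lemma farK_real (lam : ℝ) {om : E3} (hom : ‖om‖ = 1) {t : ℝ} (ht : 0 < t) (x : E3)
    (hne : x - t⁻¹ • om ≠ 0) :
    Ek lam (x - t⁻¹ • om) = (t : ℂ) * Complex.exp ((lam / t : ℝ) * Complex.I) * farK lam om t x := by
  have htc : (t : ℂ) ≠ 0 := by exact_mod_cast ht.ne'
  have hr : 0 < ‖x - t⁻¹ • om‖ := norm_pos_iff.2 hne
  have hD := farD_real hom ht x
  have hD2 : -2 * ((inner ℝ x om : ℝ) : ℂ) + t * ((‖x‖ ^ 2 : ℝ) : ℂ) = (farD om t x - 1) / t := by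
    unfold farD; field_simp; ring
  have hcs : cs (farD om t x) = ((t * ‖x - t⁻¹ • om‖ : ℝ) : ℂ) := by
    rw [hD, cs_ofReal (by positivity), sqrt_sq (by positivity)]
  unfold farK farθ Ek
  rw [hD2, hcs, hD]
  generalize ‖x - t⁻¹ • om‖ = r at *
  have hrc : (r : ℂ) ≠ 0 := by exact_mod_cast hr.ne'
  have h1 : ((t * r : ℝ) : ℂ) + 1 ≠ 0 := by
    have : t * r + 1 ≠ 0 := by positivity
    exact_mod_cast this
  have h2 : ((((t * r) ^ 2 : ℝ) : ℂ) - 1) / t / (((t * r : ℝ) : ℂ) + 1) = r - 1 / t := by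
    push_cast at h1 ⊢
    field_simp
    ring
  rw [h2]
  have h3 : Complex.exp (Complex.I * ((lam * r : ℝ) : ℂ)) =
      Complex.exp ((lam / t : ℝ) * Complex.I) * Complex.exp (Complex.I * (lam * ((r : ℂ) - 1 / t))) := by
    rw [← Complex.exp_add]; congr 1; push_cast; ring
  rw [h3]
  push_cast
  field_simp

lemma far_seq {g : ℝ → ℝ} {R : ℝ} (hR : 0 < R) (hg : AnalyticOnNhd ℝ g (Metric.ball 0 R)) {s : ℕ → ℝ}
    (hs : Tendsto s atTop (𝓝 0)) (hs0 : ∀ n, s n ≠ 0) (h : ∀ᶠ n in atTop, g (s n) = 0) :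
    ∀ t ∈ Metric.ball 0 R, g t = 0 := by
  have hfreq : ∃ᶠ t in 𝓝[≠] (0 : ℝ), g t = 0 :=
    (tendsto_nhdsWithin_iff.2 ⟨hs, Eventually.of_forall hs0⟩ :
      Tendsto s atTop (𝓝[≠] 0)).frequently h.frequently
  exact hg.eqOn_zero_of_preconnected_of_frequently_eq_zero
    (convex_ball (0 : ℝ) R).isPreconnected (by simpa using hR) hfreq

lemma tend_aux (lam c : ℝ) : Tendsto (fun n : ℕ => lam / (π * (n + 1) + c)) atTop (𝓝 0) := by
  apply Tendsto.const_div_atTop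
  apply tendsto_atTop_add_const_right
  apply Tendsto.const_mul_atTop pi_pos
  exact tendsto_atTop_add_const_right _ _ tendsto_natCast_atTop_atTop

theorem pot_far {lam : ℝ} (hlam : 0 < lam) {K : Set E3} (hKm : MeasurableSet K) {φ : E3 → ℝ}
    (hφ : IntegrableOn φ K) {ρ : ℝ} (hρ : 0 < ρ) (hKρ : ∀ x ∈ K, ‖x‖ ≤ ρ)
    (him : ∀ y, 4 * ρ < ‖y‖ → (pot lam K φ y).im = 0) (y : E3) (hy : 4 * ρ < ‖y‖) :
    pot lam K φ y = 0 := by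
  have hy0 : 0 < ‖y‖ := by linarith
  let om : E3 := ‖y‖⁻¹ • y
  have hom : ‖om‖ = 1 := by
    simp only [om]; rw [norm_smul, norm_inv, norm_norm, inv_mul_cancel₀ hy0.ne']
  set R : ℝ := 1 / (4 * ρ) with hRdef
  have hR : 0 < R := by positivity
  have hRρ : R * ρ = 1 / 4 := by rw [hRdef]; field_simp
  have hest : ∀ x ∈ K, ∀ t ∈ Metric.ball (0 : ℂ) R, ‖farD om t x - ((1 : ℝ) : ℂ)‖ ≤ 9 / 16 := by
    intro x hx t ht
    have ht : ‖t‖ < R := by simpa using ht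
    have hi : ‖(inner ℝ x om : ℝ)‖ ≤ ρ := by
      refine (norm_inner_le_norm _ _).trans ?_
      rw [hom, mul_one]; exact hKρ x hx
    have e : farD om t x - ((1 : ℝ) : ℂ) =
      - (2 * t * ((inner ℝ x om : ℝ) : ℂ)) + t ^ 2 * ((‖x‖ ^ 2 : ℝ) : ℂ) := by
      unfold farD; push_cast; ring
    rw [e]
    refine (norm_add_le _ _).trans ?_
    rw [norm_neg, norm_mul, norm_mul, norm_mul, norm_pow, Complex.norm_real, Complex.norm_real,
      Real.norm_eq_abs (‖x‖ ^ 2), abs_of_nonneg (by positivity)]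
    simp only [Complex.norm_ofNat]
    have k1 : 2 * ‖t‖ * ‖(inner ℝ x om : ℝ)‖ ≤ 2 * R * ρ := by gcongr
    have k2 : ‖t‖ ^ 2 * ‖x‖ ^ 2 ≤ R ^ 2 * ρ ^ 2 := by gcongr; exact hKρ x hx
    have k3 : R ^ 2 * ρ ^ 2 = 1 / 16 := by rw [← mul_pow, hRρ]; norm_num
    linarith
  have hre : ∀ x ∈ K, ∀ t ∈ Metric.ball (0 : ℂ) R, 0 < (farD om t x).re := fun x hx t ht =>
    re_pos_of one_pos ((hest x hx t ht).trans (by norm_num))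
  have hcs1 : ∀ x : E3, ∀ t : ℂ, 1 ≤ ‖cs (farD om t x) + 1‖ := by
    intro x t
    refine le_trans ?_ (Complex.re_le_norm _)
    rw [Complex.add_re, Complex.one_re]
    linarith [cs_re_nonneg (farD om t x)]
  have hcs2 : ∀ x ∈ K, ∀ t ∈ Metric.ball (0 : ℂ) R, 1 / 2 ≤ ‖cs (farD om t x)‖ := by
    intro x hx t ht
    rw [cs_norm]
    apply le_sqrt_of_sq_le
    have := norm_sub_norm_le ((1 : ℝ) : ℂ) (farD om t x)
    rw [norm_sub_rev] at this
    have h2 := hest x hx t ht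
    rw [Complex.norm_real, Real.norm_eq_abs, abs_one] at this
    linarith
  have hh : DifferentiableOn ℂ (fun t => ∫ x in K, (φ x : ℂ) * farK lam om t x)
      (Metric.ball 0 R) := by
    refine hol_param (C := rexp (|lam| * (3 * ρ)) / (1 / 2)) hφ.ofReal Metric.isOpen_ball ?_ ?_ ?_
    · intro t ht
      have := cs_meas
      unfold farK farθ farD
      apply Measurable.aestronglyMeasurable
      fun_prop
    · refine (ae_restrict_iff' hKm).2 (Eventually.of_forall fun x hx => ?_)
      intro t ht
      apply DifferentiableAt.differentiableWithinAt
      have h1 : DifferentiableAt ℂ (fun t => farD om t x) t := by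
        unfold farD; fun_prop
      have h2 := cs_diff h1 (hre x hx t ht)
      have h3 : cs (farD om t x) ≠ 0 := by
        rw [← norm_pos_iff]; linarith [hcs2 x hx t ht]
      have h4 : cs (farD om t x) + 1 ≠ 0 := by
        rw [← norm_pos_iff]; linarith [hcs1 x t]
      have h5 : DifferentiableAt ℂ (fun t => farθ om t x) t := by
        unfold farθ
        refine DifferentiableAt.div (by fun_prop) (h2.add_const 1) h4
      unfold farK
      exact ((h5.const_mul _).const_mul _).cexp.div h2 h3
    · refine (ae_restrict_iff' hKm).2 (Eventually.of_forall fun x hx => ?_)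
      intro t ht
      have hθ : ‖farθ om t x‖ ≤ 3 * ρ := by
        unfold farθ
        rw [norm_div]
        refine (div_le_self (norm_nonneg _) (hcs1 x t)).trans ?_
        refine (norm_add_le _ _).trans ?_
        have ht : ‖t‖ < R := by simpa using ht
        have hi : ‖(inner ℝ x om : ℝ)‖ ≤ ρ := by
          refine (norm_inner_le_norm _ _).trans ?_
          rw [hom, mul_one]; exact hKρ x hx
        rw [norm_mul, norm_mul, norm_neg, Complex.norm_real, Complex.norm_real,
          Real.norm_eq_abs (‖x‖ ^ 2), abs_of_nonneg (by positivity)]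
        simp only [Complex.norm_ofNat]
        have k2 : ‖t‖ * ‖x‖ ^ 2 ≤ R * ρ ^ 2 := by gcongr; exact hKρ x hx
        have k3 : R * ρ ^ 2 = ρ / 4 := by rw [pow_two, ← mul_assoc, hRρ]; ring
        linarith
      unfold farK
      rw [norm_div]
      have := hcs2 x hx t ht
      gcongr
      refine (Complex.norm_exp_le_exp_norm _).trans ?_
      rw [norm_mul, norm_mul, Complex.norm_I, one_mul, Complex.norm_real, Real.norm_eq_abs]
      gcongr
  set A : ℂ → ℂ := fun t => ∫ x in K, (φ x : ℂ) * farK lam om t x with hA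
  have han := hh.analyticOnNhd Metric.isOpen_ball
  have hB : ∀ t ∈ Metric.ball (0 : ℝ) R, AnalyticAt ℝ (fun t : ℝ => A t) t := by
    intro t ht
    have h1 : (t : ℂ) ∈ Metric.ball (0 : ℂ) R := by simpa using ht
    exact (han _ h1).restrictScalars.comp (Complex.ofRealCLM.analyticAt t)
  have hP : AnalyticOnNhd ℝ (fun t : ℝ => (A t).re) (Metric.ball 0 R) := fun t ht =>
    (Complex.reCLM.analyticAt _).comp (hB t ht)
  have hQ : AnalyticOnNhd ℝ (fun t : ℝ => (A t).im) (Metric.ball 0 R) := fun t ht =>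
    (Complex.imCLM.analyticAt _).comp (hB t ht)
  have hpot : ∀ t : ℝ, 0 < t → t < R →
      pot lam K φ (t⁻¹ • om) = (t : ℂ) * Complex.exp ((lam / t : ℝ) * Complex.I) * A t := by
    intro t ht htR
    rw [hA, ← integral_const_mul]
    unfold pot
    refine setIntegral_congr_fun hKm fun x hx => ?_
    rw [farK_real lam hom ht x ?_]
    · ring
    · intro h0
      have h1 : ‖x‖ = t⁻¹ := by
        rw [sub_eq_zero.1 h0, norm_smul, hom, mul_one, Real.norm_eq_abs, abs_of_pos (by positivity)]
      have h2 := hKρ x hx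
      rw [h1, inv_le_iff_one_le_mul₀ ht] at h2
      nlinarith
  have hbig : ∀ t : ℝ, 0 < t → t < R → 4 * ρ < ‖t⁻¹ • om‖ := by
    intro t ht htR
    rw [norm_smul, hom, mul_one, Real.norm_eq_abs, abs_of_pos (by positivity), lt_inv_comm₀ (by positivity) ht]
    rwa [hRdef, one_div] at htR
  have hrel : ∀ t : ℝ, 0 < t → t < R → Real.cos (lam / t) * (A t).im + Real.sin (lam / t) * (A t).re = 0 := by
    intro t ht htR
    have := him _ (hbig t ht htR)
    rw [hpot t ht htR, mul_assoc, Complex.im_ofReal_mul, Complex.mul_im,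
      Complex.exp_ofReal_mul_I_re, Complex.exp_ofReal_mul_I_im] at this
    rcases mul_eq_zero.1 this with h | h
    · exact absurd h ht.ne'
    · exact h
  have hQ0 : ∀ t ∈ Metric.ball (0 : ℝ) R, (A t).im = 0 := by
    refine far_seq hR hQ (tend_aux lam 0) (fun n => ?_) ?_
    · positivity
    · filter_upwards [(tend_aux lam 0).eventually (gt_mem_nhds hR)] with n hn
      have h0 : 0 < lam / (π * (n + 1) + 0) := by positivity
      have h := hrel _ h0 hn
      have e : lam / (lam / (π * (n + 1) + 0)) = ((n + 1 : ℕ) : ℝ) * π := by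
        push_cast; field_simp; ring
      have hsc := Real.sin_sq_add_cos_sq (((n + 1 : ℕ) : ℝ) * π)
      rw [e, Real.sin_nat_mul_pi, zero_mul, add_zero] at h
      rw [Real.sin_nat_mul_pi] at hsc
      rcases mul_eq_zero.1 h with h | h
      · rw [h] at hsc; norm_num at hsc
      · exact h
  have hP0 : ∀ t ∈ Metric.ball (0 : ℝ) R, (A t).re = 0 := by
    refine far_seq hR hP (tend_aux lam (π / 2)) (fun n => ?_) ?_
    · positivity
    · filter_upwards [(tend_aux lam (π / 2)).eventually (gt_mem_nhds hR)] with n hn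
      have h0 : 0 < lam / (π * (n + 1) + π / 2) := by positivity
      have h := hrel _ h0 hn
      have hq := hQ0 (lam / (π * (n + 1) + π / 2)) (by
        rw [Metric.mem_ball, dist_zero_right, Real.norm_eq_abs, abs_of_pos h0]; exact hn)
      have e : lam / (lam / (π * (n + 1) + π / 2)) = ((n + 1 : ℕ) : ℝ) * π + π / 2 := by
        push_cast; field_simp
      have hsc := Real.sin_sq_add_cos_sq (((n + 1 : ℕ) : ℝ) * π)
      rw [e, hq, mul_zero, zero_add, Real.sin_add_pi_div_two] at h
      rw [Real.sin_nat_mul_pi] at hsc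
      rcases mul_eq_zero.1 h with h | h
      · rw [h] at hsc; norm_num at hsc
      · exact h
  have ht : 0 < ‖y‖⁻¹ := by positivity
  have htR : ‖y‖⁻¹ < R := by
    rw [hRdef, one_div]; exact inv_strictAnti₀ (by positivity) hy
  have h1 := hpot _ ht htR
  have hm : ‖y‖⁻¹ ∈ Metric.ball (0 : ℝ) R := by
    rw [Metric.mem_ball, dist_zero_right, Real.norm_eq_abs, abs_of_pos ht]; exact htR
  rw [show A (‖y‖⁻¹ : ℝ) = 0 from Complex.ext (hP0 _ hm) (hQ0 _ hm), mul_zero] at h1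
  simp only [om] at h1
  rwa [inv_inv, smul_smul, mul_inv_cancel₀ hy0.ne', one_smul] at h1

theorem pot_gamma {lam : ℝ} {K : Set E3} (hK : IsCompact K) {φ : E3 → ℝ}
    (hφ : IntegrableOn φ K) {Γ : Set E3} (hΓ : IsPreconnected Γ) {d : ℝ} (hd : 0 < d)
    (hdist : ∀ y ∈ Γ, ∀ x ∈ K, d ≤ dist y x) {p : E3} (hp : p ∈ Γ)
    (h0 : ∀ᶠ y in 𝓝 p, pot lam K φ y = 0) : ∀ y ∈ Γ, pot lam K φ y = 0 := by
  set Z : Set E3 := interior {y | pot lam K φ y = 0} with hZ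
  have hpZ : p ∈ Z := mem_interior_iff_mem_nhds.2 h0
  have key : Γ ⊆ Z := by
    refine hΓ.subset_of_closure_inter_subset isOpen_interior ⟨p, hp, hpZ⟩ ?_
    rintro y ⟨hyc, hyΓ⟩
    obtain ⟨y1, hy1, hdy⟩ := Metric.mem_closure_iff.1 hyc (d / 20) (by positivity)
    have hd1 : ∀ x ∈ K, 19 * d / 20 ≤ dist y1 x := by
      intro x hx
      have := hdist y hyΓ x hx
      have := dist_triangle y y1 x
      linarith
    have hz : ∀ᶠ z in 𝓝 y1, pot lam K φ z = 0 := mem_interior_iff_mem_nhds.1 hy1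
    rw [hZ, mem_interior_iff_mem_nhds]
    filter_upwards [Metric.ball_mem_nhds y (show 0 < d / 20 by positivity)] with z hz'
    refine pot_near lam hK hφ (by positivity) hd1 hz z ?_
    rw [← dist_eq_norm]
    have := dist_triangle z y y1
    rw [Metric.mem_ball] at hz'
    linarith
  intro y hy
  have : y ∈ {y | pot lam K φ y = 0} := interior_subset (key hy)
  exact this

/-! ### Density in L² -/
open scoped ContDiff

lemma Jk_bdd (lam : ℝ) (x : E3) : ‖Jk lam x‖ ≤ |lam| := by
  rw [Jk, hker_zero, Real.norm_eq_abs]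
  rcases eq_or_ne x 0 with rfl | hx
  · simp
  · have hn : 0 < ‖x‖ := norm_pos_iff.2 hx
    rw [zero_mul, zero_add, one_mul, abs_div, abs_norm, div_le_iff₀ hn]
    refine (abs_sin_le_abs).trans ?_
    rw [abs_mul, abs_norm]

lemma cv_flip (h f : E3 → ℝ) (x : E3) : cv h f x = ∫ y, h (x - y) * f y := by
  unfold cv
  have := integral_sub_left_eq_self (fun y => h y * f (x - y)) (volume : Measure E3) x
  simp only [sub_sub_cancel] at this
  exact this.symm

theorem fubini_cv {K : Set E3} (hK : MeasurableSet K) {φ h f : E3 → ℝ} (hφ : IntegrableOn φ K)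
    (hf : Integrable f) (hh : Measurable h) {C : ℝ}
    (hb : ∀ x ∈ K, ∀ y, f y ≠ 0 → ‖h (x - y)‖ ≤ C) :
    ∫ x in K, φ x * cv h f x = ∫ y, f y * ∫ x in K, φ x * h (x - y) := by
  have hIntg : Integrable (Function.uncurry fun x y => φ x * (h (x - y) * f y))
      ((volume.restrict K).prod volume) := by
    refine Integrable.mono' ((hφ.norm.mul_prod hf.norm).const_mul C) ?_ ?_
    · refine AEStronglyMeasurable.mul hφ.1.comp_fst (AEStronglyMeasurable.mul ?_ hf.1.comp_snd)
      apply Measurable.aestronglyMeasurable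
      fun_prop
    · have e : (volume.restrict K).prod (volume : Measure E3) =
          ((volume : Measure E3).prod (volume : Measure E3)).restrict (K ×ˢ Set.univ) := by
        rw [← Measure.prod_restrict, Measure.restrict_univ]
      rw [e, ae_restrict_iff' (hK.prod MeasurableSet.univ)]
      refine Eventually.of_forall ?_
      rintro ⟨x, y⟩ ⟨hx, -⟩
      simp only [Function.uncurry]
      rw [norm_mul, norm_mul]
      rcases eq_or_ne (f y) 0 with h0 | h0
      · simp [h0]
      · have := hb x hx y h0
        have h1 : 0 ≤ ‖φ x‖ * ‖f y‖ := by positivity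
        nlinarith
  have hs := integral_integral_swap hIntg
  calc ∫ x in K, φ x * cv h f x = ∫ x in K, ∫ y, φ x * (h (x - y) * f y) := by
        congr 1; ext x; rw [integral_const_mul, cv_flip]
    _ = ∫ y, ∫ x in K, φ x * (h (x - y) * f y) := hs
    _ = _ := by
        congr 1; ext y; rw [← integral_const_mul]; congr 1; ext x; ring

lemma pot_integrable (lam : ℝ) {K : Set E3} (hK : MeasurableSet K) {φ : E3 → ℝ}
    (hφ : IntegrableOn φ K) {y : E3} {d : ℝ} (hd : 0 < d) (hdist : ∀ x ∈ K, d ≤ dist y x) :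
    Integrable (fun x => (φ x : ℂ) * Ek lam (x - y)) (volume.restrict K) := by
  refine Integrable.mul_bdd (c := d⁻¹) hφ.ofReal ?_ ?_
  · unfold Ek
    apply Measurable.aestronglyMeasurable
    fun_prop
  · refine (ae_restrict_iff' hK).2 (Eventually.of_forall fun x hx => ?_)
    have h1 : d ≤ ‖x - y‖ := by rw [← dist_eq_norm, dist_comm]; exact hdist x hx
    unfold Ek
    rw [norm_div, mul_comm Complex.I, Complex.norm_exp_ofReal_mul_I, Complex.norm_real, norm_norm,
      one_div]
    exact inv_anti₀ hd h1

lemma pot_im (lam : ℝ) {K : Set E3} (hK : MeasurableSet K) {φ : E3 → ℝ}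
    (hφ : IntegrableOn φ K) {y : E3} {d : ℝ} (hd : 0 < d) (hdist : ∀ x ∈ K, d ≤ dist y x) :
    (pot lam K φ y).im = ∫ x in K, φ x * Jk lam (x - y) := by
  have h := Complex.imCLM.integral_comp_comm (pot_integrable lam hK hφ hd hdist)
  unfold pot
  rw [← Complex.imCLM_apply, ← h]
  congr 1; ext x
  rw [Complex.imCLM_apply, Complex.im_ofReal_mul, Ek_im]

lemma pot_re (lam : ℝ) {K : Set E3} (hK : MeasurableSet K) {φ : E3 → ℝ}
    (hφ : IntegrableOn φ K) {y : E3} {d : ℝ} (hd : 0 < d) (hdist : ∀ x ∈ K, d ≤ dist y x) :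
    (pot lam K φ y).re = ∫ x in K, φ x * hker lam 1 0 0 (x - y) := by
  have h := Complex.reCLM.integral_comp_comm (pot_integrable lam hK hφ hd hdist)
  unfold pot
  rw [← Complex.reCLM_apply, ← h]
  congr 1; ext x
  rw [Complex.reCLM_apply, Complex.re_ofReal_mul, Ek_re]

theorem ann_far {lam : ℝ} {K : Set E3} (hK : MeasurableSet K) {φ : E3 → ℝ}
    (hφ : IntegrableOn φ K) {ρ : ℝ} (hKρ : ∀ x ∈ K, ‖x‖ ≤ ρ)
    (horth : ∀ ψ : E3 → ℝ, ContDiff ℝ ∞ ψ → HasCompactSupport ψ →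
      ∫ x in K, φ x * cv (Jk lam) ψ x = 0) (y : E3) (hy : ρ < ‖y‖) :
    (pot lam K φ y).im = 0 := by
  let g : E3 → ℝ := fun y => ∫ x in K, φ x * Jk lam (x - y)
  let U : Set E3 := {y | ρ < ‖y‖}
  have hU : IsOpen U := isOpen_lt continuous_const continuous_norm
  have hJm : Measurable (Jk lam) := hker_meas _ _ _ _
  have hgc : ContinuousOn g U := by
    intro y0 hy0
    apply ContinuousAt.continuousWithinAt
    refine continuousAt_of_dominated (bound := fun x => ‖φ x‖ * |lam|) ?_ ?_ (hφ.norm.mul_const _) ?_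
    · refine Eventually.of_forall fun y => hφ.1.mul ?_
      exact (hJm.comp (measurable_id.sub_const y)).aestronglyMeasurable
    · refine Eventually.of_forall fun y => Eventually.of_forall fun x => ?_
      rw [norm_mul]; gcongr; exact Jk_bdd _ _
    · refine (ae_restrict_iff' hK).2 (Eventually.of_forall fun x hx => ?_)
      refine continuousAt_const.mul ?_
      have hne : x - y0 ≠ 0 := by
        intro h
        have h1 : ρ < ‖y0‖ := hy0
        rw [← sub_eq_zero.1 h] at h1
        exact absurd (hKρ x hx) (not_le.2 h1)
      have h1 : ContinuousAt (Jk lam) (x - y0) :=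
        (hker_contDiffAt lam 0 1 0 (x - y0) (by have := norm_pos_iff.2 hne; positivity)).continuousAt
      exact ContinuousAt.comp (f := fun y => x - y) (x := y0) h1 (by fun_prop)
  have hae := hU.ae_eq_zero_of_integral_contDiff_smul_eq_zero (μ := volume) (f := g)
    (hgc.locallyIntegrableOn hU.measurableSet) (by
      intro ψ hψ hc _
      have h1 := horth ψ hψ hc
      rw [fubini_cv hK hφ (hψ.continuous.integrable_of_hasCompactSupport hc) hJm
        (C := |lam|) (fun x _ y _ => Jk_bdd _ _)] at h1
      exact h1)
  have h0 : Set.EqOn g 0 U := by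
    refine Measure.eqOn_open_of_ae_eq (μ := volume) ?_ hU hgc continuousOn_const
    exact (ae_restrict_iff' hU.measurableSet).2 hae
  rw [pot_im lam hK hφ (d := ‖y‖ - ρ) (by linarith)]
  · exact h0 hy
  · intro x hx
    rw [dist_eq_norm]
    have := norm_sub_norm_le y x
    linarith [hKρ x hx]

theorem ann_W {lam : ℝ} (hlam : 0 < lam) {K : Set E3} (hK : IsCompact K) {φ : E3 → ℝ}
    (hφ : IntegrableOn φ K) {Γ : Set E3} (hΓ : IsPreconnected Γ) {d : ℝ} (hd : 0 < d)
    (hdist : ∀ y ∈ Γ, ∀ x ∈ K, d ≤ dist y x) (hunb : ∀ R : ℝ, ∃ p ∈ Γ, R < ‖p‖)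
    {W : E3 → ℝ} (hW : ContDiff ℝ ∞ W) (hWc : HasCompactSupport W)
    (hWΓ : tsupport (Lop lam W) ⊆ Γ)
    (horth : ∀ ψ : E3 → ℝ, ContDiff ℝ ∞ ψ → HasCompactSupport ψ →
      ∫ x in K, φ x * cv (Jk lam) ψ x = 0) : ∫ x in K, φ x * W x = 0 := by
  obtain ⟨ρ, hρ, hKρ⟩ := hK.isBounded.exists_pos_norm_le
  have hfar := pot_far hlam hK.measurableSet hφ hρ hKρ
    (fun y hy => ann_far hK.measurableSet hφ hKρ horth y (by linarith))
  obtain ⟨p, hpΓ, hp⟩ := hunb (4 * ρ)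
  have hev : ∀ᶠ y in 𝓝 p, pot lam K φ y = 0 := by
    filter_upwards [(isOpen_lt continuous_const continuous_norm).mem_nhds hp] with y hy
      using hfar y hy
  have hΓ0 := pot_gamma hK hφ hΓ hd hdist hpΓ hev
  have hLc := (Lop_contDiff (lam := lam) hW).continuous
  have hf := fubini_cv hK.measurableSet hφ (hLc.integrable_of_hasCompactSupport (Lop_compact hWc))
    (hker_meas lam 1 0 0) (C := d⁻¹) (by
      intro x hx y hy
      have hyΓ : y ∈ Γ := hWΓ (subset_tsupport _ hy)
      have h1 : d ≤ ‖x - y‖ := by rw [← dist_eq_norm, dist_comm]; exact hdist y hyΓ x hx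
      have h2 := hker_bound lam 1 0 0 (x - y) (norm_pos_iff.1 (hd.trans_le h1))
      rw [Real.norm_eq_abs]
      refine h2.trans ?_
      rw [rpow_neg_one]
      simp only [abs_one, abs_zero, add_zero, one_mul]
      exact inv_anti₀ hd h1)
  have h0 : ∫ y, Lop lam W y * ∫ x in K, φ x * hker lam 1 0 0 (x - y) = 0 := by
    refine integral_eq_zero_of_ae (Eventually.of_forall fun y => ?_)
    simp only [Pi.zero_apply]
    by_cases hy : y ∈ tsupport (Lop lam W)
    · rw [← pot_re lam hK.measurableSet hφ hd (hdist y (hWΓ hy)), hΓ0 y (hWΓ hy)]; simp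
    · rw [image_eq_zero_of_notMem_tsupport hy, zero_mul]
  rw [h0] at hf
  have e : ∀ x, cv (hker lam 1 0 0) (Lop lam W) x = - cst * W x := by
    intro x
    have := fund_at lam 1 0 hW hWc x
    rw [mul_one] at this
    exact this
  have e2 : ∫ x in K, φ x * cv (hker lam 1 0 0) (Lop lam W) x = - cst * ∫ x in K, φ x * W x := by
    rw [← integral_const_mul]; congr 1; ext x; rw [e]; ring
  rw [e2] at hf
  have := cst_pos
  rcases mul_eq_zero.1 hf with h | h
  · linarith
  · exact h

lemma memLp_cont {K : Set E3} (hK : IsCompact K) {G : E3 → ℝ} (hG : Continuous G) :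
    MemLp G 2 (volume.restrict K) := by
  obtain ⟨C, hC⟩ := hK.exists_bound_of_continuousOn hG.continuousOn
  have : IsFiniteMeasure ((volume : Measure E3).restrict K) := ⟨by simpa using hK.measure_lt_top⟩
  refine MemLp.of_bound hG.aestronglyMeasurable C ?_
  exact (ae_restrict_iff' hK.measurableSet).2 (Eventually.of_forall hC)

/-- subspace of convolutions -/
def Msub (lam : ℝ) (K : Set E3) : Submodule ℝ (Lp ℝ 2 ((volume : Measure E3).restrict K)) where
  carrier := {F | ∃ ψ : E3 → ℝ, ContDiff ℝ ∞ ψ ∧ HasCompactSupport ψ ∧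
    F =ᵐ[volume.restrict K] cv (Jk lam) ψ}
  zero_mem' := by
    refine ⟨fun _ => 0, contDiff_const, HasCompactSupport.zero, ?_⟩
    filter_upwards [Lp.coeFn_zero ℝ 2 ((volume : Measure E3).restrict K)] with x hx
    rw [hx]; simp [cv]
  add_mem' := by
    rintro F G ⟨ψ, h1, h2, h3⟩ ⟨χ, k1, k2, k3⟩
    refine ⟨fun x => ψ x + χ x, h1.add k1, h2.add k2, ?_⟩
    filter_upwards [Lp.coeFn_add F G, h3, k3] with x hx e1 e2
    rw [hx, Pi.add_apply, e1, e2]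
    unfold cv
    rw [← integral_add (cv_integrable (Jk_locInt lam) h1.continuous h2 x)
      (cv_integrable (Jk_locInt lam) k1.continuous k2 x)]
    simp_rw [smul_add]
  smul_mem' := by
    rintro c F ⟨ψ, h1, h2, h3⟩
    refine ⟨fun x => c * ψ x, contDiff_const.mul h1, h2.mul_left, ?_⟩
    filter_upwards [Lp.coeFn_smul c F, h3] with x hx e1
    rw [hx, Pi.smul_apply, e1]
    unfold cv
    rw [← integral_smul]
    congr 1; ext y; simp only [smul_eq_mul]; ring

theorem l1_density {lam : ℝ} (hlam : 0 < lam) {K : Set E3} (hK : IsCompact K)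
    {Γ : Set E3} (hΓ : IsPreconnected Γ) {d : ℝ} (hd : 0 < d)
    (hdist : ∀ y ∈ Γ, ∀ x ∈ K, d ≤ dist y x) (hunb : ∀ R : ℝ, ∃ p ∈ Γ, R < ‖p‖)
    {W : E3 → ℝ} (hW : ContDiff ℝ ∞ W) (hWc : HasCompactSupport W)
    (hWΓ : tsupport (Lop lam W) ⊆ Γ) {η : ℝ} (hη : 0 < η) :
    ∃ ψ : E3 → ℝ, ContDiff ℝ ∞ ψ ∧ HasCompactSupport ψ ∧
      ∫ x in K, ‖cv (Jk lam) ψ x - W x‖ < η := by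
  have : IsFiniteMeasure ((volume : Measure E3).restrict K) := ⟨by simpa using hK.measure_lt_top⟩
  set μ := (volume : Measure E3).restrict K with hμ
  let W' : Lp ℝ 2 μ := (memLp_cont hK hW.continuous).toLp W
  have hW' : W' =ᵐ[μ] W := MemLp.coeFn_toLp _
  have hmem : W' ∈ (Msub lam K).topologicalClosure := by
    rw [← Submodule.orthogonal_orthogonal_eq_closure, Submodule.mem_orthogonal]
    intro φ hφ
    rw [Submodule.mem_orthogonal] at hφ
    have hφi : IntegrableOn φ K := (Lp.memLp φ).integrable one_le_two
    rw [L2.inner_def]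
    have h := ann_W hlam hK hφi hΓ hd hdist hunb hW hWc hWΓ (by
      intro ψ hψ hc
      let F : Lp ℝ 2 μ := (memLp_cont hK (cv_contDiff (Jk_locInt lam) hψ hc).continuous).toLp _
      have hF : F =ᵐ[μ] cv (Jk lam) ψ := MemLp.coeFn_toLp _
      have h1 := hφ F ⟨ψ, hψ, hc, hF⟩
      rw [L2.inner_def] at h1
      rw [← h1]
      apply integral_congr_ae
      filter_upwards [hF] with x hx
      rw [hx]; simp)
    rw [← h]
    apply integral_congr_ae
    filter_upwards [hW'] with x hx
    rw [hx]; simp [mul_comm]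
  set c : ℝ := (μ Set.univ ^ (1 / (1 : ENNReal).toReal - 1 / (2 : ENNReal).toReal)).toReal with hc
  have hc0 : 0 ≤ c := ENNReal.toReal_nonneg
  obtain ⟨F, hFM, hF⟩ := Metric.mem_closure_iff.1 hmem (η / (c + 1)) (by positivity)
  obtain ⟨ψ, hψ, hψc, hFψ⟩ := hFM
  refine ⟨ψ, hψ, hψc, ?_⟩
  have hfin : μ Set.univ ^ (1 / (1 : ENNReal).toReal - 1 / (2 : ENNReal).toReal) ≠ ⊤ := by
    apply ENNReal.rpow_ne_top_of_nonneg (by norm_num) (measure_ne_top _ _)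
  have e1 : ∫ x in K, ‖cv (Jk lam) ψ x - W x‖ = ∫ x, ‖(F - W' : Lp ℝ 2 μ) x‖ ∂μ := by
    apply integral_congr_ae
    filter_upwards [hFψ, hW', Lp.coeFn_sub F W'] with x h1 h2 h3
    rw [h3, Pi.sub_apply, h1, h2]
  have hm := (Lp.memLp (F - W')).1
  have e2 : ∫ x, ‖(F - W' : Lp ℝ 2 μ) x‖ ∂μ = (eLpNorm (F - W' : Lp ℝ 2 μ) 1 μ).toReal := by
    rw [integral_norm_eq_lintegral_enorm hm, eLpNorm_one_eq_lintegral_enorm]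
  have e3 := eLpNorm_le_eLpNorm_mul_rpow_measure_univ (μ := μ) (p := 1) (q := 2) one_le_two hm
  have e4 : (eLpNorm (F - W' : Lp ℝ 2 μ) 1 μ).toReal ≤ ‖F - W'‖ * c := by
    rw [Lp.norm_def, hc, ← ENNReal.toReal_mul]
    exact ENNReal.toReal_mono (ENNReal.mul_ne_top (Lp.eLpNorm_ne_top _) hfin) e3
  rw [e1, e2]
  refine e4.trans_lt ?_
  rw [dist_comm, dist_eq_norm, lt_div_iff₀ (by positivity)] at hF
  have := norm_nonneg (F - W')
  nlinarith

/-! ### Scalar theorem -/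
open scoped ContDiff

lemma Lop_sub {lam : ℝ} {f g : E3 → ℝ} {x : E3} (hf : ContDiffAt ℝ ∞ f x) (hg : ContDiffAt ℝ ∞ g x) :
    Lop lam (fun z => f z - g z) x = Lop lam f x - Lop lam g x := by
  unfold Lop; rw [lap_sub hf hg]; ring

theorem scalar_approx {lam : ℝ} (hlam : 0 < lam) (S : Set E3) (hS : IsCompact S)
    (hScompl : IsConnected Sᶜ) (Ω : Set E3) (hΩ : IsOpen Ω) (hSΩ : S ⊆ Ω) (w : E3 → ℝ)
    (hw : ContDiffOn ℝ ∞ w Ω) (hLw : ∀ x ∈ Ω, Lop lam w x = 0) (δ : ℝ) (hδ : 0 < δ) (k : ℕ) :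
    ∃ h : E3 → ℝ, ContDiff ℝ ∞ h ∧ (∀ x, Lop lam h x = 0) ∧
      (∀ j : ℕ, ∃ C > (0 : ℝ), ∀ x : E3, ‖x‖ * ‖iteratedFDeriv ℝ j h x‖ ≤ C) ∧
      (∀ j ≤ k, ∀ x ∈ S, ‖iteratedFDeriv ℝ j (fun z => h z - w z) x‖ < δ) := by
  obtain ⟨r, hr, hrΩ⟩ := hS.exists_cthickening_subset_open hΩ hSΩ
  have hcr : IsCompact (Metric.cthickening r S) := hS.cthickening
  obtain ⟨χ, hχ, -, hχs, hχ1⟩ := exists_contMDiff_support_eq_eq_one_iff (modelWithCornersSelf ℝ E3)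
    (n := ⊤) (s := Metric.thickening r S) (t := Metric.cthickening (r / 2) S)
    Metric.isOpen_thickening Metric.isClosed_cthickening
    (Metric.cthickening_subset_thickening' hr (by linarith) S)
  rw [contMDiff_iff_contDiff] at hχ
  have hχts : tsupport χ ⊆ Metric.cthickening r S := by
    rw [tsupport, hχs]; exact Metric.closure_thickening_subset_cthickening r S
  have hχc : HasCompactSupport χ := hcr.of_isClosed_subset (isClosed_tsupport _) hχts
  set W : E3 → ℝ := fun x => χ x * w x with hWdef
  have hW : ContDiff ℝ ∞ W := by
    rw [contDiff_iff_contDiffAt]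
    intro x
    by_cases hx : x ∈ Ω
    · exact hχ.contDiffAt.mul (hw.contDiffAt (hΩ.mem_nhds hx))
    · have hx' : x ∉ tsupport χ := fun h => hx (hrΩ (hχts h))
      have h0 : W =ᶠ[𝓝 x] fun _ => 0 := by
        filter_upwards [(isClosed_tsupport χ).isOpen_compl.mem_nhds hx'] with z hz
        simp [hWdef, image_eq_zero_of_notMem_tsupport hz]
      exact contDiffAt_const.congr_of_eventuallyEq h0
  have hWc : HasCompactSupport W := hχc.mul_right
  set U : Set E3 := Metric.thickening (r / 2) S with hU
  have hUo : IsOpen U := Metric.isOpen_thickening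
  have hWU : ∀ x ∈ U, W =ᶠ[𝓝 x] w := by
    intro x hx
    filter_upwards [hUo.mem_nhds hx] with z hz
    have : χ z = 1 := (hχ1 z).1 (Metric.thickening_subset_cthickening _ _ hz)
    simp [hWdef, this]
  have hUΩ : U ⊆ Ω := fun x hx => hrΩ (Metric.cthickening_mono (by linarith) _
    (Metric.thickening_subset_cthickening _ _ hx))
  have hLU : ∀ x ∈ U, Lop lam W x = 0 := fun x hx => by
    rw [Lop_congr (hWU x hx)]; exact hLw x (hUΩ hx)
  have hSU : S ⊆ U := Metric.self_subset_thickening (by positivity) S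
  have hAU : tsupport (Lop lam W) ⊆ Uᶜ :=
    closure_minimal (fun x hx hxU => hx (hLU x hxU)) hUo.isClosed_compl
  obtain ⟨Γ, hΓ, hAΓ, ε, hε, hΓS, hunb⟩ := exists_gamma S (tsupport (Lop lam W)) hS hScompl
    (Lop_compact hWc) (fun x hx hxS => hAU hx (hSU hxS))
  set e : ℝ := min (ε / 2) (r / 4) with he
  have he0 : 0 < e := by positivity
  have he1 : e ≤ ε / 2 := min_le_left _ _
  have he2 : e ≤ r / 4 := min_le_right _ _
  set K : Set E3 := Metric.cthickening e S with hKdef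
  have hK : IsCompact K := hS.cthickening
  have hKU : K ⊆ U := Metric.cthickening_subset_thickening' (by positivity) (by linarith) S
  have hdist : ∀ y ∈ Γ, ∀ x ∈ K, ε / 2 ≤ dist y x := by
    intro y hy x hx
    rw [hKdef, hS.cthickening_eq_biUnion_closedBall he0.le] at hx
    simp only [Set.mem_iUnion, Metric.mem_closedBall] at hx
    obtain ⟨s, hs, hxs⟩ := hx
    have := hΓS y hy s hs
    have := dist_triangle y x s
    linarith
  obtain ⟨C, hC, hest⟩ := interior_est lam (e / 2) (by positivity) k
  obtain ⟨ψ, hψ, hψc, hψK⟩ := l1_density hlam hK hΓ (by positivity) hdist hunb hW hWc hAΓ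
    (η := δ / C) (by positivity)
  have hh := cv_contDiff (Jk_locInt lam) hψ hψc
  refine ⟨cv (Jk lam) ψ, hh, cvJ_Lop lam hψ hψc, cvJ_decay lam hψ hψc, ?_⟩
  intro j hj x hx
  have h1 := hest K hK (fun z => cv (Jk lam) ψ z - W z) (hh.sub hW) (by
    intro z hz
    rw [Lop_sub hh.contDiffAt hW.contDiffAt, cvJ_Lop lam hψ hψc, hLU z (hKU hz), sub_zero]) x (by
    rw [mul_div_cancel₀ e two_ne_zero]
    exact (Metric.ball_subset_thickening hx e).trans (Metric.thickening_subset_cthickening _ _)) j hj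
  have h2 : (fun z => cv (Jk lam) ψ z - w z) =ᶠ[𝓝 x] fun z => cv (Jk lam) ψ z - W z := by
    filter_upwards [hWU x (hSU hx)] with z hz
    rw [hz]
  rw [(h2.iteratedFDeriv ℝ j).eq_of_nhds]
  refine h1.trans_lt ?_
  rw [lt_div_iff₀ hC] at hψK
  linarith

/-! ### Vector fields -/
open scoped ContDiff

/-- smoothness at a point, componentwise -/
def VS (V : E3 → E3) (x : E3) : Prop := ∀ i : Fin 3, ContDiffAt ℝ ∞ (fun z => V z i) x

lemma VS_iff {V : E3 → E3} {x : E3} : VS V x ↔ ContDiffAt ℝ ∞ V x := (contDiffAt_piLp 2).symm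

lemma curl_0 (V : E3 → E3) (x : E3) :
    curl3 V x 0 = pd 1 (fun z => V z 2) x - pd 2 (fun z => V z 1) x := rfl
lemma curl_1 (V : E3 → E3) (x : E3) :
    curl3 V x 1 = pd 2 (fun z => V z 0) x - pd 0 (fun z => V z 2) x := rfl
lemma curl_2 (V : E3 → E3) (x : E3) :
    curl3 V x 2 = pd 0 (fun z => V z 1) x - pd 1 (fun z => V z 0) x := rfl

lemma E3_ext {a b : E3} (h0 : a 0 = b 0) (h1 : a 1 = b 1) (h2 : a 2 = b 2) : a = b := by
  ext i; fin_cases i <;> assumption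

lemma curl_VS {V : E3 → E3} {x : E3} (h : VS V x) : VS (curl3 V) x := by
  intro i
  fin_cases i
  · exact (pd_contDiffAt (h 2) 1).sub (pd_contDiffAt (h 1) 2)
  · exact (pd_contDiffAt (h 0) 2).sub (pd_contDiffAt (h 2) 0)
  · exact (pd_contDiffAt (h 1) 0).sub (pd_contDiffAt (h 0) 1)

lemma comp_congr {V V' : E3 → E3} {x : E3} (h : V =ᶠ[𝓝 x] V') (i : Fin 3) :
    (fun z => V z i) =ᶠ[𝓝 x] fun z => V' z i := h.mono fun z hz => by simp only [hz]

lemma curl_congr {V V' : E3 → E3} {x : E3} (h : V =ᶠ[𝓝 x] V') : curl3 V x = curl3 V' x := by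
  apply E3_ext
  · rw [curl_0, curl_0, pd_congr (comp_congr h 2), pd_congr (comp_congr h 1)]
  · rw [curl_1, curl_1, pd_congr (comp_congr h 0), pd_congr (comp_congr h 2)]
  · rw [curl_2, curl_2, pd_congr (comp_congr h 1), pd_congr (comp_congr h 0)]

lemma curl_sub {V V' : E3 → E3} {x : E3} (h : VS V x) (h' : VS V' x) :
    curl3 (fun z => V z - V' z) x = curl3 V x - curl3 V' x := by
  have k : ∀ i j, pd i (fun z => (V z - V' z) j) x = pd i (fun z => V z j) x - pd i (fun z => V' z j) x :=
    fun i j => pd_sub (cda_diff (h j)) (cda_diff (h' j)) i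
  apply E3_ext
  · rw [PiLp.sub_apply, curl_0, curl_0, curl_0, k, k]; ring
  · rw [PiLp.sub_apply, curl_1, curl_1, curl_1, k, k]; ring
  · rw [PiLp.sub_apply, curl_2, curl_2, curl_2, k, k]; ring

lemma curl_add {V V' : E3 → E3} {x : E3} (h : VS V x) (h' : VS V' x) :
    curl3 (fun z => V z + V' z) x = curl3 V x + curl3 V' x := by
  have k : ∀ i j, pd i (fun z => (V z + V' z) j) x = pd i (fun z => V z j) x + pd i (fun z => V' z j) x :=
    fun i j => pd_add (cda_diff (h j)) (cda_diff (h' j)) i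
  apply E3_ext
  · rw [PiLp.add_apply, curl_0, curl_0, curl_0, k, k]; ring
  · rw [PiLp.add_apply, curl_1, curl_1, curl_1, k, k]; ring
  · rw [PiLp.add_apply, curl_2, curl_2, curl_2, k, k]; ring

lemma curl_smul {V : E3 → E3} {x : E3} (h : VS V x) (c : ℝ) :
    curl3 (fun z => c • V z) x = c • curl3 V x := by
  have k : ∀ i j, pd i (fun z => (c • V z) j) x = c * pd i (fun z => V z j) x :=
    fun i j => pd_const_mul (cda_diff (h j)) c i
  apply E3_ext
  · rw [PiLp.smul_apply, curl_0, curl_0, k, k, smul_eq_mul]; ring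
  · rw [PiLp.smul_apply, curl_1, curl_1, k, k, smul_eq_mul]; ring
  · rw [PiLp.smul_apply, curl_2, curl_2, k, k, smul_eq_mul]; ring

lemma VS_smul {V : E3 → E3} {x : E3} (h : VS V x) (c : ℝ) : VS (fun z => c • V z) x :=
  fun i => contDiffAt_const.mul (h i)
lemma VS_add {V V' : E3 → E3} {x : E3} (h : VS V x) (h' : VS V' x) : VS (fun z => V z + V' z) x :=
  fun i => (h i).add (h' i)
lemma VS_sub {V V' : E3 → E3} {x : E3} (h : VS V x) (h' : VS V' x) : VS (fun z => V z - V' z) x :=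
  fun i => (h i).sub (h' i)

lemma div_eq (V : E3 → E3) (x : E3) :
    div3 V x = pd 0 (fun z => V z 0) x + pd 1 (fun z => V z 1) x + pd 2 (fun z => V z 2) x := by
  unfold div3; rw [Fin.sum_univ_three]

lemma lap_eq (f : E3 → ℝ) (x : E3) :
    lap3 f x = pd 0 (pd 0 f) x + pd 1 (pd 1 f) x + pd 2 (pd 2 f) x := by
  unfold lap3; rw [Fin.sum_univ_three]

lemma pd_pd_sub {f g : E3 → ℝ} {x : E3} (hf : ContDiffAt ℝ ∞ f x) (hg : ContDiffAt ℝ ∞ g x)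
    (i j k : Fin 3) : pd i (fun z => pd j f z - pd k g z) x = pd i (pd j f) x - pd i (pd k g) x :=
  pd_sub (cda_diff (pd_contDiffAt hf j)) (cda_diff (pd_contDiffAt hg k)) i

lemma div_curl {V : E3 → E3} {x : E3} (h : VS V x) : div3 (curl3 V) x = 0 := by
  rw [div_eq]
  simp only [curl_0, curl_1, curl_2]
  rw [pd_pd_sub (h 2) (h 1), pd_pd_sub (h 0) (h 2), pd_pd_sub (h 1) (h 0)]
  rw [pd_comm (h 2) 0 1, pd_comm (h 1) 0 2, pd_comm (h 0) 1 2]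
  ring

lemma curl_curl {V : E3 → E3} {x : E3} (h : VS V x) (hdiv : ∀ᶠ z in 𝓝 x, div3 V z = 0) (i : Fin 3) :
    curl3 (curl3 V) x i = - lap3 (fun z => V z i) x := by
  have hd : ∀ i, pd i (pd 0 (fun z => V z 0)) x + pd i (pd 1 (fun z => V z 1)) x
      + pd i (pd 2 (fun z => V z 2)) x = 0 := by
    intro i
    have e : (fun z => pd 0 (fun z => V z 0) z + pd 1 (fun z => V z 1) z + pd 2 (fun z => V z 2) z)
        =ᶠ[𝓝 x] fun _ => 0 := by
      filter_upwards [hdiv] with z hz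
      rw [← hz, div_eq]
    have := pd_congr e i
    rw [pd_add (cda_diff ((pd_contDiffAt (h 0) 0).add (pd_contDiffAt (h 1) 1)))
      (cda_diff (pd_contDiffAt (h 2) 2)), pd_add (cda_diff (pd_contDiffAt (h 0) 0))
      (cda_diff (pd_contDiffAt (h 1) 1))] at this
    rw [this]
    simp [pd]
  rw [lap_eq]
  fin_cases i
  · simp only [Fin.zero_eta]
    rw [curl_0]
    simp only [curl_1, curl_2]
    rw [pd_pd_sub (h 1) (h 0), pd_pd_sub (h 0) (h 2), pd_comm (h 1) 1 0, pd_comm (h 2) 2 0]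
    linarith [hd 0]
  · simp only [Fin.mk_one]
    rw [curl_1]
    simp only [curl_0, curl_2]
    rw [pd_pd_sub (h 2) (h 1), pd_pd_sub (h 1) (h 0), pd_comm (h 2) 2 1, pd_comm (h 0) 0 1]
    linarith [hd 1]
  · simp only [Fin.reduceFinMk]
    rw [curl_2]
    simp only [curl_0, curl_1]
    rw [pd_pd_sub (h 0) (h 2), pd_pd_sub (h 2) (h 1), pd_comm (h 0) 0 2, pd_comm (h 1) 1 2]
    linarith [hd 2]

lemma pd_lap {f : E3 → ℝ} {x : E3} (h : ContDiffAt ℝ ∞ f x) (i : Fin 3) :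
    lap3 (pd i f) x = pd i (lap3 f) x := by
  have e : lap3 f = fun z => pd 0 (pd 0 f) z + pd 1 (pd 1 f) z + pd 2 (pd 2 f) z := by
    ext z; rw [lap_eq]
  have c : ∀ j, ContDiffAt ℝ ∞ (pd j (pd j f)) x := fun j => pd_contDiffAt (pd_contDiffAt h j) j
  have k : ∀ j, pd j (pd j (pd i f)) x = pd i (pd j (pd j f)) x := by
    intro j
    have e1 : pd j (pd i f) =ᶠ[𝓝 x] pd i (pd j f) := by
      have : ∀ᶠ z in 𝓝 x, ContDiffAt ℝ 2 f z :=
        (h.of_le (WithTop.coe_le_coe.2 (le_top : (2 : ℕ∞) ≤ ⊤))).eventually (by simp)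
      filter_upwards [this] with z hz
      have hs : IsSymmSndFDerivAt ℝ f z := hz.isSymmSndFDerivAt (by simp)
      have hd : DifferentiableAt ℝ (fderiv ℝ f) z :=
        (hz.fderiv_right (m := 1) (by norm_num)).differentiableAt (by simp)
      have key : ∀ a b : Fin 3, pd a (pd b f) z =
          fderiv ℝ (fderiv ℝ f) z (EuclideanSpace.single a 1) (EuclideanSpace.single b 1) := by
        intro a b
        unfold pd
        rw [fderiv_clm_apply hd (differentiableAt_const _)]
        simp
      rw [key, key]
      exact hs _ _
    rw [pd_congr e1 j, pd_comm (pd_contDiffAt h j)]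
  rw [lap_eq, k, k, k, e, pd_add (cda_diff ((c 0).add (c 1))) (cda_diff (c 2)),
    pd_add (cda_diff (c 0)) (cda_diff (c 1))]

/-- the projection operator -/
def Tb (lam : ℝ) (V : E3 → E3) (x : E3) : E3 :=
  (1 / (2 * lam ^ 2)) • (curl3 (curl3 V) x + lam • curl3 V x)

lemma Tb_VS {lam : ℝ} {V : E3 → E3} {x : E3} (h : VS V x) : VS (Tb lam V) x :=
  VS_smul (VS_add (curl_VS (curl_VS h)) (VS_smul (curl_VS h) lam)) _

lemma lap_curl {mu : ℝ} {V : E3 → E3} (h : ∀ x, VS V x) (hL : ∀ i x, lap3 (fun z => V z i) x = mu * V x i)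
    (i : Fin 3) (x : E3) : lap3 (fun z => curl3 V z i) x = mu * curl3 V x i := by
  have k : ∀ a b, lap3 (pd a fun z => V z b) x = mu * pd a (fun z => V z b) x := by
    intro a b
    rw [pd_lap (h x b), show lap3 (fun z => V z b) = fun z => mu * V z b from funext (hL b),
      pd_const_mul (cda_diff (h x b))]
  fin_cases i
  · simp only [Fin.zero_eta, curl_0]
    rw [lap_sub (pd_contDiffAt (h x 2) 1) (pd_contDiffAt (h x 1) 2), k, k]; ring
  · simp only [Fin.mk_one, curl_1]
    rw [lap_sub (pd_contDiffAt (h x 0) 2) (pd_contDiffAt (h x 2) 0), k, k]; ring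
  · simp only [Fin.reduceFinMk, curl_2]
    rw [lap_sub (pd_contDiffAt (h x 1) 0) (pd_contDiffAt (h x 0) 1), k, k]; ring

lemma Tb_beltrami {lam : ℝ} {V : E3 → E3} (h : ∀ x, VS V x)
    (hL : ∀ i x, lap3 (fun z => V z i) x = - lam ^ 2 * V x i) (x : E3) :
    curl3 (Tb lam V) x = lam • Tb lam V x := by
  have h1 : ∀ x, VS (curl3 V) x := fun x => curl_VS (h x)
  have h2 : ∀ x, VS (curl3 (curl3 V)) x := fun x => curl_VS (h1 x)
  have e : curl3 (curl3 (curl3 V)) x = lam ^ 2 • curl3 V x := by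
    ext i
    rw [curl_curl (h1 x) (Eventually.of_forall fun z => div_curl (h z)), lap_curl h hL]
    simp
  unfold Tb
  rw [curl_smul (VS_add (h2 x) (VS_smul (h1 x) lam)), curl_add (h2 x) (VS_smul (h1 x) lam),
    curl_smul (h1 x), e]
  module

lemma beltrami_lap {lam : ℝ} (hlam : lam ≠ 0) {v : E3 → E3} {Ω : Set E3} (hΩ : IsOpen Ω)
    (hv : ∀ x ∈ Ω, VS v x) (hB : ∀ x ∈ Ω, curl3 v x = lam • v x) {x : E3} (hx : x ∈ Ω) :
    curl3 (curl3 v) x = lam ^ 2 • v x ∧ ∀ i, lap3 (fun z => v z i) x = - lam ^ 2 * v x i := by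
  have ev : ∀ x ∈ Ω, curl3 v =ᶠ[𝓝 x] fun z => lam • v z := fun x hx => by
    filter_upwards [hΩ.mem_nhds hx] with z hz using hB z hz
  have h1 : curl3 (curl3 v) x = lam ^ 2 • v x := by
    rw [curl_congr (ev x hx), curl_smul (hv x hx), hB x hx, smul_smul, pow_two]
  refine ⟨h1, fun i => ?_⟩
  have hdiv : ∀ᶠ z in 𝓝 x, div3 v z = 0 := by
    filter_upwards [hΩ.mem_nhds hx] with z hz
    have h2 := div_curl (hv z hz)
    have h3 : div3 (curl3 v) z = lam * div3 v z := by
      have k : ∀ i, pd i (fun y => curl3 v y i) z = lam * pd i (fun y => v y i) z := by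
        intro i
        rw [pd_congr (comp_congr (ev z hz) i)]
        exact pd_const_mul (cda_diff (hv z hz i)) lam i
      rw [div_eq, div_eq, k, k, k]; ring
    rw [h3] at h2
    exact (mul_eq_zero.1 h2).resolve_left hlam
  have h4 := curl_curl (hv x hx) hdiv i
  rw [h1, PiLp.smul_apply, smul_eq_mul] at h4
  linarith

lemma Tb_sub {lam : ℝ} (hlam : lam ≠ 0) {v w : E3 → E3} {Ω : Set E3} (hΩ : IsOpen Ω)
    (hv : ∀ x ∈ Ω, VS v x) (hB : ∀ x ∈ Ω, curl3 v x = lam • v x) (hw : ∀ x, VS w x) {x : E3}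
    (hx : x ∈ Ω) : Tb lam w x - v x = Tb lam (fun z => w z - v z) x := by
  have h1 := (beltrami_lap hlam hΩ hv hB hx).1
  have ev : curl3 (fun z => w z - v z) =ᶠ[𝓝 x] fun z => curl3 w z - curl3 v z := by
    filter_upwards [hΩ.mem_nhds hx] with z hz using curl_sub (hw z) (hv z hz)
  unfold Tb
  rw [curl_congr ev, curl_sub (curl_VS (hw x)) (curl_VS (hv x hx)), h1, ev.eq_of_nhds, hB x hx]
  have e : v x = (1 / (2 * lam ^ 2)) • (lam ^ 2 • v x + lam • lam • v x) := by
    rw [smul_smul lam lam, ← pow_two, ← add_smul, smul_smul]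
    rw [show 1 / (2 * lam ^ 2) * (lam ^ 2 + lam ^ 2) = 1 by field_simp; norm_num, one_smul]
  nth_rewrite 1 [e]
  module

/-! norms -/

/-- sum of the norms of the derivatives of the components -/
def Nj (j : ℕ) (V : E3 → E3) (x : E3) : ℝ := ∑ i : Fin 3, ‖iteratedFDeriv ℝ j (fun z => V z i) x‖

lemma cda_nat {F : Type*} [NormedAddCommGroup F] [NormedSpace ℝ F] {f : E3 → F} {x : E3}
    (h : ContDiffAt ℝ ∞ f x) (j : ℕ) : ContDiffAt ℝ j f x := h.of_le (by exact_mod_cast le_top)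

lemma norm_le_Nj {V : E3 → E3} {x : E3} (h : VS V x) (j : ℕ) : ‖iteratedFDeriv ℝ j V x‖ ≤ Nj j V x := by
  have hV : ContDiffAt ℝ j V x := cda_nat (VS_iff.1 h) j
  refine ContinuousMultilinearMap.opNorm_le_bound (Finset.sum_nonneg fun _ _ => norm_nonneg _) fun m => ?_
  have hc : ∀ i, (iteratedFDeriv ℝ j V x m) i = iteratedFDeriv ℝ j (fun z => V z i) x m := by
    intro i
    have := (EuclideanSpace.proj (𝕜 := ℝ) i : E3 →L[ℝ] ℝ).iteratedFDeriv_comp_left hV (i := j) le_rfl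
    have e : (⇑(EuclideanSpace.proj (𝕜 := ℝ) i : E3 →L[ℝ] ℝ) ∘ V) = fun z => V z i := rfl
    rw [e] at this
    rw [this]; rfl
  unfold Nj
  rw [Finset.sum_mul]
  have h1 : ‖iteratedFDeriv ℝ j V x m‖ ≤ ∑ i, ‖(iteratedFDeriv ℝ j V x m) i‖ := by
    generalize iteratedFDeriv ℝ j V x m = a
    rw [EuclideanSpace.norm_eq]
    refine sqrt_le_iff.2 ⟨Finset.sum_nonneg fun _ _ => norm_nonneg _, ?_⟩
    rw [Fin.sum_univ_three, Fin.sum_univ_three]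
    nlinarith [norm_nonneg (a 0), norm_nonneg (a 1), norm_nonneg (a 2),
      mul_nonneg (norm_nonneg (a 0)) (norm_nonneg (a 1)),
      mul_nonneg (norm_nonneg (a 0)) (norm_nonneg (a 2)),
      mul_nonneg (norm_nonneg (a 1)) (norm_nonneg (a 2))]
  refine h1.trans (Finset.sum_le_sum fun i _ => ?_)
  rw [hc]
  exact ContinuousMultilinearMap.le_opNorm _ _

lemma pd_iter {f : E3 → ℝ} {x : E3} (h : ContDiffAt ℝ ∞ f x) (i : Fin 3) (j : ℕ) :
    ‖iteratedFDeriv ℝ j (pd i f) x‖ ≤ ‖iteratedFDeriv ℝ (j + 1) f x‖ := by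
  let L : (E3 →L[ℝ] ℝ) →L[ℝ] ℝ := ContinuousLinearMap.apply ℝ ℝ (EuclideanSpace.single i 1 : E3)
  have e : pd i f = L ∘ fderiv ℝ f := rfl
  have h1 : ContDiffAt ℝ j (fderiv ℝ f) x := cda_nat (h.fderiv_right (m := ∞) (by simp)) j
  have hL : ‖L‖ ≤ 1 := by
    refine ContinuousLinearMap.opNorm_le_bound _ zero_le_one fun g => ?_
    have := g.le_opNorm (EuclideanSpace.single i 1 : E3)
    simp only [EuclideanSpace.norm_single, norm_one, mul_one] at this
    rw [one_mul]; exact this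
  rw [e]
  refine (L.norm_iteratedFDeriv_comp_left h1 le_rfl).trans ?_
  rw [norm_iteratedFDeriv_fderiv]
  exact mul_le_of_le_one_left (norm_nonneg _) hL

lemma it_sub {f g : E3 → ℝ} {x : E3} (hf : ContDiffAt ℝ ∞ f x) (hg : ContDiffAt ℝ ∞ g x) (j : ℕ) :
    ‖iteratedFDeriv ℝ j (fun z => f z - g z) x‖ ≤ ‖iteratedFDeriv ℝ j f x‖ + ‖iteratedFDeriv ℝ j g x‖ := by
  have := iteratedFDeriv_sub_apply (cda_nat hf j) (cda_nat hg j)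
  have e : (fun z => f z - g z) = f - g := rfl
  rw [e, this]; exact norm_sub_le _ _

lemma it_add {f g : E3 → ℝ} {x : E3} (hf : ContDiffAt ℝ ∞ f x) (hg : ContDiffAt ℝ ∞ g x) (j : ℕ) :
    ‖iteratedFDeriv ℝ j (fun z => f z + g z) x‖ ≤ ‖iteratedFDeriv ℝ j f x‖ + ‖iteratedFDeriv ℝ j g x‖ := by
  have := iteratedFDeriv_add_apply (cda_nat hf j) (cda_nat hg j)
  have e : (fun z => f z + g z) = f + g := rfl
  rw [e, this]; exact norm_add_le _ _

lemma it_smul {f : E3 → ℝ} {x : E3} (hf : ContDiffAt ℝ ∞ f x) (c : ℝ) (j : ℕ) :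
    ‖iteratedFDeriv ℝ j (fun z => c * f z) x‖ = |c| * ‖iteratedFDeriv ℝ j f x‖ := by
  have := iteratedFDeriv_const_smul_apply (a := c) (cda_nat hf j)
  have e : (fun z => c * f z) = c • f := rfl
  rw [e, this, norm_smul, Real.norm_eq_abs]

lemma Nj_curl {V : E3 → E3} {x : E3} (h : VS V x) (j : ℕ) : Nj j (curl3 V) x ≤ 2 * Nj (j + 1) V x := by
  have k : ∀ a b a' b', ‖iteratedFDeriv ℝ j (fun z => pd a (fun y => V y b) z - pd a' (fun y => V y b') z) x‖
      ≤ ‖iteratedFDeriv ℝ (j + 1) (fun y => V y b) x‖ + ‖iteratedFDeriv ℝ (j + 1) (fun y => V y b') x‖ :=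
    fun a b a' b' => (it_sub (pd_contDiffAt (h b) a) (pd_contDiffAt (h b') a') j).trans
      (add_le_add (pd_iter (h b) a j) (pd_iter (h b') a' j))
  unfold Nj
  rw [Fin.sum_univ_three, Fin.sum_univ_three]
  simp only [curl_0, curl_1, curl_2]
  linarith [k 1 2 2 1, k 2 0 0 2, k 0 1 1 0]

lemma Nj_add {V V' : E3 → E3} {x : E3} (h : VS V x) (h' : VS V' x) (j : ℕ) :
    Nj j (fun z => V z + V' z) x ≤ Nj j V x + Nj j V' x := by
  unfold Nj
  rw [← Finset.sum_add_distrib]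
  exact Finset.sum_le_sum fun i _ => it_add (h i) (h' i) j

lemma Nj_smul {V : E3 → E3} {x : E3} (h : VS V x) (c : ℝ) (j : ℕ) :
    Nj j (fun z => c • V z) x = |c| * Nj j V x := by
  unfold Nj
  rw [Finset.mul_sum]
  exact Finset.sum_congr rfl fun i _ => it_smul (h i) c j

lemma Nj_Tb {lam : ℝ} {V : E3 → E3} {x : E3} (h : VS V x) (j : ℕ) :
    Nj j (Tb lam V) x ≤ |1 / (2 * lam ^ 2)| * (4 * Nj (j + 2) V x + 2 * |lam| * Nj (j + 1) V x) := by
  unfold Tb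
  have h1 := curl_VS h
  have h2 := curl_VS h1
  rw [Nj_smul (VS_add h2 (VS_smul h1 lam))]
  gcongr
  refine (Nj_add h2 (VS_smul h1 lam) j).trans ?_
  rw [Nj_smul h1]
  have a1 := Nj_curl h1 j
  have a2 := Nj_curl h (j + 1)
  have a3 := Nj_curl h j
  have a4 := mul_le_mul_of_nonneg_left a3 (abs_nonneg lam)
  linarith

theorem main_aux
    (S : Set E3) (hS : IsCompact S) (hScompl : IsConnected Sᶜ)
    (lam : ℝ) (hlam : lam ≠ 0)
    (v : E3 → E3) (Ω : Set E3) (hΩ : IsOpen Ω) (hSΩ : S ⊆ Ω)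
    (hv : ContDiffOn ℝ (⊤ : ℕ∞) v Ω)
    (hBeltrami : ∀ x ∈ Ω, curl3 v x = lam • v x)
    (δ : ℝ) (hδ : 0 < δ) (k : ℕ) :
    ∃ u : E3 → E3,
      ContDiff ℝ (⊤ : ℕ∞) u ∧
      (∀ x : E3, curl3 u x = lam • u x) ∧
      (∀ j : ℕ, ∃ C > (0 : ℝ), ∀ x : E3, ‖x‖ * ‖iteratedFDeriv ℝ j u x‖ ≤ C) ∧
      (∀ j ≤ k, ∀ x ∈ S, ‖iteratedFDeriv ℝ j (fun z => u z - v z) x‖ < δ) := by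
  have hvs : ∀ x ∈ Ω, VS v x := fun x hx => VS_iff.2 (hv.contDiffAt (hΩ.mem_nhds hx))
  set c : ℝ := |1 / (2 * lam ^ 2)| with hc
  have hc0 : 0 ≤ c := abs_nonneg _
  set δ' : ℝ := δ / (c * (12 + 6 * |lam|) + 1) with hδ'
  have hδ'0 : 0 < δ' := by positivity
  have happ : ∀ i : Fin 3, ∃ h : E3 → ℝ, ContDiff ℝ ∞ h ∧ (∀ x, Lop |lam| h x = 0) ∧
      (∀ j : ℕ, ∃ C > (0 : ℝ), ∀ x : E3, ‖x‖ * ‖iteratedFDeriv ℝ j h x‖ ≤ C) ∧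
      (∀ j ≤ k + 2, ∀ x ∈ S, ‖iteratedFDeriv ℝ j (fun z => h z - v z i) x‖ < δ') := by
    intro i
    refine scalar_approx (abs_pos.2 hlam) S hS hScompl Ω hΩ hSΩ (fun z => v z i)
      (fun x hx => (hvs x hx i).contDiffWithinAt) ?_ δ' hδ'0 (k + 2)
    intro x hx
    unfold Lop
    rw [(beltrami_lap hlam hΩ hvs hBeltrami hx).2 i, sq_abs]; ring
  choose h hsm hLop hdec hclose using happ
  let w : E3 → E3 := fun z => WithLp.toLp 2 fun i => h i z
  have hw : ∀ x, VS w x := fun x i => (hsm i).contDiffAt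
  have hL : ∀ i x, lap3 (fun z => w z i) x = - lam ^ 2 * w x i := by
    intro i x
    have := hLop i x
    unfold Lop at this
    rw [sq_abs] at this
    change lap3 (h i) x = - lam ^ 2 * h i x
    linarith
  refine ⟨Tb lam w, ?_, Tb_beltrami hw hL, ?_, ?_⟩
  · rw [contDiff_iff_contDiffAt]
    intro x
    exact VS_iff.1 (Tb_VS (hw x))
  · have hN : ∀ j, ∃ C > (0 : ℝ), ∀ x, ‖x‖ * Nj j w x ≤ C := by
      intro j
      choose C hC hCx using fun i => hdec i j
      refine ⟨∑ i, C i, Finset.sum_pos (fun i _ => hC i) Finset.univ_nonempty, fun x => ?_⟩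
      unfold Nj
      rw [Finset.mul_sum]
      exact Finset.sum_le_sum fun i _ => hCx i x
    intro j
    obtain ⟨C1, hC1, h1⟩ := hN (j + 1)
    obtain ⟨C2, hC2, h2⟩ := hN (j + 2)
    refine ⟨c * (4 * C2 + 2 * |lam| * C1) + 1, by positivity, fun x => ?_⟩
    have a1 := (norm_le_Nj (Tb_VS (lam := lam) (hw x)) j).trans (Nj_Tb (hw x) j)
    calc ‖x‖ * ‖iteratedFDeriv ℝ j (Tb lam w) x‖
        ≤ ‖x‖ * (c * (4 * Nj (j + 2) w x + 2 * |lam| * Nj (j + 1) w x)) := by gcongr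
      _ = c * (4 * (‖x‖ * Nj (j + 2) w x) + 2 * |lam| * (‖x‖ * Nj (j + 1) w x)) := by ring
      _ ≤ c * (4 * C2 + 2 * |lam| * C1) := by gcongr; exacts [h2 x, h1 x]
      _ ≤ _ := by linarith
  · intro j hj x hx
    have hxΩ := hSΩ hx
    have ev : (fun z => Tb lam w z - v z) =ᶠ[𝓝 x] Tb lam (fun z => w z - v z) := by
      filter_upwards [hΩ.mem_nhds hxΩ] with z hz using Tb_sub hlam hΩ hvs hBeltrami hw hz
    rw [(ev.iteratedFDeriv ℝ j).eq_of_nhds]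
    have hwv := VS_sub (hw x) (hvs x hxΩ)
    have a1 := (norm_le_Nj (Tb_VS (lam := lam) hwv) j).trans (Nj_Tb hwv j)
    have hN : ∀ j ≤ k + 2, Nj j (fun z => w z - v z) x ≤ 3 * δ' := by
      intro j hj
      unfold Nj
      rw [Fin.sum_univ_three]
      have b0 := hclose 0 j hj x hx
      have b1 := hclose 1 j hj x hx
      have b2 := hclose 2 j hj x hx
      change ‖iteratedFDeriv ℝ j (fun z => h 0 z - v z 0) x‖ +
        ‖iteratedFDeriv ℝ j (fun z => h 1 z - v z 1) x‖ +
        ‖iteratedFDeriv ℝ j (fun z => h 2 z - v z 2) x‖ ≤ 3 * δ'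
      linarith
    have n1 := hN (j + 1) (by omega)
    have n2 := hN (j + 2) (by omega)
    refine a1.trans_lt ?_
    calc c * (4 * Nj (j + 2) (fun z => w z - v z) x + 2 * |lam| * Nj (j + 1) (fun z => w z - v z) x)
        ≤ c * (4 * (3 * δ') + 2 * |lam| * (3 * δ')) := by gcongr
      _ = c * (12 + 6 * |lam|) * δ' := by ring
      _ < (c * (12 + 6 * |lam|) + 1) * δ' := by linarith
      _ = δ := by rw [hδ']; field_simp

/-- **Global approximation by Beltrami fields with decay** (Theorem 8.3).
If `v` satisfies `curl v = λ v` in a neighborhood of a compact set `S ⊂ ℝ³` with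
connected complement, then for any `δ > 0` and `k` there is a global Beltrami field `u`,
`curl u = λ u` on `ℝ³`, with the optimal fall-off `|Dʲu(x)| < C_j/|x|`, such that
`‖u − v‖_{C^k(S)} < δ`. -/
theorem global_approximation_by_decaying_beltrami_fields
    (S : Set E3) (hS : IsCompact S) (hScompl : IsConnected Sᶜ)
    (lam : ℝ) (hlam : lam ≠ 0)
    (v : E3 → E3) (Ω : Set E3) (hΩ : IsOpen Ω) (hSΩ : S ⊆ Ω)
    (hv : ContDiffOn ℝ (⊤ : ℕ∞) v Ω)
    (hBeltrami : ∀ x ∈ Ω, curl3 v x = lam • v x)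
    (δ : ℝ) (hδ : 0 < δ) (k : ℕ) (hk : 0 < k) :
    ∃ u : E3 → E3,
      ContDiff ℝ (⊤ : ℕ∞) u ∧
      (∀ x : E3, curl3 u x = lam • u x) ∧
      (∀ j : ℕ, ∃ C > (0 : ℝ), ∀ x : E3, ‖x‖ * ‖iteratedFDeriv ℝ j u x‖ ≤ C) ∧
      (∀ j ≤ k, ∀ x ∈ S, ‖iteratedFDeriv ℝ j (fun z => u z - v z) x‖ < δ) := by
  exact main_aux S hS hScompl lam hlam v Ω hΩ hSΩ hv hBeltrami δ hδ k
end
end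

section
/- Let v be a vector field satisfying Δv = −λ²v (componentwise, λ a real constant) in an open neighborhood of a compact set S ⊂ ℝ³ whose complement ℝ³∖S is connected and which is contained in the ball 𝔹_R. Then for any δ > 0 and any positive integer k there is a vector field w satisfying Δw = −λ²w in an open neighborhood of the closed ball 𝔹_R such that ‖v − w‖_{C^k(S)} < δ. -/
open Filter Topology MeasureTheory Real
open scoped RealInnerProductSpace

set_option linter.unusedVariables false
noncomputable section

namespace HelmAux
open scoped ENNReal NNReal

section Analytic
variable {E F : Type*} [NormedAddCommGroup E] [NormedSpace ℝ E]
  [NormedAddCommGroup F] [NormedSpace ℝ F]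

/-- Locally uniform power series bounds. -/
lemma local_bound [CompleteSpace F] {H : E → F} {z : E} (h : AnalyticAt ℝ H z) :
    ∃ r : ℝ≥0, 0 < r ∧ ∃ C : ℝ, ∀ d : E, ‖d‖ ≤ r → ∃ p : FormalMultilinearSeries ℝ E F,
      (∀ n, ‖p n‖ * (r : ℝ) ^ n ≤ C) ∧
      ∀ t : E, ‖t‖ < r → HasSum (fun n => p n (fun _ => t)) (H (z + d + t)) := by
  obtain ⟨p, ρ, hp⟩ := h
  obtain ⟨s, hs0, hs⟩ := ENNReal.lt_iff_exists_nnreal_btwn.1 hp.r_pos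
  have hs0' : 0 < s := by exact_mod_cast hs0
  set r : ℝ≥0 := s / 2 with hr
  have hr0 : 0 < r := by positivity
  have hrr : (r + r : ℝ≥0∞) = s := by
    rw [← ENNReal.coe_add, hr, add_halves]
  have hrad : (r + r : ℝ≥0∞) < p.radius := by rw [hrr]; exact hs.trans_le hp.r_le
  have hsum := p.changeOriginSeries_summable_aux₁ hrad
  refine ⟨r, hr0, ((∑' k : Σ k l : ℕ, { s : Finset (Fin (k + l)) // s.card = l },
      ‖p (k.1 + k.2.1)‖₊ * r ^ k.2.1 * r ^ k.1 : ℝ≥0) : ℝ), fun d hd => ?_⟩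
  have hd' : ‖d‖₊ ≤ r := hd
  have hdr : (‖d‖₊ : ℝ≥0∞) < ρ := by
    refine lt_of_le_of_lt ?_ hs
    rw [← hrr]
    exact le_trans (by exact_mod_cast hd') le_self_add
  refine ⟨p.changeOrigin d, fun n => ?_, fun t ht => ?_⟩
  · have h1 := p.nnnorm_changeOrigin_le n (hdr.trans_le hp.r_le)
    have h2 := NNReal.summable_sigma.1 hsum
    have h3 : ‖p.changeOrigin d n‖₊ * r ^ n ≤ ∑' s : Σ l : ℕ, { s : Finset (Fin (n + l)) // s.card = l },
        ‖p (n + s.1)‖₊ * r ^ s.1 * r ^ n := by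
      rw [NNReal.tsum_mul_right]
      gcongr
      refine h1.trans ?_
      have h4 := (h2.1 n).mul_right (r ^ n)⁻¹
      have h5 : Summable (fun s : Σ l : ℕ, { s : Finset (Fin (n + l)) // s.card = l } =>
          ‖p (n + s.1)‖₊ * r ^ s.1) := by
        refine h4.congr fun s => ?_
        field_simp
      refine Summable.tsum_le_tsum (fun s => ?_) ?_ h5
      · gcongr
      · exact NNReal.summable_of_le (fun s => by gcongr) h5
    have h6 := h3.trans (h2.2.le_tsum n (fun _ _ => zero_le))
    rw [← hsum.tsum_sigma' h2.1] at h6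
    exact_mod_cast h6
  · have h1 := hp.changeOrigin hdr
    have h2 : t ∈ Metric.eball (0 : E) (ρ - ‖d‖₊) := by
      rw [Metric.mem_eball, edist_zero_right]
      refine lt_of_lt_of_le ?_ (tsub_le_tsub hs.le (show (‖d‖₊ : ℝ≥0∞) ≤ (r : ℝ≥0∞) by exact_mod_cast hd'))
      rw [← hrr, ENNReal.add_sub_cancel_right ENNReal.coe_ne_top]
      rw [enorm_eq_nnnorm]
      exact_mod_cast ht
    exact h1.hasSum h2

/-- The bounded function `x ↦ f x` on `S`, or zero. -/
def toBdd {α : Type*} (f : α → F) : lp (fun _ : α => F) ∞ :=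
  open Classical in if h : Memℓp f ∞ then ⟨f, h⟩ else 0

lemma toBdd_apply {α : Type*} {f : α → F} (h : Memℓp f ∞) (x : α) : toBdd f x = f x := by
  simp [toBdd, h]

/-- Multilinear maps with values in bounded functions. -/
def mulBdd {α : Type*} {n : ℕ} (p : α → ContinuousMultilinearMap ℝ (fun _ : Fin n => E) F) (C : ℝ)
    (hC : ∀ x, ‖p x‖ ≤ C) : ContinuousMultilinearMap ℝ (fun _ : Fin n => E) (lp (fun _ : α => F) ∞) :=
  have hb : ∀ m : Fin n → E, ∀ x, ‖p x m‖ ≤ |C| * ∏ i, ‖m i‖ := fun m x =>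
    ((p x).le_opNorm m).trans (by
      gcongr
      exact (hC x).trans (le_abs_self C))
  have hm : ∀ m : Fin n → E, Memℓp (fun x => p x m) ∞ := fun m => memℓp_infty
    ⟨|C| * ∏ i, ‖m i‖, by rintro _ ⟨x, rfl⟩; exact hb m x⟩
  MultilinearMap.mkContinuous
    { toFun := fun m => (⟨fun x => p x m, hm m⟩ : lp (fun _ : α => F) ∞)
      map_update_add' := by
        intro _ m i a b
        ext x
        have := (p x).map_update_add m i a b
        simp only [lp.coeFn_add, Pi.add_apply]
        convert this
      map_update_smul' := by
        intro _ m i a b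
        ext x
        have := (p x).map_update_smul m i a b
        simp only [lp.coeFn_smul, Pi.smul_apply]
        convert this } |C|
    (fun m => lp.norm_le_of_forall_le (by positivity) (hb m))

lemma mulBdd_apply {α : Type*} {n : ℕ} (p : α → ContinuousMultilinearMap ℝ (fun _ : Fin n => E) F) (C : ℝ)
    (hC : ∀ x, ‖p x‖ ≤ C) (m : Fin n → E) (x : α) : mulBdd p C hC m x = p x m := rfl

lemma norm_mulBdd {α : Type*} {n : ℕ} (p : α → ContinuousMultilinearMap ℝ (fun _ : Fin n => E) F) (C : ℝ)
    (hC : ∀ x, ‖p x‖ ≤ C) : ‖mulBdd p C hC‖ ≤ |C| :=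
  ContinuousMultilinearMap.opNorm_le_bound (abs_nonneg C) fun m =>
    lp.norm_le_of_forall_le (by positivity) fun x => by
      rw [mulBdd_apply]
      refine ((p x).le_opNorm m).trans ?_
      gcongr
      exact (hC x).trans (le_abs_self C)

/-- A family of functions with uniformly bounded power series is analytic as a map into
bounded functions. -/
lemma analytic_family [CompleteSpace F] {α : Type*} (K : α → E → F) (r : ℝ≥0) (hr : 0 < r) (C : ℝ)
    (h : ∀ x, ∃ p : FormalMultilinearSeries ℝ E F, (∀ n, ‖p n‖ * (r : ℝ) ^ n ≤ C) ∧
      ∀ t : E, ‖t‖ < r → HasSum (fun n => p n (fun _ => t)) (K x t)) :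
    AnalyticAt ℝ (fun t => toBdd (fun x => K x t)) 0 ∧
      ∀ t, ‖t‖ < r → Memℓp (fun x => K x t) ∞ := by
  choose p hpC hpS using h
  have hr' : (0 : ℝ) < r := hr
  have hC' : ∀ n x, ‖p x n‖ ≤ C / r ^ n := fun n x => by
    rw [le_div_iff₀ (by positivity)]; exact hpC x n
  let q : FormalMultilinearSeries ℝ E (lp (fun _ : α => F) ∞) := fun n =>
    mulBdd (fun x => p x n) (C / r ^ n) (hC' n)
  have hq : ∀ n, ‖q n‖ * (r : ℝ) ^ n ≤ |C| := fun n => by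
    have := norm_mulBdd (fun x => p x n) (C / r ^ n) (hC' n)
    rw [abs_div, abs_of_pos (by positivity : (0 : ℝ) < r ^ n), le_div_iff₀ (by positivity)] at this
    exact this
  have hqr : (r : ℝ≥0∞) ≤ q.radius := q.le_radius_of_bound |C| hq
  have key : ∀ t, ‖t‖ < r → ∃ a : lp (fun _ : α => F) ∞, HasSum (fun n => q n (fun _ => t)) a ∧
      ∀ x, a x = K x t := fun t ht => by
    have hs : Summable (fun n => q n (fun _ => t)) := by
      apply q.summable
      refine Metric.eball_subset_eball hqr ?_
      rw [Metric.mem_eball, edist_zero_right, enorm_eq_nnnorm]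
      exact_mod_cast ht
    refine ⟨_, hs.hasSum, fun x => ?_⟩
    have h1 := (lp.evalCLM ℝ (fun _ : α => F) ∞ x).hasSum hs.hasSum
    exact h1.unique (hpS x t ht)
  have hmem : ∀ t, ‖t‖ < r → Memℓp (fun x => K x t) ∞ := fun t ht => by
    obtain ⟨a, -, ha⟩ := key t ht
    have := lp.memℓp a
    rwa [show (a : ∀ _ : α, F) = fun x => K x t from funext ha] at this
  refine ⟨⟨q, r, ⟨hqr, by exact_mod_cast hr, ?_⟩⟩, hmem⟩
  intro t ht
  rw [Metric.mem_eball, edist_zero_right, enorm_eq_nnnorm] at ht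
  have ht' : ‖t‖ < r := by exact_mod_cast ht
  obtain ⟨a, ha, hax⟩ := key t ht'
  rw [zero_add]
  convert ha
  ext x
  rw [toBdd_apply (hmem t ht'), hax x]

lemma analytic_translates [CompleteSpace F] {H : E → F} (hH : AnalyticOnNhd ℝ H {0}ᶜ) {S : Set E}
    (hS : IsCompact S) {y : E} (hy : y ∉ S) :
    AnalyticAt ℝ (fun y => toBdd (fun x : S => H (x - y))) y ∧
      Memℓp (fun x : S => H (x - y)) ∞ := by
  have main : ∃ r : ℝ≥0, 0 < r ∧ ∃ C : ℝ, ∀ x ∈ S, ∃ p : FormalMultilinearSeries ℝ E F,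
      (∀ n, ‖p n‖ * (r : ℝ) ^ n ≤ C) ∧
      ∀ t : E, ‖t‖ < r → HasSum (fun n => p n (fun _ => t)) (H (x - y + t)) := by
    refine hS.induction_on (p := fun T => ∃ r : ℝ≥0, 0 < r ∧ ∃ C : ℝ, ∀ x ∈ T,
      ∃ p : FormalMultilinearSeries ℝ E F, (∀ n, ‖p n‖ * (r : ℝ) ^ n ≤ C) ∧
      ∀ t : E, ‖t‖ < r → HasSum (fun n => p n (fun _ => t)) (H (x - y + t))) ?_ ?_ ?_ ?_
    · exact ⟨1, one_pos, 0, by simp⟩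
    · rintro s t hst ⟨r, hr, C, h⟩
      exact ⟨r, hr, C, fun x hx => h x (hst hx)⟩
    · rintro s t ⟨r, hr, C, h⟩ ⟨r', hr', C', h'⟩
      refine ⟨min r r', lt_min hr hr', max C C', ?_⟩
      rintro x (hx | hx)
      · obtain ⟨p, hp, hp'⟩ := h x hx
        refine ⟨p, fun n => le_trans ?_ ((hp n).trans (le_max_left _ _)), fun t ht => hp' t (ht.trans_le ?_)⟩
        · gcongr; exact min_le_left _ _
        · exact_mod_cast min_le_left _ _
      · obtain ⟨p, hp, hp'⟩ := h' x hx
        refine ⟨p, fun n => le_trans ?_ ((hp n).trans (le_max_right _ _)), fun t ht => hp' t (ht.trans_le ?_)⟩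
        · gcongr; exact min_le_right _ _
        · exact_mod_cast min_le_right _ _
    · intro x hx
      have hxy : x - y ≠ 0 := fun h => hy (by rwa [← sub_eq_zero.1 h])
      obtain ⟨r, hr, C, h⟩ := local_bound (hH (x - y) hxy)
      refine ⟨Metric.closedBall x r, mem_nhdsWithin_of_mem_nhds (Metric.closedBall_mem_nhds x hr),
        r, hr, C, fun x' hx' => ?_⟩
      obtain ⟨p, hp, hp'⟩ := h (x' - x) (by rwa [← dist_eq_norm])
      refine ⟨p, hp, fun t ht => ?_⟩
      have := hp' t ht
      rwa [show x - y + (x' - x) = x' - y by abel] at this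
  obtain ⟨r, hr, C, h⟩ := main
  obtain ⟨h1, h2⟩ := analytic_family (fun (x : S) t => H (x - y + t)) r hr C (fun x => h x x.2)
  constructor
  · have h3 : AnalyticAt ℝ (fun y' : E => y - y') y := analyticAt_const.sub analyticAt_id
    rw [← sub_self y] at h1
    have h4 := AnalyticAt.comp (f := fun y' : E => y - y') h1 h3
    convert h4 using 1
    funext y'
    simp [Function.comp_def]
  · simpa using h2 0 (by simpa using hr)

end Analytic
end HelmAux

namespace HelmAux
open scoped ENNReal NNReal ContDiff

def gf (lam q : ℝ) : ℝ := Real.cos (lam * √q) / √q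
def gf1 (lam q : ℝ) : ℝ :=
  -(lam * Real.sin (lam * √q)) / (2 * √q ^ 2) - Real.cos (lam * √q) / (2 * √q ^ 3)
def gf2 (lam q : ℝ) : ℝ :=
  3 * Real.cos (lam * √q) / (4 * √q ^ 5) - lam ^ 2 * Real.cos (lam * √q) / (4 * √q ^ 3)
    + 3 * lam * Real.sin (lam * √q) / (4 * √q ^ 4)

lemma hasDerivAt_gf (lam : ℝ) {q : ℝ} (hq : 0 < q) : HasDerivAt (gf lam) (gf1 lam q) q := by
  have ht : 0 < √q := Real.sqrt_pos.2 hq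
  have h0 : HasDerivAt (fun q => √q) (1 / (2 * √q)) q := Real.hasDerivAt_sqrt hq.ne'
  have h1 := ((h0.const_mul lam).cos).div h0 ht.ne'
  refine h1.congr_deriv ?_
  unfold gf1
  field_simp

lemma hasDerivAt_gf1 (lam : ℝ) {q : ℝ} (hq : 0 < q) : HasDerivAt (gf1 lam) (gf2 lam q) q := by
  have ht : 0 < √q := Real.sqrt_pos.2 hq
  have h0 : HasDerivAt (fun q => √q) (1 / (2 * √q)) q := Real.hasDerivAt_sqrt hq.ne'
  have h1 := (((h0.const_mul lam).sin.const_mul lam).neg.div ((h0.pow 2).const_mul 2)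
    (by simp; positivity)).sub
    ((h0.const_mul lam).cos.div ((h0.pow 3).const_mul 2) (by simp; positivity))
  refine h1.congr_deriv ?_
  unfold gf2
  simp only [Pi.pow_apply, Pi.neg_apply]
  field_simp
  ring

lemma gf_ode (lam : ℝ) {q : ℝ} (hq : 0 < q) :
    4 * q * gf2 lam q + 6 * gf1 lam q + lam ^ 2 * gf lam q = 0 := by
  have ht : 0 < √q := Real.sqrt_pos.2 hq
  have : q = √q ^ 2 := (Real.sq_sqrt hq.le).symm
  rw [show 4 * q * gf2 lam q = 4 * √q ^ 2 * gf2 lam q by rw [← this]]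
  unfold gf gf1 gf2
  field_simp
  ring

/-- Radial kernel. -/
def Ker (lam q0 : ℝ) (y : E3) : ℝ := gf lam (‖y‖ ^ 2 + q0)

lemma hasFDerivAt_normsq (q0 : ℝ) (y : E3) :
    HasFDerivAt (fun y : E3 => ‖y‖ ^ 2 + q0) (2 • innerSL ℝ y) y := by
  simpa using (hasStrictFDerivAt_norm_sq y).hasFDerivAt.add_const q0

lemma pd_radial {h h1 : ℝ → ℝ} (hh : ∀ q, 0 < q → HasDerivAt h (h1 q) q) {q0 : ℝ} {y : E3}
    (hy : 0 < ‖y‖ ^ 2 + q0) (i : Fin 3) :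
    HasFDerivAt (fun y : E3 => h (‖y‖ ^ 2 + q0)) (h1 (‖y‖ ^ 2 + q0) • (2 • innerSL ℝ y)) y ∧
    pd i (fun y : E3 => h (‖y‖ ^ 2 + q0)) y = h1 (‖y‖ ^ 2 + q0) * (2 * y i) := by
  have h2 := (hh _ hy).comp_hasFDerivAt y (hasFDerivAt_normsq q0 y)
  refine ⟨h2, ?_⟩
  unfold pd
  erw [h2.fderiv]
  simp [EuclideanSpace.inner_single_right]

lemma isOpen_pos (q0 : ℝ) : IsOpen {y : E3 | 0 < ‖y‖ ^ 2 + q0} :=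
  isOpen_lt continuous_const (by fun_prop)

lemma pd_congr {f g : E3 → ℝ} {x : E3} (h : f =ᶠ[𝓝 x] g) (i : Fin 3) : pd i f x = pd i g x := by
  unfold pd; rw [h.fderiv_eq]

lemma lap_congr {f g : E3 → ℝ} {x : E3} (h : f =ᶠ[𝓝 x] g) : lap3 f x = lap3 g x := by
  unfold lap3
  refine Finset.sum_congr rfl fun i _ => ?_
  exact pd_congr (h.eventually_nhds.mono fun y hy => pd_congr hy i) i

lemma lap_Ker (lam q0 : ℝ) {y : E3} (hy : 0 < ‖y‖ ^ 2 + q0) :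
    lap3 (Ker lam q0) y + lam ^ 2 * Ker lam q0 y = -4 * q0 * gf2 lam (‖y‖ ^ 2 + q0) := by
  have h1 : ∀ i, pd i (pd i (Ker lam q0)) y =
      4 * (y i) ^ 2 * gf2 lam (‖y‖ ^ 2 + q0) + 2 * gf1 lam (‖y‖ ^ 2 + q0) := fun i => by
    have : pd i (Ker lam q0) =ᶠ[𝓝 y] fun y => gf1 lam (‖y‖ ^ 2 + q0) * (2 * y i) := by
      filter_upwards [(isOpen_pos q0).mem_nhds hy] with z hz
      exact (pd_radial (fun q hq => hasDerivAt_gf lam hq) hz i).2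
    rw [pd_congr this]
    have h2 := (pd_radial (fun q hq => hasDerivAt_gf1 lam hq) hy i).1
    have h3 : HasFDerivAt (fun y : E3 => 2 * y i) ((2 : ℝ) • (EuclideanSpace.proj i : E3 →L[ℝ] ℝ)) y :=
      (EuclideanSpace.proj i : E3 →L[ℝ] ℝ).hasFDerivAt.const_mul 2
    have h4 := h2.mul h3
    unfold pd
    erw [h4.fderiv]
    simp [EuclideanSpace.inner_single_right]
    ring
  have h2 : ‖y‖ ^ 2 = ∑ i, (y i) ^ 2 := by simp [EuclideanSpace.norm_sq_eq]
  unfold lap3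
  simp only [h1]
  have h3 := gf_ode lam hy
  rw [Fin.sum_univ_three] at h2 ⊢
  unfold Ker
  have h4 : ∀ a b c : ℝ, a + b + c = 0 → a = - b - c := fun a b c h => by linarith
  linear_combination h3 - 4 * gf2 lam (‖y‖ ^ 2 + q0) * h2

lemma contDiffAt_Ker (lam q0 : ℝ) {y : E3} (hy : 0 < ‖y‖ ^ 2 + q0) {n : WithTop ℕ∞} :
    ContDiffAt ℝ n (Ker lam q0) y := by
  have h1 : ContDiffAt ℝ n (fun y : E3 => √(‖y‖ ^ 2 + q0)) y :=
    (Real.contDiffAt_sqrt hy.ne').comp y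
      ((contDiff_norm_sq ℝ).add contDiff_const).contDiffAt
  exact (Real.contDiff_cos.contDiffAt.comp y (contDiffAt_const.mul h1)).div h1
    (Real.sqrt_pos.2 hy).ne'

lemma analytic_Ker (lam : ℝ) : AnalyticOnNhd ℝ (Ker lam 0) {0}ᶜ := fun y hy => by
  have : 0 < ‖y‖ ^ 2 + 0 := by
    have : 0 < ‖y‖ := norm_pos_iff.2 hy
    positivity
  exact (contDiffAt_Ker lam 0 this (n := ω)).analyticAt

end HelmAux

namespace HelmAux
open scoped ENNReal NNReal ContDiff

lemma contDiff_pd {f : E3 → ℝ} (hf : ContDiff ℝ ∞ f) (i : Fin 3) : ContDiff ℝ ∞ (pd i f) := by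
  have := hf.fderiv_right (m := ∞) (by simp)
  exact this.clm_apply contDiff_const

lemma compact_pd {f : E3 → ℝ} (hf : HasCompactSupport f) (i : Fin 3) :
    HasCompactSupport (pd i f) := hf.fderiv_apply ℝ _

lemma ibp1 {f g : E3 → ℝ} (hf : ContDiff ℝ ∞ f) (hg : ContDiff ℝ ∞ g) (hgc : HasCompactSupport g)
    (i : Fin 3) : ∫ x, f x * pd i g x = - ∫ x, pd i f x * g x := by
  have hf' := (contDiff_pd hf i).continuous
  have hg' := (contDiff_pd hg i).continuous
  refine integral_mul_fderiv_eq_neg_fderiv_mul_of_integrable ?_ ?_ ?_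
    (fun x _ => hf.differentiable (by simp) x) (fun x _ => hg.differentiable (by simp) x)
  · exact (hf'.mul hg.continuous).integrable_of_hasCompactSupport hgc.mul_left
  · exact (hf.continuous.mul hg').integrable_of_hasCompactSupport (compact_pd hgc i).mul_left
  · exact (hf.continuous.mul hg.continuous).integrable_of_hasCompactSupport hgc.mul_left

lemma ibp2 {f g : E3 → ℝ} (hf : ContDiff ℝ ∞ f) (hg : ContDiff ℝ ∞ g) (hgc : HasCompactSupport g)
    (i : Fin 3) : ∫ x, f x * pd i (pd i g) x = ∫ x, pd i (pd i f) x * g x := by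
  rw [ibp1 hf (contDiff_pd hg i) (compact_pd hgc i) i, ibp1 (contDiff_pd hf i) hg hgc i, neg_neg]

lemma contDiff_lap {f : E3 → ℝ} (hf : ContDiff ℝ ∞ f) : ContDiff ℝ ∞ (lap3 f) := by
  unfold lap3
  exact ContDiff.sum fun i _ => contDiff_pd (contDiff_pd hf i) i

lemma compact_lap {f : E3 → ℝ} (hf : HasCompactSupport f) : HasCompactSupport (lap3 f) := by
  refine HasCompactSupport.intro' hf.isCompact (isClosed_tsupport f) fun x hx => ?_
  have : f =ᶠ[𝓝 x] fun _ => 0 := notMem_tsupport_iff_eventuallyEq.1 hx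
  rw [lap_congr this]
  have h : ∀ i, pd i (fun _ : E3 => (0 : ℝ)) = fun _ => 0 := fun i => by
    funext y; simp [pd]
  simp [lap3, h]

lemma green {f g : E3 → ℝ} (lam : ℝ) (hf : ContDiff ℝ ∞ f) (hg : ContDiff ℝ ∞ g)
    (hgc : HasCompactSupport g) :
    ∫ x, f x * (lap3 g x + lam ^ 2 * g x) = ∫ x, (lap3 f x + lam ^ 2 * f x) * g x := by
  have hi1 : ∀ i, Integrable (fun x => f x * pd i (pd i g) x) := fun i =>
    (hf.continuous.mul (contDiff_pd (contDiff_pd hg i) i).continuous).integrable_of_hasCompactSupport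
      (compact_pd (compact_pd hgc i) i).mul_left
  have hi2 : ∀ i, Integrable (fun x => pd i (pd i f) x * g x) := fun i =>
    ((contDiff_pd (contDiff_pd hf i) i).continuous.mul hg.continuous).integrable_of_hasCompactSupport
      hgc.mul_left
  have hi3 : Integrable (fun x => lam ^ 2 * (f x * g x)) :=
    ((hf.continuous.mul hg.continuous).integrable_of_hasCompactSupport hgc.mul_left).const_mul _
  have e1 : ∀ x, f x * (lap3 g x + lam ^ 2 * g x) =
      (∑ i, f x * pd i (pd i g) x) + lam ^ 2 * (f x * g x) := fun x => by
    unfold lap3; rw [← Finset.mul_sum]; ring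
  have e2 : ∀ x, (lap3 f x + lam ^ 2 * f x) * g x =
      (∑ i, pd i (pd i f) x * g x) + lam ^ 2 * (f x * g x) := fun x => by
    unfold lap3; rw [← Finset.sum_mul]; ring
  simp only [e1, e2]
  rw [integral_add (integrable_finsetSum _ fun i _ => hi1 i) hi3,
    integral_add (integrable_finsetSum _ fun i _ => hi2 i) hi3,
    integral_finsetSum _ fun i _ => hi1 i, integral_finsetSum _ fun i _ => hi2 i]
  congr 1
  exact Finset.sum_congr rfl fun i _ => ibp2 hf hg hgc i

/-- `sqrt (1+|z|^2)` -/
def jb (z : E3) : ℝ := √(‖z‖ ^ 2 + 1)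

lemma one_le_jb (z : E3) : 1 ≤ jb z := by
  unfold jb
  rw [Real.le_sqrt' one_pos]
  nlinarith [sq_nonneg ‖z‖]

lemma jb_le (z : E3) : jb z ≤ 1 + ‖z‖ := by
  unfold jb
  rw [Real.sqrt_le_left (by positivity)]
  nlinarith [norm_nonneg z]

lemma continuous_jb : Continuous jb := by unfold jb; fun_prop

lemma integrable_jb : Integrable (fun z : E3 => 1 / jb z ^ 5) := by
  have h := integrable_rpow_neg_one_add_norm_sq (E := E3) (μ := volume) (r := 5)
    (by simp; norm_num)
  refine h.congr (Eventually.of_forall fun z => ?_)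
  have hp : 0 < ‖z‖ ^ 2 + 1 := by positivity
  simp only [jb]
  rw [add_comm]
  generalize ‖z‖ ^ 2 + 1 = a at hp
  rw [Real.sqrt_eq_rpow, ← Real.rpow_natCast, ← Real.rpow_mul hp.le, one_div, ← Real.rpow_neg hp.le]
  norm_num

def cst : ℝ := -3 * ∫ z : E3, 1 / jb z ^ 5

lemma cst_ne : cst ≠ 0 := by
  have hpos : ∀ z, 0 < 1 / jb z ^ 5 := fun z => by
    have := one_le_jb z
    positivity
  have : 0 < ∫ z : E3, 1 / jb z ^ 5 := by
    rw [integral_pos_iff_support_of_nonneg (fun z => (hpos z).le) integrable_jb]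
    have : Function.support (fun z : E3 => 1 / jb z ^ 5) = Set.univ := by
      ext z; simpa using (hpos z).ne'
    rw [this]
    simp
  unfold cst
  intro h
  linarith

lemma scaled (lam : ℝ) (u : E3 → ℝ) {ε : ℝ} (hε : 0 < ε) :
    ∫ y, (-4 * ε ^ 2 * gf2 lam (‖y‖ ^ 2 + ε ^ 2)) * u y =
    ∫ z, (-3 * Real.cos (lam * (ε * jb z)) / jb z ^ 5
      + lam ^ 2 * ε ^ 2 * Real.cos (lam * (ε * jb z)) / jb z ^ 3
      - 3 * lam * ε * Real.sin (lam * (ε * jb z)) / jb z ^ 4) * u (ε • z) := by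
  have h := Measure.integral_comp_smul_of_nonneg (μ := (volume : Measure E3))
    (fun y => (-4 * ε ^ 2 * gf2 lam (‖y‖ ^ 2 + ε ^ 2)) * u y) ε (hR := hε.le)
  simp only [finrank_euclideanSpace, Fintype.card_fin, smul_eq_mul] at h
  have h' : ∫ y, (-4 * ε ^ 2 * gf2 lam (‖y‖ ^ 2 + ε ^ 2)) * u y = 
      ε ^ 3 * ∫ z : E3, (-4 * ε ^ 2 * gf2 lam (‖ε • z‖ ^ 2 + ε ^ 2)) * u (ε • z) := by
    rw [h]; field_simp
  rw [h', ← integral_const_mul]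
  congr 1
  funext z
  have hj := one_le_jb z
  have hj0 : 0 < jb z := by linarith
  have : √(‖ε • z‖ ^ 2 + ε ^ 2) = ε * jb z := by
    unfold jb
    rw [norm_smul, Real.norm_of_nonneg hε.le,
      show (ε * ‖z‖) ^ 2 + ε ^ 2 = ε ^ 2 * (‖z‖ ^ 2 + 1) by ring, Real.sqrt_mul (by positivity),
      Real.sqrt_sq hε.le]
  unfold gf2
  rw [this]
  field_simp
  ring

lemma lim_rhs (lam : ℝ) {u : E3 → ℝ} (hu : Continuous u) (huc : HasCompactSupport u) :
    Tendsto (fun ε : ℝ => ∫ y, (-4 * ε ^ 2 * gf2 lam (‖y‖ ^ 2 + ε ^ 2)) * u y) (𝓝[>] 0)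
      (𝓝 (cst * u 0)) := by
  obtain ⟨M, hM⟩ := huc.exists_bound_of_continuous hu
  have hM0 : 0 ≤ M := (norm_nonneg _).trans (hM 0)
  obtain ⟨ρ, hρ⟩ := huc.isCompact.isBounded.exists_norm_le
  set A : ℝ := 1 + max ρ 0
  have hA : 0 ≤ A := by positivity
  have hfin : cst * u 0 = ∫ z : E3, -3 / jb z ^ 5 * u 0 := by
    unfold cst
    rw [integral_mul_const]
    congr 1
    rw [← integral_const_mul]
    congr 1; funext z; ring
  rw [hfin]
  have hev : ∀ᶠ ε : ℝ in 𝓝[>] 0, 0 < ε ∧ ε ≤ 1 := by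
    filter_upwards [Ioc_mem_nhdsGT (zero_lt_one' ℝ)] with ε h using h
  refine Tendsto.congr' (hev.mono fun ε hε => (scaled lam u hε.1).symm) ?_
  refine tendsto_integral_filter_of_dominated_convergence
    (fun z => (3 + lam ^ 2 * A ^ 2 + 3 * |lam| * A) * M * (1 / jb z ^ 5)) ?_ ?_ ?_ ?_
  · refine Eventually.of_forall fun ε => Continuous.aestronglyMeasurable ?_
    have hj := continuous_jb
    have hne : ∀ z, jb z ≠ 0 := fun z => by have := one_le_jb z; positivity
    refine Continuous.mul (((?_ : Continuous _).add ?_).sub ?_) (by fun_prop)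
    all_goals
      refine Continuous.div (by fun_prop) (by fun_prop) fun z => pow_ne_zero _ (hne z)
  · refine hev.mono fun ε hε => Eventually.of_forall fun z => ?_
    have hj := one_le_jb z
    have hj0 : 0 < jb z := by linarith
    by_cases hz : u (ε • z) = 0
    · rw [hz]; simp only [mul_zero, norm_zero]; positivity
    have h1 : ε * ‖z‖ ≤ ρ := by
      have := hρ (ε • z) (subset_tsupport u hz)
      rwa [norm_smul, Real.norm_of_nonneg hε.1.le] at this
    have h2 : ε * jb z ≤ A := by
      have := jb_le z
      have h3 : ε * jb z ≤ ε * (1 + ‖z‖) := by gcongr; exact hε.1.le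
      have h4 : ρ ≤ max ρ 0 := le_max_left _ _
      simp only [A]
      nlinarith [hε.2]
    have h0 : 0 ≤ ε * jb z := by have := hε.1; positivity
    have e : (-3 * Real.cos (lam * (ε * jb z)) / jb z ^ 5
      + lam ^ 2 * ε ^ 2 * Real.cos (lam * (ε * jb z)) / jb z ^ 3
      - 3 * lam * ε * Real.sin (lam * (ε * jb z)) / jb z ^ 4) =
      (-3 * Real.cos (lam * (ε * jb z)) + lam ^ 2 * (ε * jb z) ^ 2 * Real.cos (lam * (ε * jb z))
        - 3 * lam * (ε * jb z) * Real.sin (lam * (ε * jb z))) * (1 / jb z ^ 5) := by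
      field_simp
    rw [e, norm_mul, norm_mul, Real.norm_of_nonneg (by positivity : 0 ≤ 1 / jb z ^ 5),
      mul_right_comm]
    refine mul_le_mul_of_nonneg_right ?_ (by positivity)
    refine mul_le_mul ?_ (hM _) (norm_nonneg _) (by positivity)
    have hc := Real.abs_cos_le_one (lam * (ε * jb z))
    have hs := Real.abs_sin_le_one (lam * (ε * jb z))
    rw [Real.norm_eq_abs]
    refine (abs_sub _ _).trans (add_le_add ((abs_add_le _ _).trans (add_le_add ?_ ?_)) ?_)
    · rw [abs_mul]; norm_num; linarith
    · rw [abs_mul, abs_of_nonneg (by positivity : 0 ≤ lam ^ 2 * (ε * jb z) ^ 2), ← mul_one (lam ^ 2 * A ^ 2)]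
      gcongr
    · rw [abs_mul, ← mul_one (3 * |lam| * A), abs_mul, abs_mul, abs_of_nonneg h0]
      rw [abs_of_pos (by norm_num : (0:ℝ) < 3)]
      gcongr
  · exact integrable_jb.const_mul _
  · refine Eventually.of_forall fun z => ?_
    have hj := one_le_jb z
    have hj0 : jb z ≠ 0 := by positivity
    have hc : Continuous (fun ε : ℝ => (-3 * Real.cos (lam * (ε * jb z)) / jb z ^ 5
      + lam ^ 2 * ε ^ 2 * Real.cos (lam * (ε * jb z)) / jb z ^ 3
      - 3 * lam * ε * Real.sin (lam * (ε * jb z)) / jb z ^ 4) * u (ε • z)) := by fun_prop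
    have := (hc.tendsto 0).mono_left (nhdsWithin_le_nhds (s := Set.Ioi 0))
    simpa using this

lemma repr_zero (lam : ℝ) {u : E3 → ℝ} (hu : ContDiff ℝ ∞ u) (huc : HasCompactSupport u)
    (h0 : ∀ᶠ y in 𝓝 (0 : E3), lap3 u y + lam ^ 2 * u y = 0) :
    ∫ y, Ker lam 0 y * (lap3 u y + lam ^ 2 * u y) = cst * u 0 := by
  have hfc : Continuous (fun y => lap3 u y + lam ^ 2 * u y) :=
    (contDiff_lap hu).continuous.add (continuous_const.mul hu.continuous)
  have hfs : HasCompactSupport (fun y => lap3 u y + lam ^ 2 * u y) :=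
    (compact_lap huc).add huc.mul_left
  obtain ⟨d, hd, hd'⟩ := Metric.eventually_nhds_iff.1 h0
  have hev : ∀ᶠ ε : ℝ in 𝓝[>] 0, 0 < ε := eventually_mem_nhdsWithin
  have hsm : ∀ ε : ℝ, 0 < ε → ContDiff ℝ ∞ (Ker lam (ε ^ 2)) := fun ε hε =>
    contDiff_iff_contDiffAt.2 fun y => contDiffAt_Ker lam _ (by positivity)
  have h1 : Tendsto (fun ε : ℝ => ∫ y, Ker lam (ε ^ 2) y * (lap3 u y + lam ^ 2 * u y)) (𝓝[>] 0)
      (𝓝 (cst * u 0)) := by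
    refine (lim_rhs lam hu.continuous huc).congr' (hev.mono fun ε hε => ?_)
    beta_reduce
    rw [green lam (hsm ε hε) hu huc]
    congr 1; funext y
    rw [lap_Ker lam _ (by positivity)]
  refine tendsto_nhds_unique ?_ h1
  refine tendsto_integral_filter_of_dominated_convergence
    (fun y => d⁻¹ * ‖lap3 u y + lam ^ 2 * u y‖) ?_ ?_ ?_ ?_
  · refine hev.mono fun ε hε => ?_
    exact ((hsm ε hε).continuous.mul hfc).aestronglyMeasurable
  · refine hev.mono fun ε hε => Eventually.of_forall fun y => ?_
    rw [norm_mul]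
    by_cases hy : dist y 0 < d
    · rw [hd' hy]; simp
    · gcongr
      rw [dist_zero_right, not_lt] at hy
      have h2 : d ≤ √(‖y‖ ^ 2 + ε ^ 2) := by
        rw [Real.le_sqrt' hd]; nlinarith [sq_nonneg ε]
      unfold Ker gf
      rw [norm_div, Real.norm_of_nonneg (Real.sqrt_nonneg _), inv_eq_one_div]
      exact div_le_div₀ zero_le_one (Real.abs_cos_le_one _) hd h2
  · exact (hfc.norm.integrable_of_hasCompactSupport hfs.norm).const_mul _
  · refine Eventually.of_forall fun y => ?_
    by_cases hy : y = 0
    · rw [hy, hd' (by simpa using hd)]; simp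
    refine Tendsto.mul ?_ tendsto_const_nhds
    have hy' : 0 < ‖y‖ ^ 2 + 0 := by have := norm_pos_iff.2 hy; positivity
    have h3 : Tendsto (fun ε : ℝ => ‖y‖ ^ 2 + ε ^ 2) (𝓝[>] 0) (𝓝 (‖y‖ ^ 2 + 0)) := by
      have : Continuous (fun ε : ℝ => ‖y‖ ^ 2 + ε ^ 2) := by fun_prop
      have := (this.tendsto 0).mono_left (nhdsWithin_le_nhds (s := Set.Ioi 0))
      simpa using this
    exact (hasDerivAt_gf lam hy').continuousAt.tendsto.comp h3

lemma pd_translate (u : E3 → ℝ) (x : E3) (i : Fin 3) (y : E3) :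
    pd i (fun y => u (x + y)) y = pd i u (x + y) := by
  unfold pd; rw [fderiv_comp_add_left]

lemma lap_translate (u : E3 → ℝ) (x : E3) (y : E3) :
    lap3 (fun y => u (x + y)) y = lap3 u (x + y) := by
  unfold lap3
  refine Finset.sum_congr rfl fun i _ => ?_
  rw [funext (pd_translate u x i), pd_translate (pd i u) x i]

lemma repr (lam : ℝ) {u : E3 → ℝ} (hu : ContDiff ℝ ∞ u) (huc : HasCompactSupport u) {x : E3}
    (h0 : ∀ᶠ y in 𝓝 x, lap3 u y + lam ^ 2 * u y = 0) :
    ∫ y, (lap3 u y + lam ^ 2 * u y) * Ker lam 0 (x - y) = cst * u x := by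
  have h1 := repr_zero lam (u := fun y => u (x + y)) (hu.comp (contDiff_const.add contDiff_id))
    (huc.comp_homeomorph (Homeomorph.addLeft x)) (by
      have : Tendsto (fun y : E3 => x + y) (𝓝 0) (𝓝 x) := by
        have : Continuous (fun y : E3 => x + y) := by fun_prop
        simpa using this.tendsto 0
      filter_upwards [this.eventually h0] with y hy
      rw [lap_translate]; exact hy)
  simp only [lap_translate, add_zero] at h1
  rw [← h1, ← integral_add_left_eq_self _ x]
  congr 1; funext y
  rw [mul_comm]
  congr 1
  simp [Ker]

end HelmAux

namespace HelmAux
open scoped ENNReal NNReal ContDiff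

lemma cont_smul {X : Type*} [NormedAddCommGroup X] [NormedSpace ℝ X] {f : E3 → ℝ} {Φ : E3 → X}
    (hf : Continuous f) (hΦ : ∀ y ∈ tsupport f, ContinuousAt Φ y) :
    Continuous (fun y => f y • Φ y) := by
  refine continuous_of_tsupport fun y hy => ?_
  exact hf.continuousAt.smul (hΦ y (tsupport_smul_subset_left f Φ hy))

lemma hasFDerivAt_under {F : Type*} [NormedAddCommGroup F] [NormedSpace ℝ F] [CompleteSpace F]
    {f : E3 → ℝ} (hf : Continuous f) (hfc : HasCompactSupport f) {H : E3 → F}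
    (hH : AnalyticOnNhd ℝ H {0}ᶜ) {x : E3} (hx : x ∉ tsupport f) :
    HasFDerivAt (fun x => ∫ y, f y • H (x - y)) (∫ y, f y • fderiv ℝ H (x - y)) x := by
  obtain ⟨d, hd, hd'⟩ := Metric.nhds_basis_closedBall.mem_iff.1
    ((isClosed_tsupport f).isOpen_compl.mem_nhds hx)
  have hne : ∀ x' ∈ Metric.closedBall x d, ∀ y ∈ tsupport f, x' - y ∈ ({0}ᶜ : Set E3) := by
    intro x' hx' y hy h
    rw [sub_eq_zero.1 h] at hx'
    exact hd' hx' hy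
  have hc : ∀ x' ∈ Metric.closedBall x d, Continuous (fun y => f y • H (x' - y)) := fun x' hx' =>
    cont_smul hf fun y hy => (hH _ (hne x' hx' y hy)).continuousAt.comp (by fun_prop)
  have hc' : ∀ x' ∈ Metric.closedBall x d, Continuous (fun y => f y • fderiv ℝ H (x' - y)) :=
    fun x' hx' =>
    cont_smul hf fun y hy => (hH.fderiv _ (hne x' hx' y hy)).continuousAt.comp (by fun_prop)
  have hK : IsCompact ((fun p : E3 × E3 => p.1 - p.2) '' (Metric.closedBall x d ×ˢ tsupport f)) :=
    ((isCompact_closedBall x d).prod hfc.isCompact).image (by fun_prop)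
  obtain ⟨B, hB⟩ := hK.exists_bound_of_continuousOn (f := fderiv ℝ H) (by
    rintro _ ⟨⟨a, b⟩, ⟨ha, hb⟩, rfl⟩
    exact (hH.fderiv _ (hne a ha b hb)).continuousAt.continuousWithinAt)
  have hxm : x ∈ Metric.closedBall x d := Metric.mem_closedBall_self hd.le
  refine hasFDerivAt_integral_of_dominated_of_fderiv_le
    (F := fun x y => f y • H (x - y)) (F' := fun x y => f y • fderiv ℝ H (x - y))
    (bound := fun y => ‖f y‖ * B)
    (Metric.closedBall_mem_nhds x hd) ?_ ?_ ?_ ?_ ?_ ?_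
  · filter_upwards [Metric.closedBall_mem_nhds x hd] with x' hx'
    exact (hc x' hx').aestronglyMeasurable
  · exact (hc x hxm).integrable_of_hasCompactSupport hfc.smul_right
  · exact (hc' x hxm).aestronglyMeasurable
  · refine Eventually.of_forall fun y x' hx' => ?_
    rw [norm_smul]
    by_cases hy : y ∈ tsupport f
    · gcongr
      exact hB _ ⟨(x', y), ⟨hx', hy⟩, rfl⟩
    · rw [image_eq_zero_of_notMem_tsupport hy]; simp
  · exact (hf.norm.integrable_of_hasCompactSupport hfc.norm).mul_const _
  · refine Eventually.of_forall fun y x' hx' => ?_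
    by_cases hy : y ∈ tsupport f
    · have h1 := (hH _ (hne x' hx' y hy)).differentiableAt.hasFDerivAt
      have h2 : HasFDerivAt (fun x : E3 => H (x - y)) (fderiv ℝ H (x' - y)) x' := by
        have h3 : HasFDerivAt (fun x : E3 => x - y) (ContinuousLinearMap.id ℝ E3) x' :=
          (hasFDerivAt_id x').sub_const y
        have := HasFDerivAt.comp (g := H) x' h1 h3
        rwa [ContinuousLinearMap.comp_id] at this
      exact h2.const_smul (f y)
    · simp only [image_eq_zero_of_notMem_tsupport hy, zero_smul]
      exact hasFDerivAt_const 0 x'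

lemma lie_integral {A B : Type*} [NormedAddCommGroup A] [NormedSpace ℝ A] [NormedAddCommGroup B]
    [NormedSpace ℝ B] (L : A ≃ₗᵢ[ℝ] B) (f : E3 → ℝ) (φ : E3 → A) :
    L (∫ y, f y • φ y) = ∫ y, f y • L (φ y) := by
  have := L.toContinuousLinearEquiv.integral_comp_comm (μ := (volume : Measure E3)) (fun y => f y • φ y)
  simp only [map_smul] at this
  exact this.symm

lemma iteratedFDeriv_under 
    {f : E3 → ℝ} (hf : Continuous f) (hfc : HasCompactSupport f) {H : E3 → ℝ}
    (hH : AnalyticOnNhd ℝ H {0}ᶜ) (j : ℕ) : ∀ {x : E3} (hx : x ∉ tsupport f),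
    iteratedFDeriv ℝ j (fun x => ∫ y, f y • H (x - y)) x =
      ∫ y, f y • iteratedFDeriv ℝ j H (x - y) := by
  induction j with
  | zero =>
    intro x hx
    simp only [iteratedFDeriv_zero_eq_comp, Function.comp_apply]
    exact lie_integral (continuousMultilinearCurryFin0 ℝ E3 ℝ).symm f (fun y => H (x - y))
  | succ j ih =>
    intro x hx
    simp only [iteratedFDeriv_succ_eq_comp_left, Function.comp_apply]
    have h1 : iteratedFDeriv ℝ j (fun x => ∫ y, f y • H (x - y)) =ᶠ[𝓝 x]
        fun x => ∫ y, f y • iteratedFDeriv ℝ j H (x - y) := by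
      filter_upwards [(isClosed_tsupport f).isOpen_compl.mem_nhds hx] with z hz
      exact ih hz
    rw [h1.fderiv_eq, (hasFDerivAt_under hf hfc (hH.iteratedFDeriv j) hx).fderiv]
    exact lie_integral (continuousMultilinearCurryLeftEquiv ℝ (fun _ : Fin (j + 1) => E3) ℝ).symm f
      (fun y => fderiv ℝ (iteratedFDeriv ℝ j H) (x - y))

lemma pd_contDiffAt {f : E3 → ℝ} {x : E3} (hf : ContDiffAt ℝ ∞ f x) (i : Fin 3) :
    ContDiffAt ℝ ∞ (pd i f) x :=
  (hf.fderiv_right (m := ∞) (by simp)).clm_apply contDiffAt_const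

lemma pd_add {f g : E3 → ℝ} {x : E3} (hf : DifferentiableAt ℝ f x) (hg : DifferentiableAt ℝ g x)
    (i : Fin 3) : pd i (fun z => f z + g z) x = pd i f x + pd i g x := by
  unfold pd
  rw [fderiv_fun_add hf hg]; rfl

lemma pd_smul {f : E3 → ℝ} {x : E3} (c : ℝ) (hf : DifferentiableAt ℝ f x)
    (i : Fin 3) : pd i (fun z => c * f z) x = c * pd i f x := by
  unfold pd
  rw [fderiv_const_mul hf]; rfl

lemma ev_diff {f : E3 → ℝ} {x : E3} (hf : ContDiffAt ℝ ∞ f x) :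
    ∀ᶠ z in 𝓝 x, DifferentiableAt ℝ f z := by
  have := (hf.of_le (m := 1) (by exact_mod_cast le_top)).eventually (by simp)
  exact this.mono fun z hz => hz.differentiableAt (by simp)

lemma lap_add {f g : E3 → ℝ} {x : E3} (hf : ContDiffAt ℝ ∞ f x) (hg : ContDiffAt ℝ ∞ g x) :
    lap3 (fun z => f z + g z) x = lap3 f x + lap3 g x := by
  unfold lap3
  rw [← Finset.sum_add_distrib]
  refine Finset.sum_congr rfl fun i _ => ?_
  have : pd i (fun z => f z + g z) =ᶠ[𝓝 x] fun z => pd i f z + pd i g z := by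
    filter_upwards [ev_diff hf, ev_diff hg] with z h1 h2 using pd_add h1 h2 i
  rw [pd_congr this, pd_add ((pd_contDiffAt hf i).differentiableAt (by simp))
    ((pd_contDiffAt hg i).differentiableAt (by simp))]

lemma lap_smul {f : E3 → ℝ} {x : E3} (c : ℝ) (hf : ContDiffAt ℝ ∞ f x) :
    lap3 (fun z => c * f z) x = c * lap3 f x := by
  unfold lap3
  rw [Finset.mul_sum]
  refine Finset.sum_congr rfl fun i _ => ?_
  have : pd i (fun z => c * f z) =ᶠ[𝓝 x] fun z => c * pd i f z := by
    filter_upwards [ev_diff hf] with z h1 using pd_smul c h1 i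
  rw [pd_congr this, pd_smul c ((pd_contDiffAt hf i).differentiableAt (by simp))]

/-- Space of jets. -/
abbrev JF (k : ℕ) := (j : Fin (k + 1)) → ContinuousMultilinearMap ℝ (fun _ : Fin j => E3) ℝ

def jet (k : ℕ) (w : E3 → ℝ) (x : E3) : JF k := fun j => iteratedFDeriv ℝ j w x

lemma analytic_jet (lam : ℝ) (k : ℕ) : AnalyticOnNhd ℝ (jet k (Ker lam 0)) {0}ᶜ := fun x hx =>
  AnalyticAt.pi fun j => (analytic_Ker lam).iteratedFDeriv j x hx

/-- Good solutions on `ball 0 ρ`. -/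
def Sol (lam ρ : ℝ) (w : E3 → ℝ) : Prop :=
  ∀ x ∈ Metric.ball (0 : E3) ρ, ContDiffAt ℝ ∞ w x ∧ lap3 w x = -(lam ^ 2) * w x

lemma Sol.add {lam ρ : ℝ} {w w' : E3 → ℝ} (h : Sol lam ρ w) (h' : Sol lam ρ w') :
    Sol lam ρ (fun z => w z + w' z) := fun x hx =>
  ⟨(h x hx).1.add (h' x hx).1, by
    rw [lap_add (h x hx).1 (h' x hx).1, (h x hx).2, (h' x hx).2]; ring⟩

lemma Sol.smul {lam ρ : ℝ} {w : E3 → ℝ} (h : Sol lam ρ w) (c : ℝ) :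
    Sol lam ρ (fun z => c * w z) := fun x hx =>
  ⟨contDiffAt_const.mul (h x hx).1, by
    rw [lap_smul c (h x hx).1, (h x hx).2]; ring⟩

lemma Sol.Ker {lam ρ : ℝ} {y : E3} (hy : ρ < ‖y‖) : Sol lam ρ (fun z => Ker lam 0 (z - y)) := by
  intro x hx
  have hxy : x - y ≠ 0 := by
    intro h
    rw [sub_eq_zero.1 h, mem_ball_zero_iff] at hx
    linarith
  have hp : 0 < ‖x - y‖ ^ 2 + 0 := by have := norm_pos_iff.2 hxy; positivity
  refine ⟨ContDiffAt.comp (g := HelmAux.Ker lam 0) (f := fun z => z - y) x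
    (contDiffAt_Ker lam 0 hp) (contDiffAt_id.sub contDiffAt_const), ?_⟩
  have h1 := lap_translate (HelmAux.Ker lam 0) (-y) x
  have h2 := lap_Ker lam 0 (y := -y + x) (by rwa [show -y + x = x - y by abel])
  rw [show (fun z => HelmAux.Ker lam 0 (z - y)) = fun z => HelmAux.Ker lam 0 (-y + z) by
    funext z; congr 1; abel, h1]
  linear_combination h2

lemma span_jets {lam ρ : ℝ} {S : Set E3} (hS : IsCompact S) (hSρ : S ⊆ Metric.ball 0 ρ) (k : ℕ)
    {m : lp (fun _ : S => JF k) ∞}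
    (hm : m ∈ Submodule.span ℝ ((fun y => toBdd (fun x : S => jet k (Ker lam 0) (x - y))) '' {y | ρ < ‖y‖})) :
    ∃ w, Sol lam ρ w ∧ ∀ x : S, m x = jet k w x := by
  have hcd : ∀ {w : E3 → ℝ} (h : Sol lam ρ w) (x : S) (j : ℕ), ContDiffAt ℝ j w x := fun h x j =>
    (h x (hSρ x.2)).1.of_le (by exact_mod_cast le_top)
  induction hm using Submodule.span_induction with
  | mem m hm =>
    obtain ⟨y, hy, rfl⟩ := hm
    have hyS : y ∉ S := fun h => by
      have := hSρ h
      rw [mem_ball_zero_iff] at this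
      exact lt_asymm this hy
    refine ⟨_, Sol.Ker hy, fun x => ?_⟩
    beta_reduce
    rw [toBdd_apply (analytic_translates (analytic_jet lam k) hS hyS).2]
    funext j
    simp only [jet]
    rw [iteratedFDeriv_comp_sub]
  | zero =>
    refine ⟨fun z => 0 * Ker lam 0 (z - EuclideanSpace.single 0 (|ρ| + 1)), 
      (Sol.Ker (by simp only [PiLp.norm_single, Real.norm_eq_abs]; rw [abs_of_pos (by positivity)]; linarith [le_abs_self ρ])).smul 0, fun x => ?_⟩
    funext j
    simp only [zero_mul, jet]
    rw [iteratedFDeriv_fun_zero]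
    rfl
  | add a b _ _ ha hb =>
    obtain ⟨w, hw, hw'⟩ := ha
    obtain ⟨u, hu, hu'⟩ := hb
    refine ⟨_, hw.add hu, fun x => ?_⟩
    funext j
    rw [lp.coeFn_add, Pi.add_apply, hw', hu']
    simp only [jet, Pi.add_apply]
    exact (iteratedFDeriv_add_apply (hcd hw x j) (hcd hu x j)).symm
  | smul c a _ ha =>
    obtain ⟨w, hw, hw'⟩ := ha
    refine ⟨_, hw.smul c, fun x => ?_⟩
    funext j
    rw [lp.coeFn_smul, Pi.smul_apply, hw']
    simp only [jet, Pi.smul_apply]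
    exact (iteratedFDeriv_const_smul_apply (hcd hw x j)).symm

end HelmAux

namespace HelmAux
open scoped ENNReal NNReal ContDiff Manifold

lemma mem_of_analytic {X : Type*} [NormedAddCommGroup X] [NormedSpace ℝ X] {Φ : E3 → X}
    {U : Set E3} (hΦ : AnalyticOnNhd ℝ Φ U) (hU : IsPreconnected U) (M : Submodule ℝ X)
    (hM : IsClosed (M : Set X)) {z : E3} (hz : z ∈ U) (h : ∀ᶠ y in 𝓝 z, Φ y ∈ M) :
    ∀ y ∈ U, Φ y ∈ M := by
  have : IsClosed (M : Set X) := hM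
  have h1 : AnalyticOnNhd ℝ (fun y => M.mkQL (Φ y)) U := fun y hy =>
    (M.mkQL.analyticAt _).comp (hΦ y hy)
  have h2 := h1.eqOn_zero_of_preconnected_of_eventuallyEq_zero hU hz
    (h.mono fun y hy => by simpa using hy)
  intro y hy
  simpa using h2 hy

lemma integral_mem {X : Type*} [NormedAddCommGroup X] [NormedSpace ℝ X] [CompleteSpace X]
    {Ψ : E3 → X} (hΨ : Integrable Ψ) (M : Submodule ℝ X) (hM : IsClosed (M : Set X))
    (h : ∀ y, Ψ y ∈ M) : ∫ y, Ψ y ∈ M := by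
  have : IsClosed (M : Set X) := hM
  have h1 := M.mkQL.integral_comp_comm hΨ
  have h2 : ∀ y, M.mkQL (Ψ y) = 0 := fun y => by simpa using h y
  simp only [h2, integral_zero] at h1
  simpa using h1.symm

lemma exists_cutoff {S Ω : Set E3} (hS : IsCompact S) (hΩ : IsOpen Ω) (hSΩ : S ⊆ Ω) {v : E3 → ℝ}
    (hv : ContDiffOn ℝ ∞ v Ω) : ∃ u : E3 → ℝ, ContDiff ℝ ∞ u ∧ HasCompactSupport u ∧
      ∀ x ∈ S, u =ᶠ[𝓝 x] v := by
  obtain ⟨K, hK, hSK, hKΩ⟩ := exists_compact_between hS hΩ hSΩ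
  obtain ⟨χ, h1, h0, -⟩ := exists_contMDiffMap_one_nhds_of_subset_interior (n := ⊤) 𝓘(ℝ, E3)
    hS.isClosed hSK
  have hχ : ContDiff ℝ ∞ χ := χ.contMDiff.contDiff
  refine ⟨fun z => χ z * v z, contDiff_iff_contDiffAt.2 fun x => ?_, ?_, fun x hx => ?_⟩
  · by_cases hx : x ∈ K
    · exact hχ.contDiffAt.mul (hv.contDiffAt (hΩ.mem_nhds (hKΩ hx)))
    · have : (fun z => χ z * v z) =ᶠ[𝓝 x] fun _ => 0 := by
        filter_upwards [hK.isClosed.isOpen_compl.mem_nhds hx] with z hz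
        rw [h0 z hz, zero_mul]
      exact contDiffAt_const.congr_of_eventuallyEq this
  · exact HasCompactSupport.intro hK fun x hx => by rw [h0 x hx, zero_mul]
  · filter_upwards [eventually_nhdsSet_iff_forall.1 h1 x hx] with z hz
    rw [hz, one_mul]

lemma scalar_approx {R : ℝ} (hR : 0 < R) {S : Set E3} (hS : IsCompact S)
    (hScompl : IsConnected Sᶜ) (hSR : S ⊆ Metric.ball (0 : E3) R) (lam : ℝ)
    {v : E3 → ℝ} {Ω : Set E3} (hΩ : IsOpen Ω) (hSΩ : S ⊆ Ω) (hv : ContDiffOn ℝ ∞ v Ω)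
    (hEq : ∀ x ∈ Ω, lap3 v x = -(lam ^ 2) * v x) {δ : ℝ} (hδ : 0 < δ) (k : ℕ) :
    ∃ w, Sol lam (R + 1) w ∧
      ∀ j ≤ k, ∀ x ∈ S, ‖iteratedFDeriv ℝ j v x - iteratedFDeriv ℝ j w x‖ < δ := by
  obtain ⟨u, hu, huc, huv⟩ := exists_cutoff hS hΩ hSΩ hv
  set f : E3 → ℝ := fun y => lap3 u y + lam ^ 2 * u y with hf
  have hfc : Continuous f :=
    (contDiff_lap hu).continuous.add (continuous_const.mul hu.continuous)
  have hfs : HasCompactSupport f := (compact_lap huc).add huc.mul_left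
  have hfS : ∀ x ∈ S, x ∉ tsupport f := fun x hx => by
    rw [notMem_tsupport_iff_eventuallyEq]
    filter_upwards [(huv x hx).eventually_nhds, hΩ.mem_nhds (hSΩ hx)] with z hz hzΩ
    simp only [hf, Pi.zero_apply]
    rw [lap_congr hz, hEq z hzΩ, hz.self_of_nhds]
    ring
  set Φ : E3 → lp (fun _ : S => JF k) ∞ :=
    fun y => toBdd (fun x : S => jet k (Ker lam 0) (x - y)) with hΦ
  have hΦan : AnalyticOnNhd ℝ Φ Sᶜ := fun y hy =>
    (analytic_translates (analytic_jet lam k) hS hy).1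
  have hΦx : ∀ y ∉ S, ∀ x : S, Φ y x = jet k (Ker lam 0) (x - y) := fun y hy x =>
    toBdd_apply (analytic_translates (analytic_jet lam k) hS hy).2 x
  set M := Submodule.span ℝ (Φ '' {y | R + 1 < ‖y‖}) with hM
  have hSR' : S ⊆ Metric.ball (0 : E3) (R + 1) :=
    hSR.trans (Metric.ball_subset_ball (by linarith))
  have hcl : IsClosed (M.topologicalClosure : Set (lp (fun _ : S => JF k) ∞)) :=
    M.isClosed_topologicalClosure
  have hopen : IsOpen {y : E3 | R + 1 < ‖y‖} := isOpen_lt continuous_const continuous_norm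
  have hz : EuclideanSpace.single (0 : Fin 3) (R + 2) ∈ {y : E3 | R + 1 < ‖y‖} := by
    simp only [Set.mem_setOf_eq, PiLp.norm_single, Real.norm_eq_abs]
    rw [abs_of_pos (by positivity)]; linarith
  have hΦM : ∀ y ∈ Sᶜ, Φ y ∈ M.topologicalClosure := by
    refine mem_of_analytic hΦan hScompl.isPreconnected _ hcl (z := EuclideanSpace.single 0 (R + 2))
      ?_ ?_
    · intro h
      have := hSR' h
      rw [mem_ball_zero_iff] at this
      exact lt_asymm this hz
    · filter_upwards [hopen.mem_nhds hz] with y hy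
      exact M.le_topologicalClosure (Submodule.subset_span ⟨y, hy, rfl⟩)
  have hfint : Integrable (fun y => f y • Φ y) := by
    refine (cont_smul hfc fun y hy => ?_).integrable_of_hasCompactSupport hfs.smul_right
    exact (hΦan y fun h => hfS y h hy).continuousAt
  have hI : ∫ y, f y • Φ y ∈ M.topologicalClosure := by
    refine integral_mem hfint _ hcl fun y => ?_
    by_cases hy : y ∈ S
    · rw [image_eq_zero_of_notMem_tsupport (hfS y hy), zero_smul]; exact zero_mem _
    · exact Submodule.smul_mem _ _ (hΦM y hy)
  have hIx : ∀ x : S, ∀ j : Fin (k + 1),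
      (∫ y, f y • Φ y : lp (fun _ : S => JF k) ∞) x j = cst • iteratedFDeriv ℝ j v x := by
    intro x j
    let L : lp (fun _ : S => JF k) ∞ →L[ℝ] ContinuousMultilinearMap ℝ (fun _ : Fin j => E3) ℝ :=
      (ContinuousLinearMap.proj (R := ℝ) (φ := fun j : Fin (k + 1) =>
        ContinuousMultilinearMap ℝ (fun _ : Fin j => E3) ℝ) j).comp
        (lp.evalCLM ℝ (fun _ : S => JF k) ∞ x)
    have h1 : L (∫ y, f y • Φ y) = ∫ y, L (f y • Φ y) := (L.integral_comp_comm hfint).symm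
    have h2 : ∀ y, L (f y • Φ y) = f y • iteratedFDeriv ℝ j (Ker lam 0) (x - y) := fun y => by
      by_cases hy : y ∈ S
      · rw [image_eq_zero_of_notMem_tsupport (hfS y hy), zero_smul, zero_smul, map_zero]
      · rw [map_smul]
        congr 1
        exact congrFun (hΦx y hy x) j
    simp only [h2] at h1
    rw [← iteratedFDeriv_under hfc hfs (analytic_Ker lam) j (hfS x x.2)] at h1
    have h3 : (fun x => ∫ y, f y • Ker lam 0 (x - y)) =ᶠ[𝓝 (x : E3)] cst • v := by
      filter_upwards [(isClosed_tsupport f).isOpen_compl.mem_nhds (hfS x x.2), huv x x.2] with z hz hz'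
      have := repr lam hu huc (notMem_tsupport_iff_eventuallyEq.1 hz)
      rw [hz'] at this
      exact this
    rw [(h3.iteratedFDeriv ℝ j).self_of_nhds, iteratedFDeriv_const_smul_apply] at h1
    · exact h1
    · exact (hv.contDiffAt (hΩ.mem_nhds (hSΩ x.2))).of_le (by exact_mod_cast le_top)
  have hcst : 0 < |cst| := abs_pos.2 cst_ne
  obtain ⟨m, hm, hmI⟩ := Metric.mem_closure_iff.1 hI (|cst| * δ) (by positivity)
  obtain ⟨w, hw, hwm⟩ := span_jets hS hSR' k hm
  refine ⟨_, hw.smul cst⁻¹, fun j hj x hx => ?_⟩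
  have h1 := hIx ⟨x, hx⟩ ⟨j, Nat.lt_succ_of_le hj⟩
  have h2 := congrFun (hwm ⟨x, hx⟩) ⟨j, Nat.lt_succ_of_le hj⟩
  have hcw : ContDiffAt ℝ j w x := (hw x (hSR' hx)).1.of_le (by exact_mod_cast le_top)
  have h3 : iteratedFDeriv ℝ j (fun z => cst⁻¹ * w z) x = cst⁻¹ • iteratedFDeriv ℝ j w x :=
    iteratedFDeriv_const_smul_apply (a := cst⁻¹) hcw
  have h4 : iteratedFDeriv ℝ j v x - iteratedFDeriv ℝ j (fun z => cst⁻¹ * w z) x =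
      cst⁻¹ • (cst • iteratedFDeriv ℝ j v x - iteratedFDeriv ℝ j w x) := by
    rw [h3, smul_sub, smul_smul, inv_mul_cancel₀ cst_ne, one_smul]
  have h5 : ‖cst • iteratedFDeriv ℝ j v x - iteratedFDeriv ℝ j w x‖ ≤ dist (∫ y, f y • Φ y) m := by
    rw [dist_eq_norm]
    refine le_trans ?_ (lp.norm_apply_le_norm (by simp) _ (⟨x, hx⟩ : S))
    refine le_trans ?_ (norm_le_pi_norm _ (⟨j, Nat.lt_succ_of_le hj⟩ : Fin (k + 1)))
    rw [lp.coeFn_sub, Pi.sub_apply, Pi.sub_apply, h1, h2]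
    rfl
  rw [h4, norm_smul, norm_inv, Real.norm_eq_abs, inv_mul_lt_iff₀ hcst]
  exact h5.trans_lt hmI

end HelmAux

/-- **Approximation on large balls for the equation `Δv = −λ²v`** (Proposition 8.2).
If `v` satisfies `Δv = −λ²v` (componentwise) in a neighborhood of a compact set
`S ⊆ 𝔹_R` with connected complement, then for any `δ > 0` and `k` there is a field `w`
satisfying the same equation in a neighborhood of the closed ball `𝔹_R` with
`‖v − w‖_{C^k(S)} < δ`. -/
theorem approximation_on_ball_for_helmholtz
    (R : ℝ) (hR : 0 < R)
    (S : Set E3) (hS : IsCompact S) (hScompl : IsConnected Sᶜ)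
    (hSR : S ⊆ Metric.ball (0 : E3) R)
    (lam : ℝ)
    (v : E3 → E3) (Ω : Set E3) (hΩ : IsOpen Ω) (hSΩ : S ⊆ Ω)
    (hv : ContDiffOn ℝ (⊤ : ℕ∞) v Ω)
    (hEq : ∀ x ∈ Ω, ∀ i : Fin 3, lap3 (fun z => v z i) x = -(lam ^ 2) * v x i)
    (δ : ℝ) (hδ : 0 < δ) (k : ℕ) (hk : 0 < k) :
    ∃ (w : E3 → E3) (Ω' : Set E3),
      IsOpen Ω' ∧ Metric.closedBall (0 : E3) R ⊆ Ω' ∧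
      ContDiffOn ℝ (⊤ : ℕ∞) w Ω' ∧
      (∀ x ∈ Ω', ∀ i : Fin 3, lap3 (fun z => w z i) x = -(lam ^ 2) * w x i) ∧
      (∀ j ≤ k, ∀ x ∈ S, ‖iteratedFDeriv ℝ j (fun z => v z - w z) x‖ < δ) := by
  have hvi : ∀ i : Fin 3, ContDiffOn ℝ (⊤ : ℕ∞) (fun z => v z i) Ω := fun i =>
    (EuclideanSpace.proj i : E3 →L[ℝ] ℝ).contDiff.comp_contDiffOn hv
  choose w hw hw' using fun i : Fin 3 => HelmAux.scalar_approx hR hS hScompl hSR lam hΩ hSΩ (hvi i)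
    (fun x hx => hEq x hx i) (δ := δ / 4) (by positivity) k
  let W : E3 → E3 := fun z => WithLp.toLp 2 (fun i => w i z)
  have hWc : ∀ x ∈ Metric.ball (0 : E3) (R + 1), ContDiffAt ℝ (⊤ : ℕ∞) W x := fun x hx =>
    contDiffAt_euclidean.2 fun i => (hw i x hx).1
  refine ⟨W, Metric.ball 0 (R + 1), Metric.isOpen_ball,
    Metric.closedBall_subset_ball (by linarith), fun x hx => (hWc x hx).contDiffWithinAt,
    fun x hx i => (hw i x hx).2, fun j hj x hx => ?_⟩
  have hxb : x ∈ Metric.ball (0 : E3) (R + 1) :=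
    Metric.ball_subset_ball (by linarith) (hSR hx)
  have hvx : ∀ i, ContDiffAt ℝ j (fun z => v z i) x := fun i =>
    ((hvi i).contDiffAt (hΩ.mem_nhds (hSΩ hx))).of_le (by exact_mod_cast le_top)
  have hwx : ∀ i, ContDiffAt ℝ j (w i) x := fun i =>
    (hw i x hxb).1.of_le (by exact_mod_cast le_top)
  let e : Fin 3 → (ℝ →L[ℝ] E3) := fun i =>
    (ContinuousLinearMap.id ℝ ℝ).smulRight (EuclideanSpace.single i (1 : ℝ))
  have he : ∀ i, ‖e i‖ ≤ 1 := fun i => by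
    refine ContinuousLinearMap.opNorm_le_bound _ zero_le_one fun t => ?_
    simp [e, norm_smul]
  have hsum : (fun z => v z - W z) = fun z => ∑ i, e i (v z i - w i z) := by
    funext z
    ext l
    simp [e, W, Fin.sum_univ_three]
    fin_cases l <;> simp
  have hdi : ∀ i, ContDiffAt ℝ j (fun z => v z i - w i z) x := fun i => (hvx i).sub (hwx i)
  have hdei : ∀ i, ContDiffAt ℝ j (fun z => e i (v z i - w i z)) x := fun i =>
    (e i).contDiff.contDiffAt.comp x (hdi i)
  have hb : ∀ i, ‖iteratedFDeriv ℝ j (fun z => e i (v z i - w i z)) x‖ ≤ δ / 4 := fun i => by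
    refine ((e i).norm_iteratedFDeriv_comp_left (hdi i) le_rfl).trans ?_
    have h1 : iteratedFDeriv ℝ j (fun z => v z i - w i z) x =
        iteratedFDeriv ℝ j (fun z => v z i) x - iteratedFDeriv ℝ j (w i) x :=
      iteratedFDeriv_sub_apply (hvx i) (hwx i)
    rw [h1]
    have h2 := (hw' i j hj x hx).le
    have h3 := mul_le_mul (he i) h2 (norm_nonneg _) zero_le_one
    linarith
  rw [hsum]
  have h4 : iteratedFDeriv ℝ j (fun z => ∑ i, e i (v z i - w i z)) x =
      ∑ i, iteratedFDeriv ℝ j (fun z => e i (v z i - w i z)) x := by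
    simp only [Fin.sum_univ_three]
    have a1 := iteratedFDeriv_add_apply (hdei 0) (hdei 1)
    have a2 := iteratedFDeriv_add_apply
      (f := (fun z => e 0 (v z 0 - w 0 z)) + fun z => e 1 (v z 1 - w 1 z))
      ((hdei 0).add (hdei 1)) (hdei 2)
    rw [← a1]
    exact a2
  rw [h4]
  refine (norm_sum_le _ _).trans_lt ?_
  rw [Fin.sum_univ_three]
  linarith [hb 0, hb 1, hb 2]
end
end
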